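/- Let m ≥ 1, n ≥ 1, D ≥ 1 be integers and set k♯ := 2^(D·binom(n+m−1, n)). There exists a constant C♯ depending only on m, n, D such that the following holds. Let E ⊆ ℝ^n be a finite set, and for each x ∈ E let K(x) ⊆ ℝ^D be convex. Suppose that for every subset S ⊆ E with |S| ≤ k♯ there exists F^S ∈ C^m(ℝ^n,ℝ^D) with ‖F^S‖_{C^m(ℝ^n,ℝ^D)} ≤ 1 and F^S(x) ∈ K(x) for all x ∈ S. Then there exists F ∈ C^m(ℝ^n,ℝ^D) with ‖F‖_{C^m(ℝ^n,ℝ^D)} ≤ C♯ and F(x) ∈ K(x) for all x ∈ E. -/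

import Mathlib

open scoped BigOperators Classical

noncomputable section

/-- `En n` is Euclidean space `ℝ^n`. -/
abbrev En (n : ℕ) : Type := EuclideanSpace ℝ (Fin n)

/-- First-order partial derivative `∂_i f` in the `i`-th coordinate direction. -/
noncomputable def pd1 {n : ℕ} (i : Fin n) (f : En n → ℝ) : En n → ℝ :=
  fun x => fderiv ℝ f x (EuclideanSpace.single i 1)

/-- Higher-order partial derivative `∂^α f` for a multi-index `α`. -/
noncomputable def pdalpha {n : ℕ} (α : Fin n → ℕ) (f : En n → ℝ) : En n → ℝ :=
  (List.finRange n).foldr (fun i g => (pd1 i)^[α i] g) f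

/-- First-order partial derivative within a set `s`. -/
noncomputable def pd1W {n : ℕ} (s : Set (En n)) (i : Fin n) (f : En n → ℝ) : En n → ℝ :=
  fun x => fderivWithin ℝ f s x (EuclideanSpace.single i 1)

/-- Higher-order partial derivative `∂^α f` within a set `s`. -/
noncomputable def pdalphaW {n : ℕ} (s : Set (En n)) (α : Fin n → ℕ) (f : En n → ℝ) : En n → ℝ :=
  (List.finRange n).foldr (fun i g => (pd1W s i)^[α i] g) f

/-- `∂^α` of a multivariate polynomial (formal derivative). -/
noncomputable def polyPD {n : ℕ} (α : Fin n → ℕ) (p : MvPolynomial (Fin n) ℝ) :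
    MvPolynomial (Fin n) ℝ :=
  (List.finRange n).foldr (fun i q => (fun r => MvPolynomial.pderiv i r)^[α i] q) p

/-- The value `∂^α p (x)` of the `α`-th derivative of a polynomial at `x`. -/
noncomputable def polyPDval {n : ℕ} (α : Fin n → ℕ) (p : MvPolynomial (Fin n) ℝ) (x : En n) : ℝ :=
  MvPolynomial.eval (fun i => x i) (polyPD α p)

/-- The `(m-1)`-jet (Taylor polynomial of degree `≤ m-1`) of `f` at `x`. -/
noncomputable def jetScalar (m : ℕ) {n : ℕ} (f : En n → ℝ) (x : En n) :
    MvPolynomial (Fin n) ℝ :=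
  ∑ α ∈ (Finset.univ : Finset (Fin n → Fin m)).filter (fun α => (∑ i, (α i : ℕ)) ≤ m - 1),
    MvPolynomial.C (pdalpha (fun i => (α i : ℕ)) f x / ((∏ i, Nat.factorial (α i : ℕ) : ℕ) : ℝ))
      * ∏ i, (MvPolynomial.X i - MvPolynomial.C (x i)) ^ ((α i : ℕ))

/-- The `(m-1)`-jet of `f` at `x`, with derivatives taken within a set `s`. -/
noncomputable def jetScalarW (m : ℕ) {n : ℕ} (s : Set (En n)) (f : En n → ℝ) (x : En n) :
    MvPolynomial (Fin n) ℝ :=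
  ∑ α ∈ (Finset.univ : Finset (Fin n → Fin m)).filter (fun α => (∑ i, (α i : ℕ)) ≤ m - 1),
    MvPolynomial.C (pdalphaW s (fun i => (α i : ℕ)) f x / ((∏ i, Nat.factorial (α i : ℕ) : ℕ) : ℝ))
      * ∏ i, (MvPolynomial.X i - MvPolynomial.C (x i)) ^ ((α i : ℕ))

/-- The vector-valued `(m-1)`-jet `J_x F ∈ 𝒫⃗` of `F : ℝ^n → ℝ^D` at `x`. -/
noncomputable def jetD (m : ℕ) {n D : ℕ} (F : En n → Fin D → ℝ) (x : En n) :
    Fin D → MvPolynomial (Fin n) ℝ :=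
  fun j => jetScalar m (fun y => F y j) x

/-- The vector-valued `(m-1)`-jet of `F` at `x`, derivatives within `s`. -/
noncomputable def jetDW (m : ℕ) {n D : ℕ} (s : Set (En n)) (F : En n → Fin D → ℝ) (x : En n) :
    Fin D → MvPolynomial (Fin n) ℝ :=
  fun j => jetScalarW m s (fun y => F y j) x

/-- Truncation of a polynomial to total degree `≤ k`. -/
noncomputable def truncDeg {n : ℕ} (k : ℕ) (p : MvPolynomial (Fin n) ℝ) :
    MvPolynomial (Fin n) ℝ :=
  ∑ s ∈ p.support.filter (fun s => (s.sum fun _ e => e) ≤ k),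
    MvPolynomial.monomial s (MvPolynomial.coeff s p)

/-- The degree-`k` Taylor truncation of a polynomial at `x` (the jet `J_x p` of order `k`). -/
noncomputable def taylorTrunc {n : ℕ} (k : ℕ) (x : En n) (p : MvPolynomial (Fin n) ℝ) :
    MvPolynomial (Fin n) ℝ :=
  MvPolynomial.bind₁ (fun i => MvPolynomial.X i - MvPolynomial.C (x i))
    (truncDeg k (MvPolynomial.bind₁ (fun i => MvPolynomial.X i + MvPolynomial.C (x i)) p))

/-- The ring multiplication `p ⊙_x q := J_x(pq)` on degree-`k` jets at `x`. -/
noncomputable def odot {n : ℕ} (k : ℕ) (x : En n) (p q : MvPolynomial (Fin n) ℝ) :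
    MvPolynomial (Fin n) ℝ :=
  taylorTrunc k x (p * q)

/-- `(Γ x M)_{x ∈ E, M > 0}` is a shape field with jets of degree `≤ k` and `d` components:
each `Γ x M` is a convex set of `d`-tuples of polynomials of degree `≤ k`, monotone in `M`. -/
def IsShapeField {N : ℕ} (k d : ℕ) (E : Finset (En N))
    (Γ : En N → ℝ → Set (Fin d → MvPolynomial (Fin N) ℝ)) : Prop :=
  (∀ x ∈ E, ∀ M : ℝ, 0 < M → Convex ℝ (Γ x M)) ∧
  (∀ x ∈ E, ∀ M : ℝ, 0 < M → ∀ P ∈ Γ x M, ∀ j, (P j).totalDegree ≤ k) ∧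
  (∀ x ∈ E, ∀ M' M : ℝ, 0 < M' → M' ≤ M → Γ x M' ⊆ Γ x M)

/-- `(C_w, δmax)`-convexity of a shape field with jets of degree `≤ k`. -/
def SFConvex {N : ℕ} (k d : ℕ) (E : Finset (En N))
    (Γ : En N → ℝ → Set (Fin d → MvPolynomial (Fin N) ℝ)) (Cw δmax : ℝ) : Prop :=
  ∀ δ : ℝ, 0 < δ → δ ≤ δmax → ∀ x ∈ E, ∀ M : ℝ, 0 < M →
    ∀ P₁ P₂ : Fin d → MvPolynomial (Fin N) ℝ, P₁ ∈ Γ x M → P₂ ∈ Γ x M →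
    ∀ Q₁ Q₂ : MvPolynomial (Fin N) ℝ, Q₁.totalDegree ≤ k → Q₂.totalDegree ≤ k →
    (∀ α : Fin N → ℕ, (∑ i, α i) ≤ k → ∀ j,
      |polyPDval α (P₁ j - P₂ j) x| ≤ M * δ ^ (k + 1 - ∑ i, α i)) →
    (∀ α : Fin N → ℕ, (∑ i, α i) ≤ k →
      |polyPDval α Q₁ x| ≤ δ ^ (-((∑ i, α i : ℕ) : ℤ)) ∧
      |polyPDval α Q₂ x| ≤ δ ^ (-((∑ i, α i : ℕ) : ℤ))) →
    odot k x Q₁ Q₁ + odot k x Q₂ Q₂ = 1 →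
    (fun j => odot k x (odot k x Q₁ Q₁) (P₁ j) + odot k x (odot k x Q₂ Q₂) (P₂ j))
      ∈ Γ x (Cw * M)

/-- `‖(P^x)_{x ∈ S}‖_{Ẇ^m(S)} ≤ M` : the homogeneous Whitney seminorm bound. -/
def WSemiLE (m : ℕ) {N d : ℕ} (S : Finset (En N))
    (P : En N → Fin d → MvPolynomial (Fin N) ℝ) (M : ℝ) : Prop :=
  ∀ x ∈ S, ∀ y ∈ S, x ≠ y → ∀ α : Fin N → ℕ, (∑ i, α i) ≤ m - 1 → ∀ j,
    |polyPDval α (P x j - P y j) x| ≤ M * dist x y ^ (m - ∑ i, α i)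

/-- The homogeneous Whitney seminorm `‖(P^x)_{x ∈ S}‖_{Ẇ^m(S)}`. -/
noncomputable def WNormHomog (m : ℕ) {N d : ℕ} (S : Finset (En N))
    (P : En N → Fin d → MvPolynomial (Fin N) ℝ) : ℝ :=
  sSup {r : ℝ | ∃ x ∈ S, ∃ y ∈ S, x ≠ y ∧ ∃ α : Fin N → ℕ, (∑ i, α i) ≤ m - 1 ∧ ∃ j : Fin d,
    r = |polyPDval α (P x j - P y j) x| / dist x y ^ (m - ∑ i, α i)}

/-- The lower-order part of the Whitney norm. -/
noncomputable def WNormLow (m : ℕ) {N d : ℕ} (S : Finset (En N))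
    (P : En N → Fin d → MvPolynomial (Fin N) ℝ) : ℝ :=
  sSup {r : ℝ | ∃ x ∈ S, ∃ α : Fin N → ℕ, (∑ i, α i) ≤ m - 1 ∧ ∃ j : Fin d,
    r = |polyPDval α (P x j) x|}

/-- The Whitney norm `‖(P^x)_{x ∈ S}‖_{W^m(S)}`. -/
noncomputable def WNormFull (m : ℕ) {N d : ℕ} (S : Finset (En N))
    (P : En N → Fin d → MvPolynomial (Fin N) ℝ) : ℝ :=
  WNormLow m S P + WNormHomog m S P

/-- `‖F‖_{C^m} ≤ M`: all partials of order `≤ m` of all components bounded by `M`. -/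
def CmLE (m : ℕ) {n D : ℕ} (F : En n → Fin D → ℝ) (M : ℝ) : Prop :=
  ∀ α : Fin n → ℕ, (∑ i, α i) ≤ m → ∀ x : En n, ∀ j, |pdalpha α (fun y => F y j) x| ≤ M

/-- `‖F‖_{Ċ^m} ≤ M`: all partials of order `= m` of all components bounded by `M`. -/
def CmHomogLE (m : ℕ) {n D : ℕ} (F : En n → Fin D → ℝ) (M : ℝ) : Prop :=
  ∀ α : Fin n → ℕ, (∑ i, α i) = m → ∀ x : En n, ∀ j, |pdalpha α (fun y => F y j) x| ≤ M

/-- `‖F‖_{C^{m-1,1}} ≤ M`. -/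
def Cm11LE (m : ℕ) {n D : ℕ} (F : En n → Fin D → ℝ) (M : ℝ) : Prop :=
  (∀ α : Fin n → ℕ, (∑ i, α i) ≤ m - 1 → ∀ x : En n, ∀ j,
    |pdalpha α (fun y => F y j) x| ≤ M) ∧
  (∀ α : Fin n → ℕ, (∑ i, α i) = m - 1 → ∀ j, ∀ x y : En n,
    |pdalpha α (fun z => F z j) x - pdalpha α (fun z => F z j) y| ≤ M * dist x y)

/-- A closed cube in `ℝ^n` with lower corner `a` and side length `δ`. -/
def cube {n : ℕ} (a : En n) (δ : ℝ) : Set (En n) := {y | ∀ i, a i ≤ y i ∧ y i ≤ a i + δ}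

/-- The embedding `ℝ^n → ℝ^{n+D}`, `x ↦ (x, 0)`. -/
noncomputable def embed (n D : ℕ) (x : En n) : En (n + D) :=
  (EuclideanSpace.equiv (Fin (n + D)) ℝ).symm
    (Fin.append (fun i : Fin n => x i) (fun _ : Fin D => (0 : ℝ)))

/-- The projection `ℝ^{n+D} → ℝ^n`, `(x, ξ) ↦ x`. -/
noncomputable def projn (n D : ℕ) (z : En (n + D)) : En n :=
  (EuclideanSpace.equiv (Fin n) ℝ).symm (fun i => z (Fin.castAdd D i))

/-- Restriction of a polynomial on `ℝ^{n+D}` to `ℝ^n × {0}`, as a polynomial on `ℝ^n`. -/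
noncomputable def restrict0 (n D : ℕ) (p : MvPolynomial (Fin (n + D)) ℝ) :
    MvPolynomial (Fin n) ℝ :=
  MvPolynomial.aeval
    (Fin.append (fun i : Fin n => (MvPolynomial.X i : MvPolynomial (Fin n) ℝ))
      (fun _ : Fin D => 0)) p


namespace CmSel

/-- iterated partial derivative along a list of indices -/
def pdl {n : ℕ} (l : List (Fin n)) (f : En n → ℝ) : En n → ℝ := l.foldr pd1 f

lemma pdl_nil {n : ℕ} (f : En n → ℝ) : pdl [] f = f := rfl
lemma pdl_cons {n : ℕ} (i : Fin n) (l : List (Fin n)) (f : En n → ℝ) :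
    pdl (i :: l) f = pd1 i (pdl l f) := rfl

lemma contDiff_pd1 {n : ℕ} {k : ℕ} (i : Fin n) {f : En n → ℝ} (hf : ContDiff ℝ (k+1 : ℕ) f) :
    ContDiff ℝ k (pd1 i f) := by
  have h : ContDiff ℝ k (fderiv ℝ f) := hf.fderiv_right (by norm_cast)
  exact h.clm_apply contDiff_const

lemma contDiff_pdl {n : ℕ} (l : List (Fin n)) : ∀ {k : ℕ} {f : En n → ℝ},
    ContDiff ℝ (k + l.length : ℕ) f → ContDiff ℝ k (pdl l f) := by
  induction l with
  | nil => intro k f hf; rw [pdl_nil]; simpa using hf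
  | cons i l ih =>
    intro k f hf
    rw [pdl_cons]
    apply contDiff_pd1
    apply ih
    convert hf using 2
    simp; ring

lemma pd1_comm {n : ℕ} (i j : Fin n) {f : En n → ℝ} (hf : ContDiff ℝ 2 f) :
    pd1 i (pd1 j f) = pd1 j (pd1 i f) := by
  funext x
  have hd : Differentiable ℝ (fderiv ℝ f) :=
    (hf.fderiv_right (m := 1) (by norm_num)).differentiable (by norm_num)
  have key : ∀ a b : Fin n, pd1 a (pd1 b f) x =
      fderiv ℝ (fderiv ℝ f) x (EuclideanSpace.single a 1) (EuclideanSpace.single b 1) := by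
    intro a b
    unfold pd1
    rw [fderiv_clm_apply (hd x) (by fun_prop)]
    simp
  rw [key, key]
  have hs : IsSymmSndFDerivAt ℝ f x := hf.contDiffAt.isSymmSndFDerivAt (by simp)
  exact hs _ _

lemma pdl_perm {n : ℕ} {l l' : List (Fin n)} (h : l.Perm l') {f : En n → ℝ}
    (hf : ContDiff ℝ l.length f) : pdl l f = pdl l' f := by
  induction h with
  | nil => rfl
  | cons a h ih =>
    rw [pdl_cons, pdl_cons, ih (hf.of_le (by simp))]
  | swap a b l =>
    simp only [pdl_cons]
    apply pd1_comm
    have := contDiff_pdl l (k := 2) (f := f) (by convert hf using 2; simp; ring)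
    exact_mod_cast this
  | trans h1 h2 ih1 ih2 => rw [ih1 hf, ih2 (by rwa [← h1.length_eq])]

/-- list of indices of a multi-index -/
def mlist {n : ℕ} (α : Fin n → ℕ) : List (Fin n) :=
  (List.finRange n).flatMap (fun i => List.replicate (α i) i)

lemma pdl_append {n : ℕ} (l l' : List (Fin n)) (f : En n → ℝ) :
    pdl (l ++ l') f = pdl l (pdl l' f) := by simp [pdl]

lemma pdl_replicate {n : ℕ} (k : ℕ) (i : Fin n) (f : En n → ℝ) :
    pdl (List.replicate k i) f = (pd1 i)^[k] f := by
  induction k with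
  | zero => rfl
  | succ k ih => rw [List.replicate_succ, pdl_cons, ih, Function.iterate_succ_apply']

lemma pdalpha_eq {n : ℕ} (α : Fin n → ℕ) (f : En n → ℝ) : pdalpha α f = pdl (mlist α) f := by
  unfold pdalpha mlist
  induction (List.finRange n) with
  | nil => rfl
  | cons i l ih => simp [List.flatMap_cons, pdl_append, pdl_replicate, ih]

lemma count_mlist {n : ℕ} (α : Fin n → ℕ) (i : Fin n) : (mlist α).count i = α i := by
  unfold mlist
  rw [List.count_flatMap]
  simp only [Function.comp_def, List.count_replicate]
  have : ∀ l : List (Fin n), l.Nodup → (l.map (fun a => if (a == i) = true then α a else 0)).sum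
      = if i ∈ l then α i else 0 := by
    intro l
    induction l with
    | nil => simp
    | cons a l ih =>
      intro h
      rw [List.nodup_cons] at h
      simp only [List.map_cons, List.sum_cons, ih h.2, List.mem_cons]
      by_cases hai : a = i
      · subst hai; simp [h.1]
      · simp [hai, Ne.symm hai]
  rw [this _ (List.nodup_finRange n)]
  simp

lemma length_eq_sum_count {n : ℕ} (l : List (Fin n)) : l.length = ∑ i, l.count i := by
  induction l with
  | nil => simp
  | cons a l ih => simp [List.count_cons, Finset.sum_add_distrib, ih]

lemma length_mlist {n : ℕ} (α : Fin n → ℕ) : (mlist α).length = ∑ i, α i := by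
  rw [length_eq_sum_count]; simp [count_mlist]

lemma pdl_eq_pdalpha {n : ℕ} (l : List (Fin n)) {f : En n → ℝ} (hf : ContDiff ℝ l.length f) :
    pdl l f = pdalpha (fun i => l.count i) f := by
  rw [pdalpha_eq]
  apply pdl_perm _ hf
  rw [List.perm_iff_count]
  intro a; rw [count_mlist]

lemma iter_basis {n : ℕ} (k : ℕ) : ∀ {f : En n → ℝ}, ContDiff ℝ k f → ∀ (ι : Fin k → Fin n) (x : En n),
    iteratedFDeriv ℝ k f x (fun i => EuclideanSpace.single (ι i) 1) = pdl (List.ofFn ι) f x := by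
  induction k with
  | zero => intro f hf ι x; simp [pdl]
  | succ k ih =>
    intro f hf ι x
    rw [iteratedFDeriv_succ_apply_left, List.ofFn_succ, pdl_cons]
    have hk : ContDiff ℝ k f := hf.of_le (by norm_cast; omega)
    have h2 : (pdl (List.ofFn fun i => ι i.succ) f) = fun y => iteratedFDeriv ℝ k f y
        (fun i => EuclideanSpace.single (ι i.succ) 1) := by
      funext y; rw [ih hk]
    rw [h2]; unfold pd1
    have hd : DifferentiableAt ℝ (iteratedFDeriv ℝ k f) x :=
      (hf.differentiable_iteratedFDeriv (by norm_cast; omega)) x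
    have : (fun y => iteratedFDeriv ℝ k f y (fun i => EuclideanSpace.single (ι i.succ) 1)) =
      (fun L : ContinuousMultilinearMap ℝ (fun _ : Fin k => En n) ℝ =>
        ContinuousMultilinearMap.apply ℝ (fun _ : Fin k => En n) ℝ
          (fun i => EuclideanSpace.single (ι i.succ) 1) L) ∘ (iteratedFDeriv ℝ k f) := by
      funext y; rfl
    rw [this]
    have h3 := ((ContinuousMultilinearMap.apply ℝ (fun _ : Fin k => En n) ℝ
          (fun i => EuclideanSpace.single (ι i.succ) 1)).hasFDerivAt.comp x hd.hasFDerivAt).fderiv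
    erw [h3]
    rfl

/-- norm bound of multilinear map by its values on the standard basis -/
lemma multilin_bound {n k : ℕ} (g : ContinuousMultilinearMap ℝ (fun _ : Fin k => En n) ℝ) {M : ℝ}
    (hM : 0 ≤ M)
    (h : ∀ ι : Fin k → Fin n, |g (fun i => EuclideanSpace.single (ι i) 1)| ≤ M) :
    ‖g‖ ≤ (n : ℝ) ^ k * M := by
  apply ContinuousMultilinearMap.opNorm_le_bound (by positivity)
  intro v
  have hv : v = fun i => ∑ a : Fin n, (v i a) • (EuclideanSpace.single a (1:ℝ) : En n) := by
    funext i
    ext b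
    simp [Pi.single_apply]
  conv_lhs => rw [hv]
  rw [g.map_sum]
  simp_rw [g.map_smul_univ]
  calc ‖∑ ι : Fin k → Fin n, (∏ i, v i (ι i)) • g (fun i => EuclideanSpace.single (ι i) 1)‖
      ≤ ∑ ι : Fin k → Fin n, ‖(∏ i, v i (ι i)) • g (fun i => EuclideanSpace.single (ι i) 1)‖ :=
        norm_sum_le _ _
    _ ≤ ∑ ι : Fin k → Fin n, (∏ i, ‖v i‖) * M := by
        apply Finset.sum_le_sum
        intro ι _
        rw [norm_smul, norm_prod]
        gcongr with i _
        · exact PiLp.norm_apply_le (v i) (ι i)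
        · exact h ι
    _ = (n : ℝ) ^ k * M * ∏ i, ‖v i‖ := by
        simp; ring

lemma iter_apply {n D k : ℕ} {F : En n → Fin D → ℝ} (hF : ContDiff ℝ k F) (x : En n)
    (v : Fin k → En n) (j : Fin D) :
    iteratedFDeriv ℝ k (fun y => F y j) x v = iteratedFDeriv ℝ k F x v j := by
  have := (ContinuousLinearMap.proj (R := ℝ) (φ := fun _ : Fin D => ℝ) j).iteratedFDeriv_comp_left
    (f := F) (x := x) (n := k) hF.contDiffAt (i := k) le_rfl
  have h2 : (fun y => F y j) = (ContinuousLinearMap.proj (R := ℝ) (φ := fun _ : Fin D => ℝ) j) ∘ F := rfl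
  rw [h2, this]; rfl

lemma comp_contDiff {n D : ℕ} {k : WithTop ℕ∞} {F : En n → Fin D → ℝ} (hF : ContDiff ℝ k F) (j : Fin D) :
    ContDiff ℝ k (fun y => F y j) := (contDiff_pi.1 hF) j

lemma vec_multilin_bound {n D k : ℕ} {F : En n → Fin D → ℝ} (hF : ContDiff ℝ k F) (x : En n) {M : ℝ}
    (hM : 0 ≤ M)
    (h : ∀ α : Fin n → ℕ, ∑ i, α i = k → ∀ j, |pdalpha α (fun y => F y j) x| ≤ M) :
    ‖iteratedFDeriv ℝ k F x‖ ≤ (n : ℝ) ^ k * M := by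
  apply ContinuousMultilinearMap.opNorm_le_bound (by positivity)
  intro v
  rw [pi_norm_le_iff_of_nonneg (by positivity)]
  intro j
  rw [← iter_apply hF]
  refine (ContinuousMultilinearMap.le_opNorm _ _).trans ?_
  gcongr
  apply multilin_bound _ hM
  intro ι
  rw [iter_basis k (comp_contDiff hF j), pdl_eq_pdalpha]
  · apply h
    rw [← length_eq_sum_count]; simp
  · simpa using comp_contDiff hF j

lemma pdalpha_iter {n k : ℕ} {f : En n → ℝ} (hf : ContDiff ℝ k f) (α : Fin n → ℕ)
    (hα : ∑ i, α i = k) (x : En n) : ∃ ι : Fin k → Fin n, pdalpha α f x =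
      iteratedFDeriv ℝ k f x (fun i => EuclideanSpace.single (ι i) 1) := by
  subst hα
  rw [← length_mlist] at hf ⊢
  refine ⟨fun i => (mlist α).get i, ?_⟩
  rw [iter_basis _ hf, List.ofFn_get, pdalpha_eq]

lemma pdalpha_le {n D k : ℕ} {F : En n → Fin D → ℝ} (hF : ContDiff ℝ k F) (α : Fin n → ℕ)
    (hα : ∑ i, α i = k) (x : En n) (j : Fin D) :
    |pdalpha α (fun y => F y j) x| ≤ ‖iteratedFDeriv ℝ k F x‖ := by
  obtain ⟨ι, h⟩ := pdalpha_iter (comp_contDiff hF j) α hα x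
  rw [h, iter_apply hF]
  refine (norm_le_pi_norm (iteratedFDeriv ℝ k F x (fun i => EuclideanSpace.single (ι i) 1)) j).trans ?_
  refine (ContinuousMultilinearMap.le_opNorm _ _).trans ?_
  simp

/-- norm bound -/
def NB (m : ℕ) {n D : ℕ} (F : En n → Fin D → ℝ) (M : ℝ) : Prop :=
  ContDiff ℝ m F ∧ ∀ k ≤ m, ∀ y, ‖iteratedFDeriv ℝ k F y‖ ≤ M

lemma NB.cmLE {m n D : ℕ} {F : En n → Fin D → ℝ} {M : ℝ} (h : NB m F M) : CmLE m F M := by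
  intro α hα x j
  exact (pdalpha_le (h.1.of_le (by exact_mod_cast hα)) α rfl x j).trans (h.2 _ hα x)

lemma NB_of_cmLE {m n D : ℕ} (hn : 1 ≤ n) {F : En n → Fin D → ℝ} {M : ℝ} (hM : 0 ≤ M)
    (hF : ContDiff ℝ m F) (h : CmLE m F M) : NB m F ((n:ℝ)^m * M) := by
  refine ⟨hF, fun k hk y => ?_⟩
  refine (vec_multilin_bound (hF.of_le (by exact_mod_cast hk)) y hM
    (fun α hα j => h α (by omega) y j)).trans ?_
  have : (1:ℝ) ≤ n := by exact_mod_cast hn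
  gcongr

end CmSel

namespace CmSel

def miSet (m n : ℕ) : Finset (Fin n → ℕ) :=
  (Fintype.piFinset fun _ => Finset.range m).filter (fun α => ∑ i, α i < m)

lemma mem_miSet {m n : ℕ} {α : Fin n → ℕ} : α ∈ miSet m n ↔ ∑ i, α i < m := by
  unfold miSet
  simp only [Finset.mem_filter, Fintype.mem_piFinset, Finset.mem_range, and_iff_right_iff_imp]
  intro h i
  exact (Finset.single_le_sum (f := α) (fun _ _ => Nat.zero_le _) (Finset.mem_univ i)).trans_lt h

abbrev MI (m n : ℕ) : Type := {α : Fin n → ℕ // α ∈ miSet m n}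
abbrev Ix (m n D : ℕ) : Type := MI m n × Fin D
abbrev Jt (m n D : ℕ) : Type := Ix m n D → ℝ

def od {m n D : ℕ} (b : Ix m n D) : ℕ := ∑ i, b.1.1 i
lemma od_lt {m n D : ℕ} (b : Ix m n D) : od b < m := mem_miSet.1 b.1.2

def TT {n : ℕ} (h : En n) (β α : Fin n → ℕ) : ℝ :=
  ∏ i, ((α i).choose (β i) : ℝ) * (h i) ^ (α i - β i)

lemma TT_eq_zero {n : ℕ} (h : En n) {β α : Fin n → ℕ} (hb : ¬ β ≤ α) : TT h β α = 0 := by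
  rw [Pi.le_def] at hb
  push Not at hb
  obtain ⟨i, hi⟩ := hb
  apply Finset.prod_eq_zero (Finset.mem_univ i)
  rw [Nat.choose_eq_zero_of_lt hi]; simp

lemma TT_zero {n : ℕ} (β α : Fin n → ℕ) : TT (0 : En n) β α = if β = α then 1 else 0 := by
  by_cases hb : β ≤ α
  · split_ifs with h
    · subst h; simp [TT]
    · have : ∃ i, β i ≠ α i := by
        by_contra hc; push Not at hc; exact h (funext hc)
      obtain ⟨i, hi⟩ := this
      apply Finset.prod_eq_zero (Finset.mem_univ i)
      have h1 : β i ≤ α i := hb i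
      have : α i - β i ≠ 0 := by omega
      simp [this]
  · rw [TT_eq_zero _ hb, if_neg]
    rintro rfl; exact hb le_rfl

lemma oneD (a c m : ℕ) (ha : a < m) (s t : ℝ) :
    ∑ b ∈ Finset.range m, ((b.choose c : ℝ) * s ^ (b - c)) * ((a.choose b : ℝ) * t ^ (a - b)) =
      (a.choose c : ℝ) * (s + t) ^ (a - c) := by
  by_cases hc : c ≤ a
  · have h1 : Finset.Ico c (a+1) ⊆ Finset.range m := by
      intro b; simp; omega
    rw [← Finset.sum_subset h1]
    · rw [Finset.sum_Ico_eq_sum_range, add_pow, Finset.mul_sum]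
      have : a + 1 - c = a - c + 1 := by omega
      rw [this]
      apply Finset.sum_congr rfl
      intro k hk
      simp only [Finset.mem_range] at hk
      have e : (a.choose (c+k)) * ((c+k).choose c) = a.choose c * (a-c).choose k := by
        rw [Nat.choose_mul (by omega)]; congr 2; omega
      have e' : ((a.choose (c+k) : ℝ)) * ((c+k).choose c) = a.choose c * (a-c).choose k := by
        exact_mod_cast e
      have e2 : c + k - c = k := by omega
      have e3 : a - (c + k) = a - c - k := by omega
      rw [e2, e3]
      linear_combination (s^k * t^(a-c-k)) * e'
    · intro b _ hb
      simp only [Finset.mem_Ico, not_and_or, not_le, not_lt] at hb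
      rcases hb with hb | hb
      · rw [Nat.choose_eq_zero_of_lt hb]; simp
      · rw [Nat.choose_eq_zero_of_lt (n := a) (by omega)]; simp
  · push Not at hc
    rw [Nat.choose_eq_zero_of_lt hc, Finset.sum_eq_zero]
    · simp
    intro b _
    rcases lt_or_ge b c with h | h
    · rw [Nat.choose_eq_zero_of_lt h]; simp
    · rw [Nat.choose_eq_zero_of_lt (n := a) (by omega)]; simp

lemma TT_comp {m n : ℕ} (h h' : En n) (γ α : Fin n → ℕ) (hα : α ∈ miSet m n) :
    ∑ β : MI m n, TT h γ β.1 * TT h' β.1 α = TT (h + h') γ α := by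
  have e1 : ∑ β : MI m n, TT h γ β.1 * TT h' β.1 α = ∑ β ∈ miSet m n, TT h γ β * TT h' β α :=
    Finset.sum_coe_sort (miSet m n) (fun β => TT h γ β * TT h' β α)
  have hs : miSet m n ⊆ Fintype.piFinset fun _ : Fin n => Finset.range m := Finset.filter_subset _ _
  rw [e1, Finset.sum_subset hs]
  · unfold TT
    simp_rw [← Finset.prod_mul_distrib]
    rw [← Finset.prod_univ_sum (fun _ => Finset.range m)
      (fun i b => ((b.choose (γ i) : ℝ) * (h i) ^ (b - γ i)) * (((α i).choose b : ℝ) * (h' i) ^ (α i - b)))]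
    apply Finset.prod_congr rfl
    intro i _
    rw [oneD]
    · rfl
    · exact (Finset.mem_range.1 (Fintype.mem_piFinset.1 (hs hα) i))
  · intro β _ hb
    rw [TT_eq_zero h' (β := β), mul_zero]
    intro hle
    apply hb
    rw [mem_miSet] at hα ⊢
    exact (Finset.sum_le_sum (fun i _ => hle i)).trans_lt hα

lemma TT_bound {n : ℕ} (h : En n) {β α : Fin n → ℕ} {t : ℝ} (ht : ‖h‖ ≤ t) (hb : β ≤ α) :
    |TT h β α| ≤ 2 ^ (∑ i, α i) * t ^ (∑ i, α i - ∑ i, β i) := by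
  unfold TT
  have ht0 : 0 ≤ t := (norm_nonneg h).trans ht
  rw [Finset.abs_prod]
  have e : ∑ i, α i - ∑ i, β i = ∑ i, (α i - β i) := by
    have := Finset.sum_add_distrib (s := Finset.univ) (f := fun i => α i - β i) (g := β)
    have h2 : ∑ i, (α i - β i + β i) = ∑ i, α i :=
      Finset.sum_congr rfl (fun i _ => Nat.sub_add_cancel (hb i))
    omega
  rw [e, ← Finset.prod_pow_eq_pow_sum, ← Finset.prod_pow_eq_pow_sum, ← Finset.prod_mul_distrib]
  apply Finset.prod_le_prod
  · intros; positivity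
  · intro i _
    rw [abs_mul, abs_pow]
    gcongr
    · rw [abs_of_nonneg (by positivity)]
      exact_mod_cast Nat.choose_le_two_pow _ _
    · exact (PiLp.norm_apply_le h i).trans ht

/-- coefficient at `y` of the polynomial with coefficients `p` at the origin -/
def cof {m n D : ℕ} (y : En n) (p : Jt m n D) (β : Fin n → ℕ) (j : Fin D) : ℝ :=
  ∑ α : MI m n, TT y β α.1 * p (α, j)

def co {m n D : ℕ} (y : En n) : Jt m n D →ₗ[ℝ] Jt m n D where
  toFun p := fun b => cof y p b.1.1 b.2
  map_add' p q := by
    funext b; simp [cof, mul_add, Finset.sum_add_distrib]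
  map_smul' c p := by
    funext b; simp only [cof, Pi.smul_apply, smul_eq_mul, Finset.mul_sum, RingHom.id_apply]
    apply Finset.sum_congr rfl; intros; ring

lemma co_apply {m n D : ℕ} (y : En n) (p : Jt m n D) (b : Ix m n D) :
    co y p b = cof y p b.1.1 b.2 := rfl

lemma cof_co {m n D : ℕ} (x y : En n) (p : Jt m n D) (β : Fin n → ℕ) (j : Fin D) :
    cof x (co y p) β j = cof (x + y) p β j := by
  simp only [cof, co_apply]
  simp_rw [Finset.mul_sum]
  rw [Finset.sum_comm]
  apply Finset.sum_congr rfl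
  intro α _
  rw [← TT_comp (m := m) x y β α.1 α.2, Finset.sum_mul]
  apply Finset.sum_congr rfl; intros; ring

lemma co_co {m n D : ℕ} (x y : En n) (p : Jt m n D) : co x (co y p) = co (x + y) p := by
  funext b; rw [co_apply, cof_co]; rfl

lemma co_zero {m n D : ℕ} (p : Jt m n D) : co 0 p = p := by
  funext b
  simp only [co_apply, cof, TT_zero]
  have : ∀ α : MI m n, (if b.1.1 = α.1 then (1:ℝ) else 0) * p (α, b.2) =
      if b.1 = α then p (α, b.2) else 0 := by
    intro α
    by_cases h : b.1 = α
    · simp [h]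
    · have : b.1.1 ≠ α.1 := fun h' => h (Subtype.ext h')
      simp [h, this]
  simp_rw [this]
  simp

lemma co_neg {m n D : ℕ} (x : En n) (p : Jt m n D) : co x (co (-x) p) = p := by
  rw [co_co, add_neg_cancel, co_zero]
lemma co_neg' {m n D : ℕ} (x : En n) (p : Jt m n D) : co (-x) (co x p) = p := by
  rw [co_co, neg_add_cancel, co_zero]
lemma co_inj {m n D : ℕ} (x : En n) {p q : Jt m n D} (h : co x p = co x q) : p = q := by
  rw [← co_neg' x p, h, co_neg']

/-- recentring -/
lemma co_move {m n D : ℕ} (x y : En n) (p : Jt m n D) (b : Ix m n D) :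
    co y p b = ∑ α : MI m n, TT (y - x) b.1.1 α.1 * co x p (α, b.2) := by
  have : co y p = co (y - x) (co x p) := by rw [co_co]; congr 2; abel
  rw [this]; rfl

def Mono {m n D : ℕ} (A : Finset (Ix m n D)) : Prop :=
  ∀ a ∈ A, ∀ b : Ix m n D, b.2 = a.2 → a.1.1 ≤ b.1.1 → b ∈ A

lemma co_zero_on {m n D : ℕ} {A : Finset (Ix m n D)} (hA : Mono A) {x : En n} {p : Jt m n D}
    (h : ∀ a ∈ A, co x p a = 0) (y : En n) : ∀ a ∈ A, co y p a = 0 := by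
  intro a ha
  rw [co_move x y]
  apply Finset.sum_eq_zero
  intro α _
  by_cases hle : a.1.1 ≤ α.1
  · rw [h (α, a.2) (hA a ha _ rfl hle), mul_zero]
  · rw [TT_eq_zero _ hle, zero_mul]

def Bd {m n D : ℕ} (x : En n) (δ R : ℝ) (p : Jt m n D) : Prop :=
  ∀ b, |co x p b| ≤ R * δ ^ (m - od b)

lemma Bd.add {m n D : ℕ} {x : En n} {δ R S : ℝ} {p q : Jt m n D} (hp : Bd x δ R p) (hq : Bd x δ S q) :
    Bd x δ (R + S) (p + q) := by
  intro b
  rw [map_add, Pi.add_apply, add_mul]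
  exact (abs_add_le _ _).trans (add_le_add (hp b) (hq b))
lemma Bd.neg {m n D : ℕ} {x : En n} {δ R : ℝ} {p : Jt m n D} (hp : Bd x δ R p) : Bd x δ R (-p) := by
  intro b
  rw [map_neg, Pi.neg_apply, abs_neg]; exact hp b
lemma Bd.sub {m n D : ℕ} {x : En n} {δ R S : ℝ} {p q : Jt m n D} (hp : Bd x δ R p) (hq : Bd x δ S q) :
    Bd x δ (R + S) (p - q) := by
  rw [sub_eq_add_neg]; exact hp.add hq.neg
lemma Bd.symm {m n D : ℕ} {x : En n} {δ R : ℝ} {p q : Jt m n D} (hp : Bd x δ R (p - q)) :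
    Bd x δ R (q - p) := by
  rw [← neg_sub]; exact hp.neg
lemma Bd.tri {m n D : ℕ} {x : En n} {δ R S : ℝ} {p q r : Jt m n D} (hp : Bd x δ R (p - q))
    (hq : Bd x δ S (q - r)) : Bd x δ (R + S) (p - r) := by
  have := hp.add hq; rwa [sub_add_sub_cancel] at this
lemma Bd.smul {m n D : ℕ} {x : En n} {δ R : ℝ} {p : Jt m n D} (hp : Bd x δ R p) (c : ℝ) :
    Bd x δ (|c| * R) (c • p) := by
  intro b
  rw [map_smul, Pi.smul_apply, smul_eq_mul, abs_mul, mul_assoc]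
  exact mul_le_mul_of_nonneg_left (hp b) (abs_nonneg _)
lemma Bd.mono {m n D : ℕ} {x : En n} {δ R S : ℝ} {p : Jt m n D} (hp : Bd x δ R p) (hδ : 0 ≤ δ)
    (h : R ≤ S) : Bd x δ S p := fun b => (hp b).trans (by gcongr)
lemma Bd.scale {m n D : ℕ} {x : En n} {δ δ' R : ℝ} {p : Jt m n D} (hp : Bd x δ R p) (hR : 0 ≤ R)
    (hδ : 0 ≤ δ) (h : δ ≤ δ') : Bd x δ' R p := fun b => (hp b).trans (by gcongr)
lemma Bd.zero {m n D : ℕ} {x : En n} {δ : ℝ} (hδ : 0 ≤ δ) {R : ℝ} (hR : 0 ≤ R) :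
    Bd x δ R (0 : Jt m n D) := by
  intro b; simp; positivity

def CM (m n : ℕ) : ℝ := Fintype.card (MI m n) * 2 ^ m + 1
lemma CM_ge (m n : ℕ) : 1 ≤ CM m n := by unfold CM; simp

lemma Bd.move {m n D : ℕ} {x y : En n} {δ R K : ℝ} {p : Jt m n D} (hp : Bd x δ R p) (hR : 0 ≤ R)
    (hδ : 0 ≤ δ) (hK : 1 ≤ K) (h : ‖y - x‖ ≤ K * δ) : Bd y δ (CM m n * K ^ m * R) p := by
  intro b
  rw [co_move x y]
  refine (Finset.abs_sum_le_sum_abs _ _).trans ?_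
  have : ∀ α : MI m n, |TT (y - x) b.1.1 α.1 * co x p (α, b.2)| ≤ 2 ^ m * K ^ m * R * δ ^ (m - od b) := by
    intro α
    by_cases hle : b.1.1 ≤ α.1
    · have hα := mem_miSet.1 α.2
      have hbα : od b ≤ ∑ i, α.1 i := Finset.sum_le_sum (fun i _ => hle i)
      rw [abs_mul]
      calc |TT (y - x) b.1.1 α.1| * |co x p (α, b.2)|
          ≤ (2 ^ (∑ i, α.1 i) * (K * δ) ^ (∑ i, α.1 i - od b)) * (R * δ ^ (m - ∑ i, α.1 i)) := by
            gcongr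
            · exact TT_bound _ h hle
            · exact hp (α, b.2)
        _ = 2 ^ (∑ i, α.1 i) * K ^ (∑ i, α.1 i - od b) * R * (δ ^ (∑ i, α.1 i - od b) * δ ^ (m - ∑ i, α.1 i)) := by
            rw [mul_pow]; ring
        _ ≤ _ := by
            rw [← pow_add]
            have : ∑ i, α.1 i - od b + (m - ∑ i, α.1 i) = m - od b := by omega
            rw [this]
            have h2 : (1:ℝ) ≤ 2 := by norm_num
            gcongr
            omega
    · rw [TT_eq_zero _ hle, zero_mul, abs_zero]; positivity
  refine (Finset.sum_le_sum (fun α _ => this α)).trans ?_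
  simp only [Finset.sum_const, Finset.card_univ, nsmul_eq_mul, CM]
  have h1 : 0 ≤ K ^ m * R * δ ^ (m - od b) := by positivity
  linarith

lemma Bd.move_refined {m n D : ℕ} {x y : En n} {δ R s : ℝ} {p : Jt m n D} (hp : Bd x δ R p) (hR : 0 ≤ R)
    (hδ : 0 ≤ δ) (hs : 0 ≤ s) (hs1 : s ≤ 1) (h : ‖y - x‖ ≤ s * δ) (b : Ix m n D) :
    |co y p b - co x p b| ≤ CM m n * s * R * δ ^ (m - od b) := by
  have e : co y p b - co x p b = ∑ α ∈ Finset.univ.erase b.1, TT (y - x) b.1.1 α.1 * co x p (α, b.2) := by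
    rw [co_move x y, ← Finset.add_sum_erase _ _ (Finset.mem_univ b.1)]
    simp [TT]
  rw [e]
  refine (Finset.abs_sum_le_sum_abs _ _).trans ?_
  have : ∀ α ∈ Finset.univ.erase b.1,
      |TT (y - x) b.1.1 α.1 * co x p (α, b.2)| ≤ 2 ^ m * s * R * δ ^ (m - od b) := by
    intro α hne
    by_cases hle : b.1.1 ≤ α.1
    · have hα := mem_miSet.1 α.2
      have hbα : od b < ∑ i, α.1 i := by
        apply Finset.sum_lt_sum (fun i _ => hle i)
        by_contra hc
        push Not at hc
        exact (Finset.ne_of_mem_erase hne) (Subtype.ext (funext fun i => le_antisymm (hc i (Finset.mem_univ i)) (hle i)))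
      rw [abs_mul]
      calc |TT (y - x) b.1.1 α.1| * |co x p (α, b.2)|
          ≤ (2 ^ (∑ i, α.1 i) * (s * δ) ^ (∑ i, α.1 i - od b)) * (R * δ ^ (m - ∑ i, α.1 i)) := by
            gcongr
            · exact TT_bound _ h hle
            · exact hp (α, b.2)
        _ = 2 ^ (∑ i, α.1 i) * s ^ (∑ i, α.1 i - od b) * R * (δ ^ (∑ i, α.1 i - od b) * δ ^ (m - ∑ i, α.1 i)) := by
            rw [mul_pow]; ring
        _ ≤ _ := by
            rw [← pow_add]
            have : ∑ i, α.1 i - od b + (m - ∑ i, α.1 i) = m - od b := by omega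
            rw [this]
            have h2 : (1:ℝ) ≤ 2 := by norm_num
            have h3 : s ^ (∑ i, α.1 i - od b) ≤ s := by
              calc s ^ (∑ i, α.1 i - od b) ≤ s ^ 1 := pow_le_pow_of_le_one hs hs1 (by omega)
                _ = s := pow_one s
            gcongr
    · rw [TT_eq_zero _ hle, zero_mul, abs_zero]; positivity
  refine (Finset.sum_le_sum this).trans ?_
  rw [Finset.sum_const, nsmul_eq_mul]
  have h1 : 0 ≤ s * R * δ ^ (m - od b) := by positivity
  have h2 : ((Finset.univ.erase b.1).card : ℝ) ≤ Fintype.card (MI m n) := by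
    exact_mod_cast (Finset.card_le_univ _)
  calc _ ≤ (Fintype.card (MI m n) : ℝ) * (2 ^ m * s * R * δ ^ (m - od b)) := by gcongr
    _ ≤ _ := by unfold CM; nlinarith

/-- count bound -/
lemma card_MI_le (m n : ℕ) (hm : 1 ≤ m) : Fintype.card (MI m n) ≤ (n + m - 1).choose n := by
  let f : MI m n → Sym (Option (Fin n)) (m - 1) := fun α =>
    ⟨(∑ i, Multiset.replicate (α.1 i) (some i)) + Multiset.replicate (m - 1 - ∑ i, α.1 i) none, by
      have := mem_miSet.1 α.2
      simp; omega⟩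
  have hf : Function.Injective f := by
    intro α β h
    apply Subtype.ext; funext i
    have h1 := congrArg (fun s : Sym (Option (Fin n)) (m-1) => Multiset.count (some i) s.1) h
    simpa [f, Multiset.count_sum', Multiset.count_replicate] using h1
  have := Fintype.card_le_of_injective f hf
  rw [Sym.card_sym_eq_choose] at this
  refine this.trans ?_
  simp only [Fintype.card_option, Fintype.card_fin]
  have e : n + 1 + (m - 1) - 1 = n + m - 1 := by omega
  rw [e, ← Nat.choose_symm (by omega)]
  apply le_of_eq; congr 1; omega

lemma card_Ix_le (m n D : ℕ) (hm : 1 ≤ m) : Fintype.card (Ix m n D) ≤ D * (n + m - 1).choose n := by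
  rw [Fintype.card_prod, Fintype.card_fin, mul_comm]
  exact Nat.mul_le_mul_left _ (card_MI_le m n hm)

end CmSel

namespace CmSel

def pl {m n D : ℕ} (p : Jt m n D) (y : En n) : Fin D → ℝ := fun j => cof y p 0 j

lemma contDiff_TT {n : ℕ} (β α : Fin n → ℕ) (k : WithTop ℕ∞) : ContDiff ℝ k (fun y : En n => TT y β α) := by
  unfold TT
  fun_prop

lemma contDiff_cof {m n D : ℕ} (p : Jt m n D) (β : Fin n → ℕ) (j : Fin D) (k : WithTop ℕ∞) :
    ContDiff ℝ k (fun y : En n => cof y p β j) := by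
  unfold cof
  exact ContDiff.sum (fun α _ => (contDiff_TT β α.1 k).mul contDiff_const)

lemma contDiff_pl {m n D : ℕ} (p : Jt m n D) (k : WithTop ℕ∞) : ContDiff ℝ k (pl p) := by
  rw [contDiff_pi]; intro j; exact contDiff_cof p 0 j k

def plL {m n D : ℕ} (y : En n) : Jt m n D →ₗ[ℝ] (Fin D → ℝ) where
  toFun p := pl p y
  map_add' p q := by
    funext b; simp [pl, cof, mul_add, Finset.sum_add_distrib]
  map_smul' c p := by
    funext b; simp only [pl, cof, Pi.smul_apply, smul_eq_mul, Finset.mul_sum, RingHom.id_apply]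
    apply Finset.sum_congr rfl; intros; ring

lemma pl_add {m n D : ℕ} (p q : Jt m n D) : pl (p + q) = pl p + pl q := by
  funext y; exact map_add (plL y) p q
lemma pl_sub {m n D : ℕ} (p q : Jt m n D) : pl (p - q) = pl p - pl q := by
  funext y; exact map_sub (plL y) p q
lemma pl_smul {m n D : ℕ} (c : ℝ) (p : Jt m n D) : pl (c • p) = c • pl p := by
  funext y; exact map_smul (plL y) c p
lemma pl_zero {m n D : ℕ} : pl (0 : Jt m n D) = 0 := by
  funext y; exact map_zero (plL y)

lemma TT_deriv {n : ℕ} (β α : Fin n → ℕ) (i : Fin n) (y : En n) :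
    HasDerivAt (fun t : ℝ => TT (y + t • (EuclideanSpace.single i 1 : En n)) β α)
      ((β i + 1 : ℝ) * TT y (β + Pi.single i 1) α) 0 := by
  have e : ∀ t : ℝ, TT (y + t • (EuclideanSpace.single i 1 : En n)) β α =
      (((α i).choose (β i) : ℝ) * (y i + t) ^ (α i - β i)) *
      ∏ k ∈ Finset.univ.erase i, ((α k).choose (β k) : ℝ) * (y k) ^ (α k - β k) := by
    intro t
    unfold TT
    rw [← Finset.mul_prod_erase _ _ (Finset.mem_univ i)]
    congr 1
    · simp
    · apply Finset.prod_congr rfl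
      intro k hk
      have : k ≠ i := Finset.ne_of_mem_erase hk
      simp [this]
  have e2 : TT y (β + Pi.single i 1) α = (((α i).choose (β i + 1) : ℝ) * (y i) ^ (α i - (β i + 1))) *
      ∏ k ∈ Finset.univ.erase i, ((α k).choose (β k) : ℝ) * (y k) ^ (α k - β k) := by
    unfold TT
    rw [← Finset.mul_prod_erase _ _ (Finset.mem_univ i)]
    congr 1
    · simp
    · apply Finset.prod_congr rfl
      intro k hk
      have : k ≠ i := Finset.ne_of_mem_erase hk
      simp [this]
  simp_rw [e]
  rw [e2]
  have hd : HasDerivAt (fun t : ℝ => (y i + t) ^ (α i - β i)) ((α i - β i : ℕ) * (y i + 0) ^ (α i - β i - 1)) 0 := by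
    have h1 : HasDerivAt (fun t : ℝ => y i + t) 1 0 := (hasDerivAt_id (0:ℝ)).const_add _
    have h2 := h1.fun_pow (α i - β i)
    rw [mul_one] at h2
    exact h2
  have h := ((hd.const_mul ((α i).choose (β i) : ℝ)).mul_const
    (∏ k ∈ Finset.univ.erase i, ((α k).choose (β k) : ℝ) * (y k) ^ (α k - β k)))
  refine h.congr_deriv ?_
  have e3 : ((α i).choose (β i + 1)) * (β i + 1) = (α i).choose (β i) * (α i - β i) :=
    Nat.choose_succ_right_eq _ _
  have e4 : ((α i).choose (β i + 1) : ℝ) * (β i + 1) = (α i).choose (β i) * ((α i - β i : ℕ) : ℝ) := by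
    exact_mod_cast e3
  have e5 : α i - (β i + 1) = α i - β i - 1 := by omega
  rw [e5, add_zero]
  linear_combination (y i ^ (α i - β i - 1) *
    ∏ k ∈ Finset.univ.erase i, ((α k).choose (β k) : ℝ) * (y k) ^ (α k - β k)) * (-e4)

lemma pd1_cof {m n D : ℕ} (p : Jt m n D) (β : Fin n → ℕ) (j : Fin D) (i : Fin n) :
    pd1 i (fun y => cof y p β j) = fun y => (β i + 1 : ℝ) * cof y p (β + Pi.single i 1) j := by
  funext y
  have h1 : HasDerivAt (fun t : ℝ => cof (y + t • (EuclideanSpace.single i 1 : En n)) p β j)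
      ((β i + 1 : ℝ) * cof y p (β + Pi.single i 1) j) 0 := by
    unfold cof
    have := HasDerivAt.fun_sum (u := Finset.univ) (fun (α : MI m n) _ => (TT_deriv β α.1 i y).mul_const (p (α, j)))
    refine this.congr_deriv ?_
    rw [Finset.mul_sum]
    apply Finset.sum_congr rfl; intros; ring
  have hd : DifferentiableAt ℝ (fun y : En n => cof y p β j) y :=
    ((contDiff_cof p β j 1).differentiable (by norm_num)) y
  have h2 : HasDerivAt (fun t : ℝ => cof (y + t • (EuclideanSpace.single i 1 : En n)) p β j)
      (pd1 i (fun y => cof y p β j) y) 0 := by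
    have h3 : HasDerivAt (fun t : ℝ => y + t • (EuclideanSpace.single i 1 : En n))
        (EuclideanSpace.single i 1 : En n) 0 := by
      simpa using ((hasDerivAt_id (0:ℝ)).smul_const (EuclideanSpace.single i 1 : En n)).const_add y
    have hd' : HasFDerivAt (fun y : En n => cof y p β j) (fderiv ℝ (fun y : En n => cof y p β j) y)
      (y + (0:ℝ) • (EuclideanSpace.single i 1 : En n)) := by
      simpa using hd.hasFDerivAt
    exact hd'.comp_hasDerivAt (0:ℝ) h3
  exact h2.unique h1

lemma pd1_const_mul {n : ℕ} (i : Fin n) (c : ℝ) {f : En n → ℝ} (hf : Differentiable ℝ f) :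
    pd1 i (fun y => c * f y) = fun y => c * pd1 i f y := by
  funext y; unfold pd1
  rw [fderiv_const_mul (hf y)]; simp

def fct {n : ℕ} (α : Fin n → ℕ) : ℝ := ∏ i, ((α i).factorial : ℝ)
lemma fct_pos {n : ℕ} (α : Fin n → ℕ) : 0 < fct α := by
  unfold fct; apply Finset.prod_pos; intro i _; exact_mod_cast Nat.factorial_pos _
lemma fct_ge {n : ℕ} (α : Fin n → ℕ) : 1 ≤ fct α := by
  unfold fct
  have : ((∏ i, (α i).factorial : ℕ) : ℝ) = ∏ i, ((α i).factorial : ℝ) := by push_cast; rfl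
  rw [← this]
  exact_mod_cast Nat.one_le_iff_ne_zero.2 (Finset.prod_ne_zero_iff.2 fun i _ => Nat.factorial_ne_zero _)

lemma fct_add_single {n : ℕ} (β : Fin n → ℕ) (i : Fin n) :
    fct (β + Pi.single i 1) = (β i + 1 : ℝ) * fct β := by
  unfold fct
  rw [← Finset.mul_prod_erase _ _ (Finset.mem_univ i),
    ← Finset.mul_prod_erase Finset.univ (fun x => ((β x).factorial : ℝ)) (Finset.mem_univ i)]
  have : ∏ x ∈ Finset.univ.erase i, ((((β + Pi.single i 1 : Fin n → ℕ) x).factorial : ℕ) : ℝ)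
      = ∏ x ∈ Finset.univ.erase i, ((β x).factorial : ℝ) := by
    apply Finset.prod_congr rfl
    intro k hk
    have : k ≠ i := Finset.ne_of_mem_erase hk
    simp [this]
  rw [this]
  simp [Nat.factorial_succ]; ring

lemma pdl_cof {m n D : ℕ} (p : Jt m n D) (j : Fin D) (l : List (Fin n)) :
    pdl l (fun y => cof y p 0 j) = fun y => fct (fun i => l.count i) * cof y p (fun i => l.count i) j := by
  induction l with
  | nil => simp [pdl, fct]; rfl
  | cons i l ih =>
    rw [pdl_cons, ih, pd1_const_mul _ _ ((contDiff_cof p _ j 1).differentiable (by norm_num)), pd1_cof]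
    funext y
    have e : (fun k => List.count k (i :: l)) = (fun k => l.count k) + Pi.single i 1 := by
      funext k
      simp only [List.count_cons, Pi.add_apply, Pi.single_apply]
      by_cases h : k = i
      · simp [h]
      · simp [h, Ne.symm h]
    rw [e, ← mul_assoc]
    congr 1
    rw [fct_add_single]; ring

lemma pdalpha_pl {m n D : ℕ} (p : Jt m n D) (j : Fin D) (α : Fin n → ℕ) (y : En n) :
    pdalpha α (fun y => pl p y j) y = fct α * cof y p α j := by
  rw [pdalpha_eq]
  have := congrFun (pdl_cof p j (mlist α)) y
  simp only [count_mlist] at this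
  exact this

lemma cof_high {m n D : ℕ} (p : Jt m n D) (j : Fin D) (α : Fin n → ℕ) (y : En n) (h : m ≤ ∑ i, α i) :
    cof y p α j = 0 := by
  unfold cof
  apply Finset.sum_eq_zero
  intro β _
  rw [TT_eq_zero, zero_mul]
  intro hle
  have h1 := mem_miSet.1 β.2
  have h2 := Finset.sum_le_sum (s := Finset.univ) (fun i _ => hle i)
  omega

lemma iter_pl_high {m n D : ℕ} (p : Jt m n D) (y : En n) {k : ℕ} (hk : m ≤ k) :
    iteratedFDeriv ℝ k (pl p) y = 0 := by
  rw [← norm_le_zero_iff]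
  refine (vec_multilin_bound (contDiff_pl p k) y (M := 0) le_rfl ?_).trans (by simp)
  intro α hα j
  rw [pdalpha_pl, cof_high _ _ _ _ (by omega)]; simp

def CP (m n : ℕ) : ℝ := (n + 1 : ℝ) ^ m * (m.factorial : ℝ) ^ n * CM m n
lemma CP_ge (m n : ℕ) : 1 ≤ CP m n := by
  unfold CP
  have h1 : (1:ℝ) ≤ (n+1:ℝ)^m := one_le_pow₀ (by linarith [(Nat.cast_nonneg n : (0:ℝ) ≤ n)])
  have h2 : (1:ℝ) ≤ (m.factorial : ℝ)^n := one_le_pow₀ (by exact_mod_cast Nat.factorial_pos m)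
  have h3 := CM_ge m n
  nlinarith [mul_le_mul h1 h2 (by norm_num) (by positivity)]

/-- derivative bounds for polynomials -/
lemma pl_bound {m n D : ℕ} {p : Jt m n D} {x y : En n} {δ R K : ℝ} (hp : Bd x δ R p) (hR : 0 ≤ R)
    (hδ : 0 ≤ δ) (hK : 1 ≤ K) (h : ‖y - x‖ ≤ K * δ) {k : ℕ} (hk : k ≤ m) :
    ‖iteratedFDeriv ℝ k (pl p) y‖ ≤ CP m n * K ^ m * R * δ ^ (m - k) := by
  have hB := hp.move hR hδ hK h
  have hCM := CM_ge m n
  have hM : (0:ℝ) ≤ (m.factorial : ℝ) ^ n * (CM m n * K ^ m * R * δ ^ (m - k)) := by positivity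
  refine (vec_multilin_bound (contDiff_pl p k) y hM ?_).trans ?_
  · intro α hα j
    rw [pdalpha_pl, abs_mul, abs_of_pos (fct_pos α)]
    rcases lt_or_ge k m with hkm | hkm
    · have hα' : α ∈ miSet m n := by rw [mem_miSet]; omega
      have := hB (⟨α, hα'⟩, j)
      rw [co_apply] at this
      have e : od ((⟨α, hα'⟩, j) : Ix m n D) = k := hα
      rw [e] at this
      gcongr
      · unfold fct
        calc ∏ i, ((α i).factorial : ℝ) ≤ ∏ i : Fin n, (m.factorial : ℝ) := by
              apply Finset.prod_le_prod (fun _ _ => by positivity)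
              intro i _
              have : α i ≤ ∑ i, α i := Finset.single_le_sum (f := α) (fun _ _ => Nat.zero_le _) (Finset.mem_univ i)
              exact_mod_cast Nat.factorial_le (by omega)
          _ = _ := by simp
    · rw [cof_high _ _ _ _ (by omega)]; simpa using hM
  · unfold CP
    have : (n:ℝ)^k ≤ (n+1:ℝ)^m := by
      calc (n:ℝ)^k ≤ (n+1:ℝ)^k := by gcongr; linarith
        _ ≤ _ := pow_le_pow_right₀ (by linarith [(Nat.cast_nonneg n : (0:ℝ) ≤ n)]) hk
    calc _ ≤ (n+1:ℝ)^m * ((m.factorial : ℝ) ^ n * (CM m n * K ^ m * R * δ ^ (m - k))) := by gcongr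
      _ = _ := by ring

lemma co_le_iter {m n D : ℕ} (p : Jt m n D) (x : En n) (b : Ix m n D) :
    |co x p b| ≤ ‖iteratedFDeriv ℝ (od b) (pl p) x‖ := by
  refine le_trans ?_ (pdalpha_le (contDiff_pl p (od b)) b.1.1 rfl x b.2)
  rw [pdalpha_pl, abs_mul, abs_of_pos (fct_pos _), co_apply]
  nlinarith [fct_ge b.1.1, abs_nonneg (cof x p b.1.1 b.2)]

/-- vanishing of derivatives of order less than `s` -/
def Flat {n : ℕ} {W : Type*} [NormedAddCommGroup W] [NormedSpace ℝ W] (s : ℕ) (f : En n → W) (x : En n) : Prop :=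
  ∀ k < s, iteratedFDeriv ℝ k f x = 0

lemma Flat.add {n s : ℕ} {W : Type*} [NormedAddCommGroup W] [NormedSpace ℝ W] {f g : En n → W} {x : En n}
    (hf : Flat s f x) (hg : Flat s g x) (cf : ContDiff ℝ s f) (cg : ContDiff ℝ s g) :
    Flat s (f + g) x := by
  intro k hk
  have hks : (k : WithTop ℕ∞) ≤ s := by exact_mod_cast hk.le
  rw [iteratedFDeriv_add_apply (cf.of_le hks).contDiffAt (cg.of_le hks).contDiffAt, hf k hk, hg k hk, add_zero]
lemma Flat.sub {n s : ℕ} {W : Type*} [NormedAddCommGroup W] [NormedSpace ℝ W] {f g : En n → W} {x : En n}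
    (hf : Flat s f x) (hg : Flat s g x) (cf : ContDiff ℝ s f) (cg : ContDiff ℝ s g) :
    Flat s (f - g) x := by
  intro k hk
  have hks : (k : WithTop ℕ∞) ≤ s := by exact_mod_cast hk.le
  rw [iteratedFDeriv_sub_apply (cf.of_le hks).contDiffAt (cg.of_le hks).contDiffAt, hf k hk, hg k hk, sub_zero]
lemma Flat.const_smul {n s : ℕ} {W : Type*} [NormedAddCommGroup W] [NormedSpace ℝ W] {f : En n → W} {x : En n}
    (hf : Flat s f x) (cf : ContDiff ℝ s f) (c : ℝ) : Flat s (c • f) x := by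
  intro k hk
  have hks : (k : WithTop ℕ∞) ≤ s := by exact_mod_cast hk.le
  rw [iteratedFDeriv_const_smul_apply (cf.of_le hks).contDiffAt, hf k hk, smul_zero]
lemma Flat.mono {n s s' : ℕ} {W : Type*} [NormedAddCommGroup W] [NormedSpace ℝ W] {f : En n → W} {x : En n}
    (hf : Flat s f x) (h : s' ≤ s) : Flat s' f x := fun k hk => hf k (by omega)
lemma Flat.smul {n s : ℕ} {W : Type*} [NormedAddCommGroup W] [NormedSpace ℝ W] {θ : En n → ℝ} {f : En n → W} {x : En n}
    (hf : Flat s f x) (cθ : ContDiff ℝ s θ) (cf : ContDiff ℝ s f) : Flat s (fun y => θ y • f y) x := by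
  intro k hk
  have hks : (k : WithTop ℕ∞) ≤ s := by exact_mod_cast hk.le
  rw [← norm_le_zero_iff]
  refine (norm_iteratedFDeriv_smul_le (cθ.of_le hks) (cf.of_le hks) x le_rfl).trans (le_of_eq ?_)
  apply Finset.sum_eq_zero
  intro i _
  rw [hf (k - i) (by omega)]; simp
lemma Flat.smul_succ {n s : ℕ} {W : Type*} [NormedAddCommGroup W] [NormedSpace ℝ W] {θ : En n → ℝ} {f : En n → W} {x : En n}
    (hf : Flat s f x) (cθ : ContDiff ℝ (s+1:ℕ) θ) (cf : ContDiff ℝ (s+1:ℕ) f) (h0 : θ x = 0) :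
    Flat (s+1) (fun y => θ y • f y) x := by
  intro k hk
  have hks : (k : WithTop ℕ∞) ≤ (s+1:ℕ) := by exact_mod_cast hk.le
  rw [← norm_le_zero_iff]
  refine (norm_iteratedFDeriv_smul_le (cθ.of_le hks) (cf.of_le hks) x le_rfl).trans (le_of_eq ?_)
  apply Finset.sum_eq_zero
  intro i hi
  rw [Finset.mem_range] at hi
  rcases Nat.eq_zero_or_pos i with h | h
  · subst h
    simp [h0]
  · rw [hf (k - i) (by omega)]; simp

/-- Taylor estimate -/
lemma taylor {n m : ℕ} {W : Type*} [NormedAddCommGroup W] [NormedSpace ℝ W] {g : En n → W} {x : En n} {M : ℝ}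
    (hg : ContDiff ℝ m g) (hf : Flat m g x) (hM : ∀ y, ‖iteratedFDeriv ℝ m g y‖ ≤ M) :
    ∀ k ≤ m, ∀ y, ‖iteratedFDeriv ℝ k g y‖ ≤ M * ‖y - x‖ ^ (m - k) := by
  have hM0 : 0 ≤ M := (norm_nonneg _).trans (hM x)
  intro k hk
  induction h : m - k generalizing k with
  | zero =>
    have : k = m := by omega
    subst this; intro y; simpa using hM y
  | succ d ih =>
    intro y
    have hk1 := ih (k+1) (by omega) (by omega)
    have hd : Differentiable ℝ (iteratedFDeriv ℝ k g) :=
      hg.differentiable_iteratedFDeriv (by norm_cast; omega)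
    have := (convex_closedBall x ‖y - x‖).norm_image_sub_le_of_norm_fderiv_le (𝕜 := ℝ)
      (f := iteratedFDeriv ℝ k g) (C := M * ‖y - x‖ ^ d) (x := x) (y := y) (fun z _ => hd z)
      (fun z hz => by
        rw [norm_fderiv_iteratedFDeriv]
        refine (hk1 z).trans ?_
        rw [Metric.mem_closedBall, dist_eq_norm] at hz
        gcongr)
      (Metric.mem_closedBall_self (norm_nonneg _)) (by rw [Metric.mem_closedBall, dist_eq_norm])
    rw [hf k (by omega), sub_zero] at this
    rw [pow_succ, ← mul_assoc]; exact this

/-- `p` is the jet of `F` at `x` -/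
def Jet {m n D : ℕ} (F : En n → Fin D → ℝ) (x : En n) (p : Jt m n D) : Prop := Flat m (F - pl p) x

lemma Jet.exists {m n D : ℕ} {F : En n → Fin D → ℝ} (hF : ContDiff ℝ m F) (x : En n) :
    ∃ p : Jt m n D, Jet F x p := by
  refine ⟨co (-x) (fun b => pdalpha b.1.1 (fun y => F y b.2) x / fct b.1.1), ?_⟩
  set p : Jt m n D := co (-x) (fun b => pdalpha b.1.1 (fun y => F y b.2) x / fct b.1.1) with hp
  intro k hk
  have hks : (k : WithTop ℕ∞) ≤ m := by exact_mod_cast hk.le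
  have hFk := hF.of_le hks
  rw [← norm_le_zero_iff]
  refine (vec_multilin_bound (M := 0) (hFk.sub (contDiff_pl p k)) x le_rfl ?_).trans (by simp)
  intro α hα j
  have hα' : α ∈ miSet m n := by rw [mem_miSet]; omega
  obtain ⟨ι, h1⟩ : ∃ ι : Fin k → Fin n, ∀ f : En n → ℝ, ContDiff ℝ k f → pdalpha α f x =
      iteratedFDeriv ℝ k f x (fun i => EuclideanSpace.single (ι i) 1) := by
    subst hα
    rw [← length_mlist]
    refine ⟨fun i => (mlist α).get i, fun f hf => ?_⟩
    rw [iter_basis _ hf, List.ofFn_get, pdalpha_eq]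
  rw [h1 _ (comp_contDiff (hFk.sub (contDiff_pl p k)) j)]
  have e : (fun y => (F y - pl p y) j) = (fun y => F y j) - (fun y => pl p y j) := rfl
  rw [e, iteratedFDeriv_sub_apply (comp_contDiff hFk j).contDiffAt (comp_contDiff (contDiff_pl p k) j).contDiffAt]
  rw [sub_apply, ← h1 _ (comp_contDiff hFk j), ← h1 _ (comp_contDiff (contDiff_pl p k) j),
    pdalpha_pl]
  have h2 : co x p (⟨α, hα'⟩, j) = pdalpha α (fun y => F y j) x / fct α := by
    rw [hp, co_neg]
  rw [co_apply] at h2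
  simp only at h2
  rw [h2, mul_div_cancel₀ _ (fct_pos α).ne']; simp

lemma Jet.add {m n D : ℕ} {F G : En n → Fin D → ℝ} {x : En n} {p q : Jt m n D} (hF : Jet F x p) (hG : Jet G x q)
    (cF : ContDiff ℝ m F) (cG : ContDiff ℝ m G) : Jet (F + G) x (p + q) := by
  unfold Jet at *
  have := Flat.add hF hG (cF.sub (contDiff_pl p _)) (cG.sub (contDiff_pl q _))
  rw [pl_add]; convert this using 1; abel
lemma Jet.sub {m n D : ℕ} {F G : En n → Fin D → ℝ} {x : En n} {p q : Jt m n D} (hF : Jet F x p) (hG : Jet G x q)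
    (cF : ContDiff ℝ m F) (cG : ContDiff ℝ m G) : Jet (F - G) x (p - q) := by
  unfold Jet at *
  have := Flat.sub hF hG (cF.sub (contDiff_pl p _)) (cG.sub (contDiff_pl q _))
  rw [pl_sub]; convert this using 1; abel
lemma Jet.smul {m n D : ℕ} {F : En n → Fin D → ℝ} {x : En n} {p : Jt m n D} (hF : Jet F x p)
    (cF : ContDiff ℝ m F) (c : ℝ) : Jet (c • F) x (c • p) := by
  unfold Jet at *
  have := Flat.const_smul hF (cF.sub (contDiff_pl p _)) c
  rw [pl_smul]; rwa [smul_sub] at this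

lemma Jet.val {m n D : ℕ} (hm : 1 ≤ m) {F : En n → Fin D → ℝ} {x : En n} {p : Jt m n D} (hF : Jet F x p) :
    F x = pl p x := by
  have := hF 0 (by omega)
  have h2 := congrArg (fun L => L 0) this
  simp at h2
  exact sub_eq_zero.1 h2

lemma Jet.taylor {m n D : ℕ} {F : En n → Fin D → ℝ} {x : En n} {p : Jt m n D} {M : ℝ} (hF : Jet F x p)
    (hN : NB m F M) {k : ℕ} (hk : k ≤ m) (y : En n) :
    ‖iteratedFDeriv ℝ k (F - pl p) y‖ ≤ M * ‖y - x‖ ^ (m - k) := by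
  apply CmSel.taylor (hN.1.sub (contDiff_pl p _)) hF _ k hk
  intro y
  change ‖iteratedFDeriv ℝ m (F - pl p) y‖ ≤ M
  rw [iteratedFDeriv_sub_apply hN.1.contDiffAt (contDiff_pl p _).contDiffAt, iter_pl_high _ _ le_rfl, sub_zero]
  exact hN.2 m le_rfl y

/-- jets at two points -/
lemma Jet.two {m n D : ℕ} {F : En n → Fin D → ℝ} {x y : En n} {p q : Jt m n D} {M : ℝ} (hp : Jet F x p)
    (hq : Jet F y q) (hN : NB m F M) : Bd x ‖x - y‖ M (p - q) := by
  intro b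
  refine (co_le_iter _ _ _).trans ?_
  have hb := od_lt b
  have hks : ((od b : ℕ) : WithTop ℕ∞) ≤ m := by exact_mod_cast hb.le
  have e : pl (p - q) = (F - pl q) - (F - pl p) := by rw [pl_sub]; abel
  rw [e, iteratedFDeriv_sub_apply, hp _ hb, sub_zero]
  · exact hq.taylor hN hb.le x
  · exact ((hN.1.of_le hks).sub (contDiff_pl _ _)).contDiffAt
  · exact ((hN.1.of_le hks).sub (contDiff_pl _ _)).contDiffAt

end CmSel

namespace CmSel

lemma leib {n m : ℕ} {W : Type*} [NormedAddCommGroup W] [NormedSpace ℝ W] {θ : En n → ℝ} {f : En n → W}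
    {y : En n} {δ B R : ℝ} (cθ : ContDiff ℝ m θ) (cf : ContDiff ℝ m f) (hδ : 0 < δ)
    (hB : ∀ k ≤ m, ‖iteratedFDeriv ℝ k θ y‖ ≤ B / δ ^ k)
    (hR : ∀ k ≤ m, ‖iteratedFDeriv ℝ k f y‖ ≤ R * δ ^ (m - k)) :
    ∀ k ≤ m, ‖iteratedFDeriv ℝ k (fun y => θ y • f y) y‖ ≤ 2 ^ m * B * R * δ ^ (m - k) := by
  intro k hk
  have hks : (k : WithTop ℕ∞) ≤ m := by exact_mod_cast hk
  have hB0 : 0 ≤ B := by simpa using (norm_nonneg _).trans (hB 0 (by omega))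
  have hR0 : 0 ≤ R := by simpa using (norm_nonneg _).trans (hR m le_rfl)
  refine (norm_iteratedFDeriv_smul_le (cθ.of_le hks) (cf.of_le hks) y le_rfl).trans ?_
  have : ∀ i ∈ Finset.range (k+1), (k.choose i : ℝ) * ‖iteratedFDeriv ℝ i θ y‖ * ‖iteratedFDeriv ℝ (k-i) f y‖
      ≤ (k.choose i : ℝ) * (B * R * δ ^ (m - k)) := by
    intro i hi
    rw [Finset.mem_range] at hi
    have e : m - (k - i) = (m - k) + i := by omega
    calc (k.choose i : ℝ) * ‖iteratedFDeriv ℝ i θ y‖ * ‖iteratedFDeriv ℝ (k-i) f y‖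
        ≤ (k.choose i : ℝ) * (B / δ ^ i) * (R * δ ^ (m - (k - i))) := by
          gcongr
          · exact hB i (by omega)
          · exact hR (k - i) (by omega)
      _ = _ := by rw [e, pow_add]; field_simp
  refine (Finset.sum_le_sum this).trans ?_
  rw [← Finset.sum_mul]
  have e : (∑ i ∈ Finset.range (k+1), (k.choose i : ℝ)) = 2 ^ k := by exact_mod_cast Nat.sum_range_choose k
  rw [e]
  calc (2:ℝ) ^ k * (B * R * δ ^ (m - k)) ≤ 2 ^ m * (B * R * δ ^ (m - k)) := by
        gcongr
        · norm_num
    _ = _ := by ring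

lemma NB.mono {m n D : ℕ} {F : En n → Fin D → ℝ} {M M' : ℝ} (h : NB m F M) (hM : M ≤ M') : NB m F M' :=
  ⟨h.1, fun k hk y => (h.2 k hk y).trans hM⟩
lemma NB.add {m n D : ℕ} {F G : En n → Fin D → ℝ} {M M' : ℝ} (h : NB m F M) (h' : NB m G M') :
    NB m (F + G) (M + M') := by
  refine ⟨h.1.add h'.1, fun k hk y => ?_⟩
  have hks : (k : WithTop ℕ∞) ≤ m := by exact_mod_cast hk
  rw [iteratedFDeriv_add_apply (h.1.of_le hks).contDiffAt (h'.1.of_le hks).contDiffAt]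
  exact (norm_add_le _ _).trans (add_le_add (h.2 k hk y) (h'.2 k hk y))
lemma NB.smul {m n D : ℕ} {F : En n → Fin D → ℝ} {M : ℝ} (h : NB m F M) (c : ℝ) :
    NB m (c • F) (|c| * M) := by
  refine ⟨h.1.const_smul c, fun k hk y => ?_⟩
  have hks : (k : WithTop ℕ∞) ≤ m := by exact_mod_cast hk
  rw [iteratedFDeriv_const_smul_apply (h.1.of_le hks).contDiffAt, norm_smul]
  exact mul_le_mul_of_nonneg_left (h.2 k hk y) (abs_nonneg _)
lemma NB.sub {m n D : ℕ} {F G : En n → Fin D → ℝ} {M M' : ℝ} (h : NB m F M) (h' : NB m G M') :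
    NB m (F - G) (M + M') := by
  have := h.add (h'.smul (-1))
  simp only [neg_smul, one_smul, abs_neg, abs_one, one_mul] at this
  rwa [sub_eq_add_neg]
lemma NB.zero {m n D : ℕ} {M : ℝ} (hM : 0 ≤ M) : NB m (0 : En n → Fin D → ℝ) M := by
  refine ⟨contDiff_const, fun k hk y => ?_⟩
  have : (0 : En n → Fin D → ℝ) = fun _ => 0 := rfl
  rw [this]
  simp [hM]
lemma NB.nonneg {m n D : ℕ} {F : En n → Fin D → ℝ} {M : ℝ} (h : NB m F M) : 0 ≤ M :=
  (norm_nonneg _).trans (h.2 0 (by omega) 0)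
lemma NB.convex {m n D : ℕ} {F G : En n → Fin D → ℝ} {M : ℝ} (h : NB m F M) (h' : NB m G M) {a b : ℝ}
    (ha : 0 ≤ a) (hb : 0 ≤ b) (hab : a + b = 1) : NB m (a • F + b • G) M := by
  have := (h.smul a).add (h'.smul b)
  rwa [abs_of_nonneg ha, abs_of_nonneg hb, ← add_mul, hab, one_mul] at this

/-- scaling of a compactly supported function -/
lemma scaled_bound {n : ℕ} (m : ℕ) {ψ : En n → ℝ} (hψ : ContDiff ℝ m ψ) (hc : HasCompactSupport ψ) :
    ∃ B : ℝ, 1 ≤ B ∧ ∀ (x : En n) (δ : ℝ), 0 < δ → ∀ k ≤ m, ∀ y,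
      ‖iteratedFDeriv ℝ k (fun y => ψ (δ⁻¹ • (y - x))) y‖ ≤ B / δ ^ k := by
  have h1 : ∀ k : ℕ, ∃ B : ℝ, k ≤ m → ∀ y, ‖iteratedFDeriv ℝ k ψ y‖ ≤ B := by
    intro k
    by_cases hk : k ≤ m
    · obtain ⟨B, hB⟩ := (hc.iteratedFDeriv (𝕜 := ℝ) k).exists_bound_of_continuous
        (hψ.continuous_iteratedFDeriv (by exact_mod_cast hk))
      exact ⟨B, fun _ => hB⟩
    · exact ⟨0, fun h => absurd h hk⟩
  choose Bf hBf using h1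
  refine ⟨1 + ∑ k ∈ Finset.range (m+1), |Bf k|, ?_, ?_⟩
  · have : 0 ≤ ∑ k ∈ Finset.range (m+1), |Bf k| := Finset.sum_nonneg (fun _ _ => abs_nonneg _)
    linarith
  intro x δ hδ k hk y
  have hks : (k : WithTop ℕ∞) ≤ m := by exact_mod_cast hk
  have e : iteratedFDeriv ℝ k (fun y => ψ (δ⁻¹ • (y - x))) y =
      iteratedFDeriv ℝ k (fun z => ψ (δ⁻¹ • z)) (y - x) :=
    iteratedFDeriv_comp_sub (f := fun z => ψ (δ⁻¹ • z)) k x y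
  rw [e, iteratedFDeriv_comp_const_smul _ (hψ.of_le hks)]
  simp only
  rw [norm_smul, norm_pow, norm_inv, Real.norm_of_nonneg hδ.le, inv_pow, div_eq_inv_mul]
  have h2 : |Bf k| ≤ ∑ k ∈ Finset.range (m+1), |Bf k| :=
    Finset.single_le_sum (f := fun k => |Bf k|) (fun _ _ => abs_nonneg _) (Finset.mem_range.2 (by omega))
  have h3 := hBf k hk (δ⁻¹ • (y - x))
  gcongr
  linarith [le_abs_self (Bf k)]

def phi0 (n : ℕ) : ContDiffBump (0 : En n) := ⟨1, 2, by norm_num, by norm_num⟩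

def bump {n : ℕ} (x : En n) (δ : ℝ) (y : En n) : ℝ := phi0 n (δ⁻¹ • (y - x))

lemma bump_contDiff {n : ℕ} (x : En n) (δ : ℝ) (k : ℕ) : ContDiff ℝ k (bump x δ) := by
  unfold bump
  have : ContDiff ℝ k (phi0 n) := (phi0 n).contDiff
  exact this.comp (by fun_prop)

lemma norm_scaled {n : ℕ} (x y : En n) {δ : ℝ} (hδ : 0 < δ) : ‖δ⁻¹ • (y - x)‖ = ‖y - x‖ / δ := by
  rw [norm_smul, norm_inv, Real.norm_of_nonneg hδ.le, div_eq_inv_mul]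

lemma bump_one {n : ℕ} {x y : En n} {δ : ℝ} (hδ : 0 < δ) (h : ‖y - x‖ ≤ δ) : bump x δ y = 1 := by
  apply (phi0 n).one_of_mem_closedBall
  rw [mem_closedBall_zero_iff, norm_scaled x y hδ]
  exact (div_le_one hδ).2 h
lemma bump_zero {n : ℕ} {x y : En n} {δ : ℝ} (hδ : 0 < δ) (h : 2 * δ ≤ ‖y - x‖) : bump x δ y = 0 := by
  apply (phi0 n).zero_of_le_dist
  rw [dist_zero_right, norm_scaled x y hδ]
  exact (le_div_iff₀ hδ).2 h
lemma bump_nonneg {n : ℕ} (x y : En n) (δ : ℝ) : 0 ≤ bump x δ y := (phi0 n).nonneg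
lemma bump_le_one {n : ℕ} (x y : En n) (δ : ℝ) : bump x δ y ≤ 1 := (phi0 n).le_one

lemma exists_bump_bound (m n : ℕ) : ∃ B : ℝ, 1 ≤ B ∧ ∀ (x : En n) (δ : ℝ), 0 < δ → ∀ k ≤ m, ∀ y,
      ‖iteratedFDeriv ℝ k (bump x δ) y‖ ≤ B / δ ^ k :=
  scaled_bound m (phi0 n).contDiff (phi0 n).hasCompactSupport

def BB (m n : ℕ) : ℝ := (exists_bump_bound m n).choose
lemma BB_ge (m n : ℕ) : 1 ≤ BB m n := (exists_bump_bound m n).choose_spec.1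
lemma bump_bound {m n : ℕ} (x : En n) {δ : ℝ} (hδ : 0 < δ) {k : ℕ} (hk : k ≤ m) (y : En n) :
    ‖iteratedFDeriv ℝ k (bump x δ) y‖ ≤ BB m n / δ ^ k := (exists_bump_bound m n).choose_spec.2 x δ hδ k hk y

/-- linear bump -/
def lbump {n : ℕ} (i : Fin n) (x : En n) (δ : ℝ) (y : En n) : ℝ :=
  (fun z : En n => (1/4 : ℝ) * z i * phi0 n z) (δ⁻¹ • (y - x))

lemma exists_lbump_bound (m n : ℕ) (i : Fin n) : ∃ B : ℝ, 1 ≤ B ∧ ∀ (x : En n) (δ : ℝ), 0 < δ → ∀ k ≤ m, ∀ y,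
      ‖iteratedFDeriv ℝ k (lbump i x δ) y‖ ≤ B / δ ^ k := by
  apply scaled_bound m (ψ := fun z : En n => (1/4 : ℝ) * z i * phi0 n z)
  · have : ContDiff ℝ m (phi0 n) := (phi0 n).contDiff
    have h2 : ContDiff ℝ m (fun z : En n => (1/4 : ℝ) * z i) := by fun_prop
    exact h2.mul this
  · exact (phi0 n).hasCompactSupport.mul_left

def LB (m n : ℕ) (i : Fin n) : ℝ := (exists_lbump_bound m n i).choose
lemma LB_ge (m n : ℕ) (i : Fin n) : 1 ≤ LB m n i := (exists_lbump_bound m n i).choose_spec.1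
def LBB (m n : ℕ) : ℝ := 1 + ∑ i : Fin n, LB m n i
lemma LBB_ge (m n : ℕ) : 1 ≤ LBB m n := by
  unfold LBB
  have : 0 ≤ ∑ i : Fin n, LB m n i := Finset.sum_nonneg (fun i _ => by linarith [LB_ge m n i])
  linarith
lemma lbump_bound {m n : ℕ} (i : Fin n) (x : En n) {δ : ℝ} (hδ : 0 < δ) {k : ℕ} (hk : k ≤ m) (y : En n) :
    ‖iteratedFDeriv ℝ k (lbump i x δ) y‖ ≤ LBB m n / δ ^ k := by
  refine ((exists_lbump_bound m n i).choose_spec.2 x δ hδ k hk y).trans ?_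
  have : LB m n i ≤ ∑ i : Fin n, LB m n i :=
    Finset.single_le_sum (f := fun i => LB m n i) (fun i _ => by linarith [LB_ge m n i]) (Finset.mem_univ i)
  have h2 : LB m n i ≤ LBB m n := by unfold LBB; linarith
  exact div_le_div_of_nonneg_right h2 (by positivity)
lemma lbump_contDiff {n : ℕ} (i : Fin n) (x : En n) (δ : ℝ) (k : ℕ) : ContDiff ℝ k (lbump i x δ) := by
  unfold lbump
  have : ContDiff ℝ k (phi0 n) := (phi0 n).contDiff
  have h2 : ContDiff ℝ k (fun z : En n => (1/4 : ℝ) * z i) := by fun_prop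
  exact (h2.mul this).comp (g := fun z : En n => (1/4 : ℝ) * z i * phi0 n z) (f := fun y => δ⁻¹ • (y - x)) (by fun_prop)
lemma lbump_eq {n : ℕ} (i : Fin n) {x y : En n} {δ : ℝ} (hδ : 0 < δ) (h : ‖y - x‖ ≤ δ) :
    lbump i x δ y = (1/(4*δ)) * (y i - x i) := by
  have := bump_one hδ h
  unfold bump at this
  unfold lbump
  simp only [this]
  simp; field_simp
lemma lbump_zero {n : ℕ} (i : Fin n) {x y : En n} {δ : ℝ} (hδ : 0 < δ) (h : 2 * δ ≤ ‖y - x‖) :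
    lbump i x δ y = 0 := by
  have := bump_zero hδ h
  unfold bump at this
  unfold lbump
  simp only [this]; simp
lemma lbump_le {n : ℕ} (i : Fin n) {x y : En n} {δ : ℝ} (hδ : 0 < δ) : |lbump i x δ y| ≤ 1/2 := by
  rcases le_or_gt (2*δ) ‖y - x‖ with h | h
  · rw [lbump_zero i hδ h]; norm_num
  · unfold lbump
    have h1 : |(δ⁻¹ • (y - x)) i| ≤ 2 := by
      refine (PiLp.norm_apply_le (δ⁻¹ • (y - x)) i).trans ?_
      rw [norm_scaled x y hδ, div_le_iff₀ hδ]; exact h.le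
    have h2 := bump_nonneg x y δ
    have h3 := bump_le_one x y δ
    unfold bump at h2 h3
    simp only
    rw [abs_mul, abs_mul, abs_of_nonneg h2]
    have h4 : |(1/4:ℝ)| = 1/4 := by norm_num
    rw [h4]
    nlinarith [abs_nonneg ((δ⁻¹ • (y - x)) i)]

/-- multiplication of a jet by a coordinate function -/
def mulx {m n D : ℕ} (x : En n) (i : Fin n) (p : Jt m n D) : Jt m n D :=
  co (-x) (fun b => ∑ α : MI m n, if b.1.1 = α.1 + Pi.single i 1 then co x p (α, b.2) else 0)

lemma co_mulx {m n D : ℕ} (x : En n) (i : Fin n) (p : Jt m n D) (b : Ix m n D) :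
    co x (mulx x i p) b = ∑ α : MI m n, if b.1.1 = α.1 + Pi.single i 1 then co x p (α, b.2) else 0 := by
  unfold mulx; rw [co_neg]

lemma co_mulx_succ {m n D : ℕ} (x : En n) (i : Fin n) (p : Jt m n D) (a b : Ix m n D) (h2 : b.2 = a.2)
    (h : b.1.1 = a.1.1 + Pi.single i 1) : co x (mulx x i p) b = co x p a := by
  rw [co_mulx, Finset.sum_eq_single a.1]
  · rw [if_pos h, h2]
  · intro α _ hne
    rw [if_neg]
    intro h'
    apply hne
    apply Subtype.ext
    have := h.symm.trans h'
    exact (add_right_cancel this).symm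
  · simp

/-- each coordinate of `mulx` is a coordinate or zero -/
lemma co_mulx_cases {m n D : ℕ} (x : En n) (i : Fin n) (p : Jt m n D) (b : Ix m n D) :
    co x (mulx x i p) b = 0 ∨ ∃ a : Ix m n D, b.2 = a.2 ∧ b.1.1 = a.1.1 + Pi.single i 1 ∧
      co x (mulx x i p) b = co x p a := by
  by_cases h : ∃ α : MI m n, b.1.1 = α.1 + Pi.single i 1
  · obtain ⟨α, h⟩ := h
    right
    exact ⟨(α, b.2), rfl, h, co_mulx_succ x i p (α, b.2) b rfl h⟩
  · left
    push Not at h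
    rw [co_mulx]
    apply Finset.sum_eq_zero
    intro α _; rw [if_neg (h α)]

def mon {n : ℕ} (x : En n) (γ : Fin n → ℕ) (y : En n) : ℝ := ∏ i, (y i - x i) ^ (γ i)

lemma pl_expand {m n D : ℕ} (x : En n) (p : Jt m n D) (y : En n) (j : Fin D) :
    pl p y j = ∑ α : MI m n, mon x α.1 y * co x p (α, j) := by
  have : pl p y j = cof (y - x) (co x p) 0 j := by rw [cof_co, sub_add_cancel]; rfl
  rw [this]; unfold cof
  apply Finset.sum_congr rfl
  intro α _
  congr 1
  simp [TT, mon]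

lemma mon_succ {n : ℕ} (x : En n) (γ : Fin n → ℕ) (i : Fin n) (y : En n) :
    mon x (γ + Pi.single i 1) y = (y i - x i) * mon x γ y := by
  unfold mon
  simp only [Pi.add_apply, pow_add, Finset.prod_mul_distrib]
  have : ∏ k, (y k - x k) ^ (Pi.single i 1 : Fin n → ℕ) k = y i - x i := by
    rw [Finset.prod_eq_single i]
    · simp
    · intro b _ hb; simp [hb]
    · simp
  rw [this]; ring

lemma contDiff_mon {n : ℕ} (x : En n) (γ : Fin n → ℕ) (k : WithTop ℕ∞) : ContDiff ℝ k (mon x γ) := by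
  unfold mon; fun_prop

lemma flat_mon {n : ℕ} (x : En n) (s : ℕ) : ∀ γ : Fin n → ℕ, ∑ i, γ i = s → Flat s (mon x γ) x := by
  induction s with
  | zero => intro γ _ k hk; omega
  | succ s ih =>
    intro γ hγ
    have : ∃ i, γ i ≠ 0 := by
      by_contra hc; push Not at hc; simp [hc] at hγ
    obtain ⟨i, hi⟩ := this
    have e : γ = Function.update γ i (γ i - 1) + Pi.single i 1 := by
      funext k
      by_cases h : k = i
      · subst h; simp; omega
      · simp [h]
    have hs : ∑ k, (Function.update γ i (γ i - 1)) k = s := by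
      have h1 : ∑ k, γ k = ∑ k, (Function.update γ i (γ i - 1) + Pi.single i 1 : Fin n → ℕ) k := by rw [← e]
      simp only [Pi.add_apply, Finset.sum_add_distrib] at h1
      have h2 : ∑ k, (Pi.single i 1 : Fin n → ℕ) k = 1 := by simp
      omega
    have h3 := (ih _ hs).smul_succ (θ := fun y : En n => y i - x i) (by fun_prop) (contDiff_mon _ _ _) (by simp)
    rw [e]
    convert h3 using 1
    funext y; rw [mon_succ]; rfl

lemma Jet.mulx {m n D : ℕ} {F : En n → Fin D → ℝ} {x : En n} {p : Jt m n D} (hF : Jet F x p)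
    (cF : ContDiff ℝ m F) (i : Fin n) : Jet (fun y => (y i - x i) • F y) x (mulx x i p) := by
  unfold Jet
  have h1 := Flat.smul (θ := fun y : En n => y i - x i) hF (by fun_prop) (cF.sub (contDiff_pl p _))
  have c1 : ContDiff ℝ m (fun y : En n => (y i - x i) • (F - pl p) y) := by
    have : ContDiff ℝ m (F - pl p) := cF.sub (contDiff_pl p _)
    have h : ContDiff ℝ m (fun y : En n => (y i - x i)) := by fun_prop
    exact h.smul this
  set R : MI m n → En n → Fin D → ℝ := fun α y => mon x (α.1 + Pi.single i 1) y •
    (fun j => if α.1 + Pi.single i 1 ∈ miSet m n then 0 else co x p (α, j)) with hR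
  have cR : ∀ α, ContDiff ℝ m (R α) := fun α => (contDiff_mon x _ _).smul contDiff_const
  have fR : ∀ α, Flat m (R α) x := by
    intro α
    by_cases h : α.1 + Pi.single i 1 ∈ miSet m n
    · have : R α = fun _ => 0 := by
        funext y; simp only [hR]; simp only [h, if_true]
        funext j; simp
      rw [this]; intro k hk; simp
    · have hs : m ≤ ∑ k, (α.1 + Pi.single i 1 : Fin n → ℕ) k := by
        rw [mem_miSet] at h; omega
      intro k hk
      have h2 := flat_mon x _ (α.1 + Pi.single i 1) rfl k (by omega)
      rw [← norm_le_zero_iff]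
      refine (norm_iteratedFDeriv_smul_le ((contDiff_mon x _ k)) (contDiff_const (n := k)) x le_rfl).trans (le_of_eq ?_)
      apply Finset.sum_eq_zero
      intro r hr
      rw [flat_mon x _ (α.1 + Pi.single i 1) rfl r (by rw [Finset.mem_range] at hr; omega)]; simp
  have h2 : Flat m (fun y => ∑ α : MI m n, R α y) x := by
    intro k hk
    have hks : (k : WithTop ℕ∞) ≤ m := by exact_mod_cast hk.le
    rw [iteratedFDeriv_fun_sum_apply (fun α _ => ((cR α).of_le hks).contDiffAt)]
    exact Finset.sum_eq_zero (fun α _ => fR α k hk)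
  have h3 := h1.add h2 c1 (ContDiff.sum (fun α _ => cR α))
  convert h3 using 1
  funext y j
  simp only [Pi.sub_apply, Pi.smul_apply, smul_eq_mul, Pi.add_apply, Finset.sum_apply, hR]
  rw [pl_expand x p, pl_expand x (CmSel.mulx x i p)]
  have e : ∑ b : MI m n, mon x b.1 y * co x (CmSel.mulx x i p) (b, j) =
      ∑ α : MI m n, mon x (α.1 + Pi.single i 1) y * (if α.1 + Pi.single i 1 ∈ miSet m n then co x p (α, j) else 0) := by
    simp_rw [co_mulx, Finset.mul_sum]
    rw [Finset.sum_comm]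
    apply Finset.sum_congr rfl
    intro α _
    split_ifs with h
    · rw [Finset.sum_eq_single ⟨_, h⟩]
      · simp
      · intro b _ hb
        rw [if_neg, mul_zero]
        intro h'; exact hb (Subtype.ext h')
      · simp
    · rw [mul_zero]
      apply Finset.sum_eq_zero
      intro b _
      rw [if_neg, mul_zero]
      intro h'; rw [← h'] at h; exact h b.2
  rw [e, mul_sub, Finset.mul_sum, sub_add, ← Finset.sum_sub_distrib]
  congr 1
  apply Finset.sum_congr rfl
  intro α _
  rw [mon_succ]
  split_ifs <;> ring

end CmSel

namespace CmSel

def Gam {m n D : ℕ} (E0 : Finset (En n)) (K : En n → Set (Fin D → ℝ)) (k : ℕ) (x : En n) (M : ℝ) :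
    Set (Jt m n D) :=
  {p | ∀ S ⊆ E0, S.card ≤ k → ∃ F : En n → Fin D → ℝ, NB m F M ∧ Jet F x p ∧ ∀ y ∈ S, F y ∈ K y}

lemma Gam.mono {m n D : ℕ} {E0 : Finset (En n)} {K : En n → Set (Fin D → ℝ)} {k k' : ℕ} {x : En n} {M M' : ℝ}
    (hk : k' ≤ k) (hM : M ≤ M') : (Gam E0 K k x M : Set (Jt m n D)) ⊆ Gam E0 K k' x M' := by
  intro p hp S hS hc
  obtain ⟨F, h1, h2, h3⟩ := hp S hS (hc.trans hk)
  exact ⟨F, h1.mono hM, h2, h3⟩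

lemma Gam.conv {m n D : ℕ} {E0 : Finset (En n)} {K : En n → Set (Fin D → ℝ)} (hK : ∀ x ∈ E0, Convex ℝ (K x))
    (k : ℕ) (x : En n) (M : ℝ) : Convex ℝ (Gam E0 K k x M : Set (Jt m n D)) := by
  intro p hp q hq a b ha hb hab S hS hc
  obtain ⟨F, h1, h2, h3⟩ := hp S hS hc
  obtain ⟨G, g1, g2, g3⟩ := hq S hS hc
  refine ⟨a • F + b • G, h1.convex g1 ha hb hab, ?_, ?_⟩
  · exact (h2.smul h1.1 a).add (g2.smul g1.1 b) (h1.1.const_smul a) (g1.1.const_smul b)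
  · intro y hy
    exact hK y (hS hy) (h3 y hy) (g3 y hy) ha hb hab

lemma Gam.val {m n D : ℕ} (hm : 1 ≤ m) {E0 : Finset (En n)} {K : En n → Set (Fin D → ℝ)} {k : ℕ} (hk : 1 ≤ k)
    {x : En n} {M : ℝ} {p : Jt m n D} (hp : p ∈ Gam E0 K k x M) (hx : x ∈ E0) : pl p x ∈ K x := by
  obtain ⟨F, h1, h2, h3⟩ := hp {x} (by simpa using hx) (by simpa using hk)
  rw [← h2.val hm]; exact h3 x (by simp)

/-- Helly for jets. -/
lemma helly_jets {m n D : ℕ} {E0 : Finset (En n)} (k : ℕ) (X : Finset (En n) → Set (Jt m n D))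
    (hX : ∀ S ⊆ E0, Convex ℝ (X S)) (hanti : ∀ S T, S ⊆ T → T ⊆ E0 → X T ⊆ X S)
    (hne : ∀ S ⊆ E0, S.card ≤ (Fintype.card (Ix m n D) + 1) * k → (X S).Nonempty) :
    ∃ p, ∀ S ⊆ E0, S.card ≤ k → p ∈ X S := by
  have := Convex.helly_theorem' (𝕜 := ℝ) (F := X) (s := E0.powerset.filter (fun S => S.card ≤ k)) ?_ ?_
  · obtain ⟨p, hp⟩ := this
    refine ⟨p, fun S hS hc => ?_⟩
    simp only [Set.mem_iInter] at hp
    exact hp S (by simp [hS, hc])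
  · intro S hS
    simp only [Finset.mem_filter, Finset.mem_powerset] at hS
    exact hX S hS.1
  · intro I hI hc
    rw [Module.finrank_fintype_fun_eq_card] at hc
    have hI' : ∀ S ∈ I, S ⊆ E0 ∧ S.card ≤ k := by
      intro S hS
      have := hI hS
      simpa using this
    have hsub : I.biUnion id ⊆ E0 := by
      rw [Finset.biUnion_subset]; exact fun S hS => (hI' S hS).1
    obtain ⟨p, hp⟩ := hne (I.biUnion id) hsub (by
      refine (Finset.card_biUnion_le_card_mul _ _ k (fun S hS => (hI' S hS).2)).trans ?_
      exact Nat.mul_le_mul_right _ hc)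
    refine ⟨p, ?_⟩
    simp only [Set.mem_iInter]
    intro S hS
    exact hanti S _ (Finset.subset_biUnion_of_mem id hS) hsub hp

lemma Gam.transport {m n D : ℕ} {E0 : Finset (En n)} {K : En n → Set (Fin D → ℝ)} (hK : ∀ x ∈ E0, Convex ℝ (K x))
    {k k' : ℕ} (hk : (Fintype.card (Ix m n D) + 1) * k' ≤ k) {x : En n} {M : ℝ} {p : Jt m n D}
    (hp : p ∈ Gam E0 K k x M) (y : En n) : ∃ q ∈ (Gam E0 K k' y M : Set (Jt m n D)), Bd x ‖x - y‖ M (p - q) := by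
  have key := helly_jets (E0 := E0) k'
    (fun S => {q : Jt m n D | ∃ F : En n → Fin D → ℝ, NB m F M ∧ Jet F x p ∧ Jet F y q ∧ ∀ z ∈ S, F z ∈ K z}) ?_ ?_ ?_
  · obtain ⟨q, hq⟩ := key
    refine ⟨q, ?_, ?_⟩
    · intro S hS hc
      obtain ⟨F, h1, h2, h3, h4⟩ := hq S hS hc
      exact ⟨F, h1, h3, h4⟩
    · obtain ⟨F, h1, h2, h3, h4⟩ := hq ∅ (by simp) (by simp)
      exact h2.two h3 h1
  · rintro S hS q ⟨F, h1, h2, h3, h4⟩ q' ⟨G, g1, g2, g3, g4⟩ a b ha hb hab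
    refine ⟨a • F + b • G, h1.convex g1 ha hb hab, ?_, ?_, ?_⟩
    · have := (h2.smul h1.1 a).add (g2.smul g1.1 b) (h1.1.const_smul a) (g1.1.const_smul b)
      rwa [← add_smul, hab, one_smul] at this
    · exact (h3.smul h1.1 a).add (g3.smul g1.1 b) (h1.1.const_smul a) (g1.1.const_smul b)
    · intro y hy
      exact hK y (hS hy) (h4 y hy) (g4 y hy) ha hb hab
  · rintro S T hST hT q ⟨F, h1, h2, h3, h4⟩
    exact ⟨F, h1, h2, h3, fun z hz => h4 z (hST hz)⟩
  · intro S hS hc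
    obtain ⟨F, h1, h2, h3⟩ := hp S hS (hc.trans hk)
    obtain ⟨q, hq⟩ := Jet.exists h1.1 y
    exact ⟨q, F, h1, h2, hq, h3⟩

lemma Jet.congr {m n D : ℕ} {F G : En n → Fin D → ℝ} {x : En n} {p : Jt m n D} (hF : Jet F x p)
    (h : G =ᶠ[nhds x] F) : Jet G x p := by
  intro k hk
  rw [← hF k hk]
  apply Filter.EventuallyEq.eq_of_nhds
  apply Filter.EventuallyEq.iteratedFDeriv
  filter_upwards [h] with z hz
  simp [hz]

def CWc (m n : ℕ) : ℝ := 1 + 2 ^ m * LBB m n * ((2 + CP m n) * 2 ^ m)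
lemma CWc_ge (m n : ℕ) : 1 ≤ CWc m n := by
  unfold CWc
  have := LBB_ge m n
  have := CP_ge m n
  have : 0 ≤ 2 ^ m * LBB m n * ((2 + CP m n) * 2 ^ m) := by positivity
  linarith

/-- local smallness of a function with small jet -/
lemma Jet.local_bound {m n D : ℕ} {G : En n → Fin D → ℝ} {x y : En n} {p : Jt m n D} {δ M K R : ℝ}
    (hG : Jet G x p) (hN : NB m G M) (hδ : 0 < δ) (hp : Bd x δ R p) (hR : 0 ≤ R) (hK : 1 ≤ K) (hy : ‖y - x‖ ≤ K * δ)
    {k : ℕ} (hk : k ≤ m) : ‖iteratedFDeriv ℝ k G y‖ ≤ (M + CP m n * R) * K ^ m * δ ^ (m - k) := by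
  have hks : (k : WithTop ℕ∞) ≤ m := by exact_mod_cast hk
  have e : G = (G - pl p) + pl p := by abel
  have hM := hN.nonneg
  have h1 : ‖iteratedFDeriv ℝ k (G - pl p) y‖ ≤ M * (K ^ m * δ ^ (m - k)) := by
    refine (hG.taylor hN hk y).trans ?_
    gcongr
    calc ‖y - x‖ ^ (m - k) ≤ (K * δ) ^ (m - k) := by gcongr
      _ = K ^ (m - k) * δ ^ (m - k) := mul_pow _ _ _
      _ ≤ _ := by
        gcongr
        omega
  have h2 := pl_bound hp hR hδ.le hK hy hk
  have c1 : ContDiff ℝ k (G - pl p) := (hN.1.of_le hks).sub (contDiff_pl _ _)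
  rw [e, iteratedFDeriv_add_apply c1.contDiffAt (contDiff_pl _ _).contDiffAt]
  refine (norm_add_le _ _).trans ?_
  linarith

lemma Gam.wc {m n D : ℕ} {E0 : Finset (En n)} {K : En n → Set (Fin D → ℝ)} (hK : ∀ x ∈ E0, Convex ℝ (K x))
    {k : ℕ} {x : En n} {M δ : ℝ} {p q : Jt m n D} (hp : p ∈ Gam E0 K k x M) (hq : q ∈ Gam E0 K k x M)
    (hδ : 0 < δ) (hδ1 : δ ≤ 1) (hB : Bd x δ M (p - q)) (i : Fin n) :
    (1/2:ℝ) • (p + q) + (1/(4*δ)) • mulx x i (p - q) ∈ Gam E0 K k x (CWc m n * M) := by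
  intro S hS hc
  obtain ⟨F, h1, h2, h3⟩ := hp S hS hc
  obtain ⟨G, g1, g2, g3⟩ := hq S hS hc
  have hM := h1.nonneg
  have hN := h1.sub g1
  have hJ := h2.sub g2 h1.1 g1.1
  have cθ := lbump_contDiff i x δ m
  have hL := LBB_ge m n
  have hC := CP_ge m n
  have hθ : NB m (fun y => lbump i x δ y • (F - G) y) (2 ^ m * LBB m n * ((2 + CP m n) * 2 ^ m) * M) := by
    refine ⟨cθ.smul hN.1, fun k hk y => ?_⟩
    by_cases hy : ‖y - x‖ ≤ 2 * δ
    · have hb : ∀ k ≤ m, ‖iteratedFDeriv ℝ k (F - G) y‖ ≤ ((2 + CP m n) * M * 2 ^ m) * δ ^ (m - k) := by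
        intro k hk
        refine (hJ.local_bound hN hδ hB hM (by norm_num) hy hk).trans (le_of_eq (by ring))
      have := leib (y := y) cθ hN.1 hδ (fun k hk => lbump_bound i x hδ hk y) hb k hk
      refine this.trans ?_
      calc 2 ^ m * LBB m n * ((2 + CP m n) * M * 2 ^ m) * δ ^ (m - k)
          ≤ 2 ^ m * LBB m n * ((2 + CP m n) * M * 2 ^ m) * 1 := by
            gcongr; exact pow_le_one₀ hδ.le hδ1
        _ = _ := by ring
    · push Not at hy
      have : (fun y => lbump i x δ y • (F - G) y) =ᶠ[nhds y] (fun _ => (0 : Fin D → ℝ)) := by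
        have ho : IsOpen {z : En n | 2 * δ < ‖z - x‖} := isOpen_lt (by fun_prop) (by fun_prop)
        filter_upwards [ho.mem_nhds hy] with z hz
        rw [lbump_zero i hδ (le_of_lt hz), zero_smul]
      rw [(this.iteratedFDeriv ℝ k).eq_of_nhds]
      have : ‖iteratedFDeriv ℝ k (fun _ : En n => (0 : Fin D → ℝ)) y‖ = 0 := by
        simp
      rw [this]; positivity
  refine ⟨(1/2:ℝ) • (F + G) + (fun y => lbump i x δ y • (F - G) y), ?_, ?_, ?_⟩
  · refine (((h1.add g1).smul (1/2)).add hθ).mono (le_of_eq ?_)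
    rw [abs_of_pos (by norm_num), CWc]; ring
  · have j1 := (h2.add g2 h1.1 g1.1).smul (h1.1.add g1.1) (1/2:ℝ)
    have j2 := (hJ.mulx hN.1 i).smul (by
      have : ContDiff ℝ m (fun y : En n => y i - x i) := by fun_prop
      exact this.smul hN.1) (1/(4*δ))
    have c1 : ContDiff ℝ m ((1/2:ℝ) • (F + G)) := (h1.1.add g1.1).const_smul (1/2:ℝ)
    refine (j1.add j2 c1 ?_).congr ?_
    · have : ContDiff ℝ m (fun y : En n => y i - x i) := by fun_prop
      exact (this.smul hN.1).const_smul (1/(4*δ))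
    · filter_upwards [Metric.ball_mem_nhds x hδ] with z hz
      rw [Metric.mem_ball, dist_eq_norm] at hz
      simp only [Pi.add_apply, Pi.smul_apply]
      rw [lbump_eq i hδ hz.le, mul_smul]
  · intro y hy
    have hl := lbump_le i (x := x) (y := y) hδ
    rw [abs_le] at hl
    have := hK y (hS hy) (h3 y hy) (g3 y hy) (a := 1/2 + lbump i x δ y) (b := 1/2 - lbump i x δ y)
      (by linarith) (by linarith) (by ring)
    convert this using 1
    ext j; simp; ring

/-- abstract shape-field properties -/
structure SFam {m n D : ℕ} (Γ : ℕ → En n → ℝ → Set (Jt m n D)) : Prop where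
  conv : ∀ l x M, Convex ℝ (Γ l x M)
  mono : ∀ l x M M', M ≤ M' → Γ l x M ⊆ Γ l x M'
  mono_l : ∀ l x M, Γ (l+1) x M ⊆ Γ l x M
  transport : ∀ l x M p, p ∈ Γ (l+1) x M → ∀ y, ∃ q ∈ Γ l y M, Bd x ‖x - y‖ M (p - q)
  wc : ∀ l x M δ p q, p ∈ Γ l x M → q ∈ Γ l x M → 0 < δ → δ ≤ 1 → Bd x δ M (p - q) → ∀ i,
    (1/2:ℝ) • (p + q) + (1/(4*δ)) • mulx x i (p - q) ∈ Γ l x (CWc m n * M)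

def GLv (m D : ℕ) {n : ℕ} (E0 : Finset (En n)) (K : En n → Set (Fin D → ℝ)) (l : ℕ) (x : En n) (M : ℝ) : Set (Jt m n D) :=
  Gam E0 K ((Fintype.card (Ix m n D) + 1) ^ l) x M

lemma GLv_sfam (m D : ℕ) {n : ℕ} {E0 : Finset (En n)} {K : En n → Set (Fin D → ℝ)} (hK : ∀ x ∈ E0, Convex ℝ (K x)) :
    SFam (GLv m D E0 K) where
  conv l x M := Gam.conv hK _ x M
  mono l x M M' h := Gam.mono le_rfl h
  mono_l l x M := Gam.mono (Nat.pow_le_pow_right (by omega) (by omega)) le_rfl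
  transport l x M p hp y := Gam.transport hK (le_of_eq (by rw [pow_succ]; ring)) hp y
  wc l x M δ p q hp hq hδ hδ1 hB i := Gam.wc hK hp hq hδ hδ1 hB i

end CmSel

namespace CmSel

/-- symmetric gauge of a convex set around a point -/
def SG {V : Type*} [AddCommGroup V] [Module ℝ V] (G : Set V) (p : V) (t : ℝ) (v : V) : Prop :=
  0 ≤ t ∧ ∃ s, p + s ∈ G ∧ p - s ∈ G ∧ v = t • s

section SGs
variable {V : Type*} [AddCommGroup V] [Module ℝ V] {G : Set V} {p : V}

lemma sym_smul (hG : Convex ℝ G) {s : V} (h1 : p + s ∈ G) (h2 : p - s ∈ G) {c : ℝ} (h0 : |c| ≤ 1) :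
    p + c • s ∈ G := by
  rw [abs_le] at h0
  have := hG h1 h2 (a := (1 + c)/2) (b := (1 - c)/2) (by linarith) (by linarith) (by ring)
  convert this using 1
  module

lemma SG.zero (hp : p ∈ G) {t : ℝ} (ht : 0 ≤ t) : SG G p t 0 := ⟨ht, 0, by simpa, by simpa, by simp⟩

lemma SG.mono (hG : Convex ℝ G) {t t' : ℝ} {v : V} (h : SG G p t v) (ht : t ≤ t') : SG G p t' v := by
  obtain ⟨h0, s, h1, h2, h3⟩ := h
  rcases h0.eq_or_lt with h | h
  · have hp : p ∈ G := by
      have := sym_smul hG h1 h2 (c := 0) (by simp)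
      simpa using this
    rw [h3, ← h, zero_smul]
    exact SG.zero hp (by linarith)
  · have ht' : 0 < t' := by linarith
    have hc : |t / t'| ≤ 1 := by rw [abs_of_pos (by positivity)]; rw [div_le_one ht']; exact ht
    refine ⟨ht'.le, (t / t') • s, sym_smul hG h1 h2 hc, ?_, ?_⟩
    · have := sym_smul hG h1 h2 (c := -(t/t')) (by rwa [abs_neg])
      convert this using 1; module
    · rw [smul_smul, mul_div_cancel₀ _ ht'.ne', h3]

lemma SG.smul {t : ℝ} {v : V} (h : SG G p t v) (c : ℝ) : SG G p (|c| * t) (c • v) := by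
  obtain ⟨h0, s, h1, h2, h3⟩ := h
  refine ⟨by positivity, ?_⟩
  rcases le_total 0 c with hc | hc
  · exact ⟨s, h1, h2, by rw [h3, abs_of_nonneg hc, mul_smul]⟩
  · refine ⟨-s, by rwa [← sub_eq_add_neg], by rwa [sub_neg_eq_add], ?_⟩
    rw [h3, abs_of_nonpos hc]; module

lemma SG.add (hG : Convex ℝ G) {t t' : ℝ} {v v' : V} (h : SG G p t v) (h' : SG G p t' v') :
    SG G p (t + t') (v + v') := by
  rcases (show 0 ≤ t + t' by linarith [h.1, h'.1]).eq_or_lt with hh | hh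
  · have a := h.1
    have b := h'.1
    have e1 : t = 0 := by linarith
    have e2 : t' = 0 := by linarith
    obtain ⟨_, s, h1, h2, h3⟩ := h
    obtain ⟨_, s', h1', h2', h3'⟩ := h'
    exact ⟨hh.le, s, h1, h2, by rw [h3, h3', e1, e2]; simp⟩
  · obtain ⟨h0, s, h1, h2, h3⟩ := h
    obtain ⟨h0', s', h1', h2', h3'⟩ := h'
    have hs : t / (t + t') + t' / (t + t') = 1 := by field_simp
    refine ⟨hh.le, (t/(t+t')) • s + (t'/(t+t')) • s', ?_, ?_, ?_⟩
    · have := hG h1 h1' (a := t/(t+t')) (b := t'/(t+t')) (by positivity) (by positivity) hs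
      convert this using 1
      rw [smul_add, smul_add]
      have e : p = (t/(t+t')) • p + (t'/(t+t')) • p := by rw [← add_smul, hs, one_smul]
      nth_rewrite 1 [e]; abel
    · have := hG h2 h2' (a := t/(t+t')) (b := t'/(t+t')) (by positivity) (by positivity) hs
      convert this using 1
      rw [smul_sub, smul_sub]
      have e : p = (t/(t+t')) • p + (t'/(t+t')) • p := by rw [← add_smul, hs, one_smul]
      nth_rewrite 1 [e]; abel
    · rw [smul_add, smul_smul, smul_smul, mul_div_cancel₀ _ hh.ne', mul_div_cancel₀ _ hh.ne', h3, h3']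

lemma SG.sub (hG : Convex ℝ G) {t t' : ℝ} {v v' : V} (h : SG G p t v) (h' : SG G p t' v') :
    SG G p (t + t') (v - v') := by
  have := SG.add hG h (h'.smul (-1))
  simpa [sub_eq_add_neg] using this

lemma SG.sum (hG : Convex ℝ G) (hp : p ∈ G) {ι : Type*} (A : Finset ι) {v : ι → V} {t : ι → ℝ}
    (h : ∀ i ∈ A, SG G p (t i) (v i)) : SG G p (∑ i ∈ A, t i) (∑ i ∈ A, v i) := by
  induction A using Finset.induction_on with
  | empty => simpa using SG.zero hp le_rfl
  | insert a s ha ih =>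
    rw [Finset.sum_insert ha, Finset.sum_insert ha]
    exact SG.add hG (h a (by simp)) (ih (fun i hi => h i (by simp [hi])))

lemma SG.subset {G' : Set V} {t : ℝ} {v : V} (h : SG G p t v) (hG : G ⊆ G') : SG G' p t v := by
  obtain ⟨h0, s, h1, h2, h3⟩ := h
  exact ⟨h0, s, hG h1, hG h2, h3⟩

lemma SG.mk {t : ℝ} (ht : 0 < t) {v : V} (h1 : p + (1/t) • v ∈ G) (h2 : p - (1/t) • v ∈ G) : SG G p t v :=
  ⟨ht.le, _, h1, h2, by rw [smul_smul, mul_one_div_cancel ht.ne', one_smul]⟩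

lemma SG.mem {t : ℝ} (ht : 0 < t) {v : V} (h : SG G p t v) : p + (1/t) • v ∈ G ∧ p - (1/t) • v ∈ G := by
  obtain ⟨h0, s, h1, h2, h3⟩ := h
  rw [h3, smul_smul, one_div_mul_cancel ht.ne', one_smul]
  exact ⟨h1, h2⟩
end SGs

/-- matrix exchange, core -/
lemma exch_core {κ ι : Type*} [Fintype κ] [DecidableEq κ] [Fintype ι] (W : κ → ι → ℝ) (e : κ → ι)
    (hid : ∀ a a', W a (e a') = if a' = a then 1 else 0) :
    ∃ σ : κ → ι, Function.Injective σ ∧ (∀ τ : κ → ι, |(Matrix.of fun a a' => W a (τ a')).det| ≤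
      |(Matrix.of fun a a' => W a (σ a')).det|) ∧
      ∃ g : κ → κ → ℝ, (∀ b a, |g b a| ≤ 1) ∧ (∀ b b', ∑ a, g b a * W a (σ b') = if b' = b then 1 else 0) ∧
        ∀ b c, |∑ a, g b a * W a c| ≤ 1 := by
  have : Nonempty (κ → ι) := ⟨e⟩
  obtain ⟨σ, hσ⟩ := Finite.exists_max (fun τ : κ → ι => |(Matrix.of fun a a' => W a (τ a')).det|)
  set M : Matrix κ κ ℝ := Matrix.of fun a a' => W a (σ a') with hM
  have h1 : 1 ≤ |M.det| := by
    have : (Matrix.of fun a a' => W a (e a')) = (1 : Matrix κ κ ℝ) := by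
      ext a a'
      rw [Matrix.of_apply, hid, Matrix.one_apply]; simp only [eq_comm]
    have h := hσ e
    simp only [this, Matrix.det_one, abs_one] at h
    exact h
  have hdet : M.det ≠ 0 := by
    intro h; rw [h] at h1; norm_num at h1
  have hU : ∀ b c, ∑ a, M⁻¹ b a * W a c = (M.det)⁻¹ * (Matrix.of fun a a' => W a (Function.update σ b c a')).det := by
    intro b c
    have e1 : (Matrix.of fun a a' => W a (Function.update σ b c a')) = M.updateCol b (fun a => W a c) := by
      ext a a'
      rw [Matrix.updateCol_apply]
      by_cases h : a' = b
      · subst h; simp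
      · simp [h, hM]
    rw [e1, ← Matrix.cramer_apply, Matrix.cramer_eq_adjugate_mulVec, Matrix.inv_def, Matrix.mulVec, dotProduct,
      Finset.mul_sum]
    apply Finset.sum_congr rfl
    intro a _
    rw [Matrix.smul_apply, Ring.inverse_eq_inv', smul_eq_mul]; ring
  have hUb : ∀ b c, |∑ a, M⁻¹ b a * W a c| ≤ 1 := by
    intro b c
    rw [hU, abs_mul, abs_inv, inv_mul_le_iff₀ (by positivity), mul_one]
    exact hσ _
  refine ⟨σ, ?_, hσ, fun b a => M⁻¹ b a, ?_, ?_, hUb⟩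
  · intro a a' h
    by_contra hne
    exact hdet (Matrix.det_zero_of_column_eq hne (fun k => by simp [hM, h]))
  · intro b a
    have := hUb b (e a)
    simp only [hid] at this
    simpa using this
  · intro b b'
    have h2 : M⁻¹ * M = 1 := Matrix.nonsing_inv_mul M (by rwa [isUnit_iff_ne_zero])
    have := congrFun (congrFun h2 b) b'
    rw [Matrix.mul_apply, Matrix.one_apply] at this
    simp only [hM, Matrix.of_apply] at this
    rw [this]; simp only [eq_comm]

def Lam1 (N : ℕ) (Λ : ℝ) : ℝ := (N.factorial : ℝ) * Λ ^ N + 1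

lemma exch {ι : Type*} [Fintype ι] [DecidableEq ι] (A : Finset ι) (W : ι → ι → ℝ) {Λ : ℝ} (hΛ : 1 ≤ Λ)
    (hid : ∀ a ∈ A, ∀ a' ∈ A, W a a' = if a' = a then 1 else 0) (hW : ∀ a ∈ A, ∀ b, |W a b| ≤ Λ)
    (ω : ι → ℕ) (Ω : ℕ) (hω : ∀ b, ω b ≤ Ω) {T : ℝ} (hT : 1 ≤ T) :
    (∀ a ∈ A, ∀ b, |W a b| * T ^ (Ω - ω b) ≤ Lam1 (Fintype.card ι) Λ * T ^ (Ω - ω a)) ∨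
    ∃ B : Finset ι, B.card = A.card ∧ ∑ b ∈ B, ω b < ∑ a ∈ A, ω a ∧ ∃ g : ι → ι → ℝ,
      (∀ b ∈ B, ∀ a ∈ A, |g b a| ≤ 1) ∧
      (∀ b ∈ B, ∀ b' ∈ B, ∑ a ∈ A, g b a * (T ^ (Ω - ω b') / T ^ (Ω - ω a) * W a b') = if b' = b then 1 else 0) ∧
      (∀ b ∈ B, ∀ c, |∑ a ∈ A, g b a * (T ^ (Ω - ω c) / T ^ (Ω - ω a) * W a c)| ≤ 1) := by
  by_cases hall : (∀ a ∈ A, ∀ b, |W a b| * T ^ (Ω - ω b) ≤ Lam1 (Fintype.card ι) Λ * T ^ (Ω - ω a))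
  · left; exact hall
  right
  push Not at hall
  obtain ⟨a0, ha0, b0, hbig⟩ := hall
  have hT0 : 0 < T := by linarith
  set d : ι → ℝ := fun b => T ^ (Ω - ω b) with hd
  have hd0 : ∀ b, 0 < d b := fun b => by positivity
  obtain ⟨σ, hinj, hmax, g, hg1, hg2, hg3⟩ := exch_core (κ := A) (fun a c => d c / d a * W a c) (fun a => (a : ι))
    (by
      intro a a'
      rw [hid a a.2 a' a'.2]
      by_cases h : a' = a
      · subst h; simp [(hd0 _).ne']
      · simp [h])
  -- the big determinant
  have hmaxv := hmax (Function.update (fun a : A => (a : ι)) ⟨a0, ha0⟩ b0)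
  have e1 : (Matrix.of fun (a a' : A) => d (Function.update (fun a : A => (a : ι)) ⟨a0, ha0⟩ b0 a') / d a *
      W a (Function.update (fun a : A => (a : ι)) ⟨a0, ha0⟩ b0 a')).det = d b0 / d a0 * W a0 b0 := by
    have : (Matrix.of fun (a a' : A) => d (Function.update (fun a : A => (a : ι)) ⟨a0, ha0⟩ b0 a') / d a *
      W a (Function.update (fun a : A => (a : ι)) ⟨a0, ha0⟩ b0 a')) =
        (1 : Matrix A A ℝ).updateCol ⟨a0, ha0⟩ (fun a => d b0 / d a * W a b0) := by
      ext a a'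
      rw [Matrix.updateCol_apply]
      by_cases h : a' = ⟨a0, ha0⟩
      · subst h; simp
      · simp only [Matrix.of_apply, Function.update_of_ne h, h, if_false]
        rw [hid a a.2 a' a'.2, Matrix.one_apply]
        by_cases h' : a' = a
        · subst h'; simp [(hd0 _).ne']
        · have h'' : ¬ (a = a') := fun h => h' h.symm
          have h3 : ¬ ((a':ι) = a) := fun h => h' (Subtype.ext h)
          simp [h'', h3]
    rw [this, ← Matrix.cramer_apply, Matrix.cramer_one]; rfl
  rw [e1] at hmaxv
  have e2 : (Matrix.of fun (a a' : A) => d (σ a') / d a * W a (σ a')).det =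
      (∏ a : A, (d (σ a))) * ((∏ a : A, (d a)⁻¹) * (Matrix.of fun (a a' : A) => W a (σ a')).det) := by
    rw [← Matrix.det_mul_column, ← Matrix.det_mul_row]
    congr 1
    ext a a'
    simp only [Matrix.of_apply]; ring
  have h3 : |(Matrix.of fun (a a' : A) => W a (σ a')).det| ≤ Lam1 (Fintype.card ι) Λ := by
    have := Matrix.det_le (abv := AbsoluteValue.abs) (A := Matrix.of fun (a a' : A) => W a (σ a')) (x := Λ)
      (fun i j => hW i i.2 _)
    refine (show |_| ≤ _ from this).trans ?_
    rw [nsmul_eq_mul, Lam1]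
    have hc : Fintype.card A ≤ Fintype.card ι := by rw [Fintype.card_coe]; exact Finset.card_le_univ A
    have f1 : ((Fintype.card A).factorial : ℝ) ≤ (Fintype.card ι).factorial := by
      exact_mod_cast Nat.factorial_le hc
    have f2 : Λ ^ Fintype.card A ≤ Λ ^ Fintype.card ι := pow_le_pow_right₀ hΛ hc
    have : ((Fintype.card A).factorial : ℝ) * Λ ^ Fintype.card A ≤ (Fintype.card ι).factorial * Λ ^ Fintype.card ι := by
      gcongr
    linarith
  have hL : 0 < Lam1 (Fintype.card ι) Λ := by unfold Lam1; positivity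
  have h4 : (∏ a : A, d a) < ∏ a : A, d (σ a) := by
    by_contra hc
    push Not at hc
    have hpa : 0 < ∏ a : A, d a := Finset.prod_pos (fun a _ => hd0 _)
    have hps : 0 < ∏ a : A, d (σ a) := Finset.prod_pos (fun a _ => hd0 _)
    have h5 : |(Matrix.of fun (a a' : A) => d (σ a') / d a * W a (σ a')).det| ≤ Lam1 (Fintype.card ι) Λ := by
      rw [e2, abs_mul, abs_mul, Finset.prod_inv_distrib, abs_inv, abs_of_pos hpa, abs_of_pos hps]
      calc _ ≤ (∏ a : A, d a) * ((∏ a : A, d a)⁻¹ * Lam1 (Fintype.card ι) Λ) := by gcongr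
        _ = _ := by field_simp
    have h6 := hmaxv.trans h5
    rw [abs_mul, abs_of_pos (div_pos (hd0 _) (hd0 _)), div_mul_eq_mul_div, div_le_iff₀ (hd0 _)] at h6
    have : |W a0 b0| * d b0 = d b0 * |W a0 b0| := mul_comm _ _
    simp only [hd] at hbig this h6
    linarith
  have h7 : ∑ a : A, ω (σ a) < ∑ a : A, ω a := by
    simp only [hd] at h4
    rw [Finset.prod_pow_eq_pow_sum, Finset.prod_pow_eq_pow_sum] at h4
    have h8 : ∑ a : A, (Ω - ω a) < ∑ a : A, (Ω - ω (σ a)) := by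
      by_contra hc
      push Not at hc
      exact absurd h4 (not_lt.2 (pow_le_pow_right₀ hT hc))
    have e3 : ∑ a : A, (Ω - ω a) + ∑ a : A, ω a = ∑ a : A, Ω := by
      rw [← Finset.sum_add_distrib]; exact Finset.sum_congr rfl (fun a _ => Nat.sub_add_cancel (hω _))
    have e4 : ∑ a : A, (Ω - ω (σ a)) + ∑ a : A, ω (σ a) = ∑ a : A, Ω := by
      rw [← Finset.sum_add_distrib]; exact Finset.sum_congr rfl (fun a _ => Nat.sub_add_cancel (hω _))
    omega
  -- assemble
  set gg : ι → ι → ℝ := fun b a => if h : a ∈ A then if h' : ∃ k : A, σ k = b then g h'.choose ⟨a, h⟩ else 0 else 0 with hgg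
  have hgk : ∀ (k : A) (a : A), gg (σ k) a = g k a := by
    intro k a
    have h' : ∃ k' : A, σ k' = σ k := ⟨k, rfl⟩
    simp only [hgg, a.2, dif_pos, h']
    rw [hinj h'.choose_spec]
  have hsum : ∀ (k : A) c, ∑ a ∈ A, gg (σ k) a * (d c / d a * W a c) = ∑ a : A, g k a * (d c / d a * W a c) := by
    intro k c
    rw [← Finset.sum_coe_sort A]
    exact Finset.sum_congr rfl (fun a _ => by rw [hgk])
  refine ⟨Finset.univ.image σ, ?_, ?_, gg, ?_, ?_, ?_⟩
  · rw [Finset.card_image_of_injective _ hinj]; simp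
  · rw [Finset.sum_image (fun _ _ _ _ h => hinj h)]
    rw [← Finset.sum_coe_sort A]; exact h7
  · intro b hb a ha
    obtain ⟨k, _, rfl⟩ := Finset.mem_image.1 hb
    have := hgk k ⟨a, ha⟩
    simp only at this
    rw [this]; exact hg1 _ _
  · intro b hb b' hb'
    obtain ⟨k, _, rfl⟩ := Finset.mem_image.1 hb
    obtain ⟨k', _, rfl⟩ := Finset.mem_image.1 hb'
    refine (hsum k (σ k')).trans ?_
    rw [hg2]; simp [hinj.eq_iff]
  · intro b hb c
    obtain ⟨k, _, rfl⟩ := Finset.mem_image.1 hb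
    exact (congrArg abs (hsum k c)).le.trans (hg3 k c)

end CmSel

namespace CmSel

variable {m n D : ℕ}

def rr (b : Ix m n D) : ℕ := (b.2 : ℕ) + D * ∑ i, b.1.1 i * m ^ (i : ℕ)
def Lw (m n D : ℕ) : ℕ := Fintype.card (Ix m n D) * (D * m ^ n) + 1
def wt (b : Ix m n D) : ℕ := Lw m n D * od b + rr b
def Wt (m n D : ℕ) : ℕ := Lw m n D * m + D * m ^ n

def toFn (b : Ix m n D) : Fin n → Fin m := fun i => ⟨b.1.1 i, by
  have := od_lt b
  exact (Finset.single_le_sum (f := b.1.1) (fun _ _ => Nat.zero_le _) (Finset.mem_univ i)).trans_lt this⟩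

lemma digits_eq (b : Ix m n D) : (finFunctionFinEquiv (toFn b) : ℕ) = ∑ i, b.1.1 i * m ^ (i : ℕ) := by
  rw [finFunctionFinEquiv_apply]; rfl

lemma rr_lt (b : Ix m n D) : rr b < D * m ^ n := by
  unfold rr
  rw [← digits_eq b]
  have h1 := (finFunctionFinEquiv (toFn b)).2
  have h2 := b.2.2
  calc (b.2 : ℕ) + D * (finFunctionFinEquiv (toFn b) : ℕ) < D + D * (finFunctionFinEquiv (toFn b) : ℕ) := by omega
    _ = D * ((finFunctionFinEquiv (toFn b) : ℕ) + 1) := by ring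
    _ ≤ D * m ^ n := Nat.mul_le_mul_left _ h1

lemma rr_inj {a b : Ix m n D} (h : rr a = rr b) : a = b := by
  unfold rr at h
  have h2 : (a.2 : ℕ) = b.2 := by
    have := congrArg (· % D) h
    simpa [Nat.add_mul_mod_self_left, Nat.mod_eq_of_lt a.2.2, Nat.mod_eq_of_lt b.2.2] using this
  have h3 : ∑ i, a.1.1 i * m ^ (i : ℕ) = ∑ i, b.1.1 i * m ^ (i : ℕ) := by
    rw [h2] at h
    exact Nat.eq_of_mul_eq_mul_left (Nat.pos_of_ne_zero (by have := a.2.2; omega)) (Nat.add_left_cancel h)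
  rw [← digits_eq, ← digits_eq] at h3
  have h4 := finFunctionFinEquiv.injective (Fin.ext h3)
  refine Prod.ext (Subtype.ext (funext fun i => ?_)) (Fin.ext h2)
  exact congrArg Fin.val (congrFun h4 i)

lemma wt_inj {a b : Ix m n D} (h : wt a = wt b) : a = b := by
  unfold wt at h
  have h1 : rr a < Lw m n D := by
    have := rr_lt a
    have hc : 1 ≤ Fintype.card (Ix m n D) := Fintype.card_pos_iff.2 ⟨a⟩
    unfold Lw; nlinarith
  have h2 : rr b < Lw m n D := by
    have := rr_lt b
    have hc : 1 ≤ Fintype.card (Ix m n D) := Fintype.card_pos_iff.2 ⟨a⟩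
    unfold Lw; nlinarith
  apply rr_inj
  have := congrArg (· % Lw m n D) h
  simpa [Nat.mul_add_mod, Nat.mod_eq_of_lt h1, Nat.mod_eq_of_lt h2] using this

lemma wt_lt (b : Ix m n D) : wt b < Wt m n D := by
  unfold wt Wt
  have := rr_lt b
  have := Nat.mul_le_mul_left (Lw m n D) (od_lt b).le
  omega

lemma wt_succ {a b : Ix m n D} {i : Fin n} (h2 : b.2 = a.2) (h : b.1.1 = a.1.1 + Pi.single i 1) :
    wt b = wt a + (Lw m n D + D * m ^ (i : ℕ)) := by
  have h1 : od b = od a + 1 := by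
    unfold od; rw [h]
    simp [Finset.sum_add_distrib]
  have h3 : ∑ k, b.1.1 k * m ^ (k : ℕ) = ∑ k, a.1.1 k * m ^ (k : ℕ) + m ^ (i : ℕ) := by
    rw [h]
    simp [add_mul, Finset.sum_add_distrib, Pi.single_apply]
  unfold wt rr
  rw [h1, h2, h3]; ring

def Phi (A : Finset (Ix m n D)) : ℕ := ∑ a ∈ A, (Wt m n D - wt a)
def PhiMax (m n D : ℕ) : ℕ := Fintype.card (Ix m n D) * Wt m n D

lemma Phi_le (A : Finset (Ix m n D)) : Phi A ≤ PhiMax m n D := by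
  unfold Phi PhiMax
  refine (Finset.sum_le_card_nsmul A _ (Wt m n D) (fun a _ => Nat.sub_le _ _)).trans ?_
  rw [smul_eq_mul]
  exact Nat.mul_le_mul_right _ (Finset.card_le_univ A)

lemma Phi_insert {A : Finset (Ix m n D)} {b : Ix m n D} (hb : b ∉ A) : Phi A < Phi (insert b A) := by
  unfold Phi
  rw [Finset.sum_insert hb]
  have := wt_lt b
  omega

lemma Phi_exch_wt {A B : Finset (Ix m n D)} (hc : B.card = A.card) (h : ∑ b ∈ B, wt b < ∑ a ∈ A, wt a) :
    Phi A < Phi B := by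
  unfold Phi
  have e : ∀ A : Finset (Ix m n D), ∑ a ∈ A, (Wt m n D - wt a) + ∑ a ∈ A, wt a = A.card * Wt m n D := by
    intro A
    rw [← Finset.sum_add_distrib, Finset.sum_congr rfl (fun a _ => Nat.sub_add_cancel (wt_lt a).le)]
    simp
  have h1 := e A
  have h2 := e B
  rw [hc] at h2
  omega

lemma Phi_exch_od {A B : Finset (Ix m n D)} (hc : B.card = A.card) (h : ∑ b ∈ B, od b < ∑ a ∈ A, od a) :
    Phi A < Phi B := by
  apply Phi_exch_wt hc
  unfold wt
  rw [Finset.sum_add_distrib, Finset.sum_add_distrib, ← Finset.mul_sum, ← Finset.mul_sum]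
  have h1 : ∑ b ∈ B, rr b ≤ Fintype.card (Ix m n D) * (D * m ^ n) := by
    refine (Finset.sum_le_card_nsmul B _ (D * m ^ n) (fun a _ => (rr_lt a).le)).trans ?_
    rw [smul_eq_mul]
    exact Nat.mul_le_mul_right _ (Finset.card_le_univ B)
  have h2 : Lw m n D * (∑ b ∈ B, od b + 1) ≤ Lw m n D * ∑ a ∈ A, od a := Nat.mul_le_mul_left _ h
  have h3 : Lw m n D = Fintype.card (Ix m n D) * (D * m ^ n) + 1 := rfl
  rw [mul_add] at h2
  omega

/-- normalized coordinates -/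
def nco (x : En n) (δ : ℝ) : Jt m n D →ₗ[ℝ] Jt m n D where
  toFun p := fun b => co x p b / δ ^ (m - od b)
  map_add' p q := by funext b; simp [add_div]
  map_smul' c p := by funext b; simp [mul_div_assoc]

lemma nco_apply (x : En n) (δ : ℝ) (p : Jt m n D) (b : Ix m n D) : nco x δ p b = co x p b / δ ^ (m - od b) := rfl

lemma Bd_iff {x : En n} {δ R : ℝ} (hδ : 0 < δ) {p : Jt m n D} : Bd x δ R p ↔ ∀ b, |nco x δ p b| ≤ R := by
  unfold Bd
  refine forall_congr' fun b => ?_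
  rw [nco_apply, abs_div, abs_of_pos (pow_pos hδ _), div_le_iff₀ (pow_pos hδ _)]

lemma nco_eq_zero {x : En n} {δ : ℝ} (hδ : 0 < δ) {p : Jt m n D} {b : Ix m n D} : nco x δ p b = 0 ↔ co x p b = 0 := by
  rw [nco_apply, div_eq_zero_iff]; simp [hδ.ne']

lemma nco_scale {x : En n} {δ δ0 : ℝ} (hδ : 0 < δ) (hδ0 : 0 < δ0) (p : Jt m n D) (b : Ix m n D) :
    nco x δ p b = (δ0 / δ) ^ (m - od b) * nco x δ0 p b := by
  rw [nco_apply, nco_apply, div_pow]; field_simp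

variable (Γ : ℕ → En n → ℝ → Set (Jt m n D))

def Cert (A : Finset (Ix m n D)) (Λ : ℝ) (l : ℕ) (M : ℝ) (x : En n) (δ : ℝ) (p : Jt m n D) : Prop :=
  p ∈ Γ l x M ∧ ∃ w : Ix m n D → Jt m n D, (∀ a ∈ A, ∀ a' ∈ A, nco x δ (w a) a' = if a' = a then 1 else 0) ∧
    (∀ a ∈ A, ∀ b, |nco x δ (w a) b| ≤ Λ) ∧ ∀ a ∈ A, SG (Γ l x M) p (Λ / M) (w a)

variable {Γ}

lemma Cert.monoΛ (hΓ : SFam Γ) {A : Finset (Ix m n D)} {Λ Λ' : ℝ} {l : ℕ} {M : ℝ} {x : En n} {δ : ℝ} {p : Jt m n D}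
    (h : Cert Γ A Λ l M x δ p) (hΛ : Λ ≤ Λ') (hM : 0 < M) : Cert Γ A Λ' l M x δ p := by
  obtain ⟨hp, w, h1, h2, h3⟩ := h
  exact ⟨hp, w, h1, fun a ha b => (h2 a ha b).trans hΛ, fun a ha => (h3 a ha).mono (hΓ.conv _ _ _) (by gcongr)⟩

lemma Cert.monoM (hΓ : SFam Γ) {A : Finset (Ix m n D)} {Λ C : ℝ} {l : ℕ} {M : ℝ} {x : En n} {δ : ℝ} {p : Jt m n D}
    (h : Cert Γ A Λ l M x δ p) (hΛ : 0 ≤ Λ) (hM : 0 < M) (hC : 1 ≤ C) : Cert Γ A (C * Λ) l (C * M) x δ p := by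
  obtain ⟨hp, w, h1, h2, h3⟩ := h
  have hm : Γ l x M ⊆ Γ l x (C * M) := hΓ.mono _ _ _ _ (by nlinarith)
  refine ⟨hm hp, w, h1, fun a ha b => (h2 a ha b).trans (by nlinarith), fun a ha => ?_⟩
  have : C * Λ / (C * M) = Λ / M := by field_simp
  rw [this]
  exact (h3 a ha).subset hm

lemma Cert.mono_l (hΓ : SFam Γ) {A : Finset (Ix m n D)} {Λ : ℝ} {l : ℕ} {M : ℝ} {x : En n} {δ : ℝ} {p : Jt m n D}
    (h : Cert Γ A Λ (l+1) M x δ p) : Cert Γ A Λ l M x δ p := by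
  obtain ⟨hp, w, h1, h2, h3⟩ := h
  exact ⟨hΓ.mono_l _ _ _ hp, w, h1, h2, fun a ha => (h3 a ha).subset (hΓ.mono_l _ _ _)⟩

def NN (m n D : ℕ) : ℕ := Fintype.card (Ix m n D)

lemma card_le_NN (A : Finset (Ix m n D)) : (A.card : ℝ) ≤ NN m n D := by
  exact_mod_cast Finset.card_le_univ A

lemma Lam1_ge {N : ℕ} {Λ : ℝ} (hΛ : 1 ≤ Λ) : 1 ≤ Lam1 N Λ := by
  unfold Lam1
  have : 0 ≤ (N.factorial : ℝ) * Λ ^ N := by positivity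
  linarith

/-- S2 constant -/
def LS2 (N : ℕ) (Λ : ℝ) : ℝ := Lam1 N Λ + (N + 1) * Λ

lemma LS2_ge {N : ℕ} {Λ : ℝ} (hΛ : 1 ≤ Λ) : Λ ≤ LS2 N Λ := by
  unfold LS2
  have := Lam1_ge (N := N) hΛ
  nlinarith [show (0:ℝ) ≤ N * Λ by positivity]

lemma Cert.rescale (hΓ : SFam Γ) {A : Finset (Ix m n D)} {Λ : ℝ} {l : ℕ} {M : ℝ} {x : En n} {δ δ0 : ℝ} {p : Jt m n D}
    (h : Cert Γ A Λ l M x δ0 p) (hΛ : 1 ≤ Λ) (hM : 0 < M) (hδ : 0 < δ) (hδδ : δ ≤ δ0) :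
    ∃ B, (B = A ∨ Phi A < Phi B) ∧ Cert Γ B (LS2 (NN m n D) Λ) l M x δ p := by
  obtain ⟨hp, w, h1, h2, h3⟩ := h
  have hδ0 : 0 < δ0 := by linarith
  have hT : 1 ≤ δ0 / δ := by rw [le_div_iff₀ hδ]; linarith
  set T := δ0 / δ with hTd
  have hT0 : 0 < T := by linarith
  have hL1 := Lam1_ge (N := NN m n D) hΛ
  have hdd : ∀ b : Ix m n D, (1:ℝ) ≤ T ^ (m - od b) := fun b => one_le_pow₀ hT
  have hconv := hΓ.conv l x M
  have hNL : (0:ℝ) ≤ NN m n D * Λ := by positivity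
  rcases exch A (fun a b => nco x δ0 (w a) b) hΛ h1 h2 (fun b => od b) m (fun b => (od_lt b).le) hT with hc | hc
  · refine ⟨A, Or.inl rfl, hp, fun a => (1 / T ^ (m - od a)) • w a, ?_, ?_, ?_⟩
    · intro a ha a' ha'
      rw [map_smul, Pi.smul_apply, nco_scale hδ hδ0, h1 a ha a' ha', smul_eq_mul]
      by_cases h : a' = a
      · subst h
        have : T ^ (m - od a') ≠ 0 := by positivity
        simp only [if_true, ← hTd]; field_simp
      · simp [h]
    · intro a ha b
      rw [map_smul, Pi.smul_apply, nco_scale hδ hδ0, smul_eq_mul, ← hTd, abs_mul, abs_mul, abs_of_pos (by positivity),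
        abs_of_pos (by positivity), one_div, inv_mul_le_iff₀ (by positivity)]
      have := hc a ha b
      have h5 : Lam1 (Fintype.card (Ix m n D)) Λ * T ^ (m - od a) ≤ T ^ (m - od a) * LS2 (NN m n D) Λ := by
        rw [mul_comm]
        gcongr
        unfold LS2 NN
        nlinarith [show (0:ℝ) ≤ (Fintype.card (Ix m n D)) * Λ by positivity]
      linarith
    · intro a ha
      refine ((h3 a ha).smul (1 / T ^ (m - od a))).mono hconv ?_
      rw [abs_of_pos (by positivity)]
      calc 1 / T ^ (m - od a) * (Λ / M) ≤ 1 * (Λ / M) := by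
            gcongr
            rw [div_le_one (by positivity)]; exact hdd a
        _ ≤ _ := by rw [one_mul]; gcongr; exact LS2_ge hΛ
  · obtain ⟨B, hB1, hB2, g, hg1, hg2, hg3⟩ := hc
    have key : ∀ b c, nco x δ (∑ a ∈ A, (g b a / T ^ (m - od a)) • w a) c =
        ∑ a ∈ A, g b a * (T ^ (m - od c) / T ^ (m - od a) * nco x δ0 (w a) c) := by
      intro b c
      rw [map_sum, Finset.sum_apply]
      apply Finset.sum_congr rfl
      intro a ha
      rw [map_smul, Pi.smul_apply, nco_scale hδ hδ0, smul_eq_mul, ← hTd]; ring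
    refine ⟨B, Or.inr (Phi_exch_od hB1 hB2), hp, fun b => ∑ a ∈ A, (g b a / T ^ (m - od a)) • w a, ?_, ?_, ?_⟩
    · intro b hb b' hb'
      rw [key]; exact hg2 b hb b' hb'
    · intro b hb c
      rw [key]; refine (hg3 b hb c).trans ?_
      exact hΛ.trans (LS2_ge hΛ)
    · intro b hb
      refine (SG.sum hconv hp A (t := fun _ => Λ / M) (fun a ha => ?_)).mono hconv ?_
      · refine ((h3 a ha).smul _).mono hconv ?_
        rw [abs_div, abs_of_pos (pow_pos hT0 _)]
        have : |g b a| / T ^ (m - od a) ≤ 1 := by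
          rw [div_le_one (by positivity)]
          exact (hg1 b hb a ha).trans (hdd a)
        calc _ ≤ 1 * (Λ / M) := by gcongr
          _ = _ := one_mul _
      · rw [Finset.sum_const, nsmul_eq_mul, ← mul_div_assoc]
        gcongr
        have := card_le_NN A
        calc (A.card : ℝ) * Λ ≤ NN m n D * Λ := by gcongr
          _ ≤ _ := by unfold LS2; nlinarith

/-- S3 -/
lemma Cert.add (hΓ : SFam Γ) {A : Finset (Ix m n D)} {Λ : ℝ} {l : ℕ} {M : ℝ} {x : En n} {δ : ℝ} {p q : Jt m n D}
    (h : Cert Γ A Λ l M x δ p) (hΛ : 1 ≤ Λ) (hM : 0 < M) (hδ : 0 < δ) (hq : q ∈ Γ l x M)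
    (hz : ∀ a ∈ A, co x (q - p) a = 0) (hbig : ¬ Bd x δ (4 * M) (q - p)) :
    ∃ b ∉ A, ∃ κ : ℝ, 0 ≤ κ ∧ κ ≤ 1 ∧ Bd x δ M (κ • (q - p)) ∧
      Cert Γ (insert b A) (3 * Λ) l M x δ (p + κ • (q - p)) := by
  obtain ⟨hp, w, h1, h2, h3⟩ := h
  rw [Bd_iff hδ] at hbig
  push Not at hbig
  obtain ⟨b0, hb0⟩ := hbig
  have : Nonempty (Ix m n D) := ⟨b0⟩
  obtain ⟨b, hb⟩ := Finite.exists_max (fun b => |nco x δ (q - p) b|)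
  set v := nco x δ (q - p) with hv
  have hX : 4 * M < |v b| := hb0.trans_le (hb b0)
  have hvb : v b ≠ 0 := by intro h; rw [h] at hX; simp at hX; linarith
  have hXp : 0 < |v b| := abs_pos.2 hvb
  have hbA : b ∉ A := by
    intro hbA
    exact hvb ((nco_eq_zero hδ).2 (hz b hbA))
  set κ := M / |v b| with hκ
  have hκ0 : 0 < κ := by positivity
  have hκ4 : κ ≤ 1/4 := by rw [hκ, div_le_iff₀ hXp]; linarith
  have hconv := hΓ.conv l x M
  have hseg : ∀ s : ℝ, 0 ≤ s → s ≤ 1 → p + s • (q - p) ∈ Γ l x M := by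
    intro s hs0 hs1
    have := hconv hp hq (a := 1 - s) (b := s) (by linarith) hs0 (by ring)
    convert this using 1; module
  have hp3 := hseg κ hκ0.le (by linarith)
  have hmax : ∀ c, |nco x δ (κ • (q - p)) c| ≤ M := by
    intro c
    rw [map_smul, Pi.smul_apply, smul_eq_mul, abs_mul, abs_of_pos hκ0, hκ, div_mul_eq_mul_div, div_le_iff₀ hXp]
    exact mul_le_mul_of_nonneg_left (hb c) hM.le
  refine ⟨b, hbA, κ, hκ0.le, by linarith, (Bd_iff hδ).2 hmax, hp3, ?_⟩
  set u : Jt m n D := (1 / v b) • (q - p) with hu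
  have hub : nco x δ u b = 1 := by
    rw [hu, map_smul, Pi.smul_apply, smul_eq_mul, ← hv]; field_simp
  have huc : ∀ c, |nco x δ u c| ≤ 1 := by
    intro c
    rw [hu, map_smul, Pi.smul_apply, smul_eq_mul, ← hv, abs_mul, abs_div, abs_one, div_mul_eq_mul_div, one_mul, div_le_one hXp]
    exact hb c
  have huA : ∀ a ∈ A, nco x δ u a = 0 := by
    intro a ha
    rw [hu, map_smul, Pi.smul_apply, (nco_eq_zero hδ).2 (hz a ha), smul_zero]
  have hSu : SG (Γ l x M) (p + κ • (q - p)) (1 / M) u := by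
    have h0 : SG (Γ l x M) (p + κ • (q - p)) 1 (κ • (q - p)) := by
      refine ⟨zero_le_one, κ • (q - p), ?_, ?_, by simp⟩
      · have := hseg (2 * κ) (by linarith) (by linarith)
        convert this using 1; module
      · simpa using hp
    have := h0.smul (1 / (v b * κ))
    rw [smul_smul, mul_one, abs_div, abs_one, abs_mul, abs_of_pos hκ0] at this
    have e1 : 1 / (v b * κ) * κ = 1 / v b := by field_simp
    have e2 : |v b| * κ = M := by rw [hκ]; field_simp
    rw [e1, e2] at this
    exact this
  have hSw : ∀ a ∈ A, SG (Γ l x M) (p + κ • (q - p)) (2 * (Λ / M)) (w a) := by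
    intro a ha
    have hS := h3 a ha
    obtain ⟨g1, g2⟩ := hS.mem (by positivity)
    have h0 : SG (Γ l x M) (p + κ • (q - p)) (Λ / M / (1 - κ)) (w a) := by
      apply SG.mk (div_pos (by positivity) (by linarith))
      · have := hconv g1 hq (a := 1 - κ) (b := κ) (by linarith) hκ0.le (by ring)
        convert this using 1
        rw [one_div_div, div_eq_mul_one_div]; module
      · have := hconv g2 hq (a := 1 - κ) (b := κ) (by linarith) hκ0.le (by ring)
        convert this using 1
        rw [one_div_div, div_eq_mul_one_div]; module
    apply h0.mono hconv
    rw [div_le_iff₀ (by linarith)]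
    have : 0 < Λ / M := by positivity
    nlinarith
  refine ⟨fun a => if a = b then u else w a - nco x δ (w a) b • u, ?_, ?_, ?_⟩
  · intro a ha a' ha'
    rw [Finset.mem_insert] at ha ha'
    beta_reduce
    by_cases hab : a = b
    · subst hab
      rw [if_pos rfl]
      rcases ha' with rfl | ha'
      · simp [hub]
      · have : a' ≠ a := fun h => hbA (h ▸ ha')
        simp [this, huA a' ha']
    · rw [if_neg hab, map_sub, map_smul, Pi.sub_apply, Pi.smul_apply, smul_eq_mul]
      have haA := ha.resolve_left hab
      rcases ha' with rfl | ha'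
      · rw [hub]; simp [Ne.symm hab]
      · rw [huA a' ha', h1 a haA a' ha']; simp
  · intro a ha c
    rw [Finset.mem_insert] at ha
    beta_reduce
    by_cases hab : a = b
    · rw [if_pos hab]; exact (huc c).trans (by linarith)
    · rw [if_neg hab, map_sub, map_smul, Pi.sub_apply, Pi.smul_apply, smul_eq_mul]
      have haA := ha.resolve_left hab
      refine (abs_sub _ _).trans ?_
      rw [abs_mul]
      have q1 := h2 a haA c
      have q2 := h2 a haA b
      have q3 := huc c
      nlinarith [abs_nonneg (nco x δ (w a) b), abs_nonneg (nco x δ u c)]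
  · intro a ha
    rw [Finset.mem_insert] at ha
    beta_reduce
    by_cases hab : a = b
    · rw [if_pos hab]
      apply hSu.mono hconv
      gcongr; linarith
    · rw [if_neg hab]
      have haA := ha.resolve_left hab
      apply (SG.sub hconv (hSw a haA) (hSu.smul (nco x δ (w a) b))).mono hconv
      have q2 := h2 a haA b
      calc 2 * (Λ / M) + |nco x δ (w a) b| * (1 / M) ≤ 2 * (Λ / M) + Λ * (1 / M) := by gcongr
        _ = _ := by ring

end CmSel

namespace CmSel

lemma cross {κ V : Type*} [Fintype κ] [DecidableEq κ] [Nonempty κ] [AddCommGroup V] [Module ℝ V] {C : Set V} (hC : Convex ℝ C)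
    (L : V →ₗ[ℝ] (κ → ℝ)) (Q : κ × Bool → V) (hQ : ∀ i, Q i ∈ C) {τ ε : ℝ} (hε : (Fintype.card κ : ℝ) * ε ≤ τ / 2)
    (h : ∀ a s b, |L (Q (a, s)) b - (if b = a then (if s = true then τ else -τ) else 0)| ≤ ε)
    (v : κ → ℝ) (hv : ∑ b, |v b| ≤ τ / 2) : ∃ P ∈ C, L P = v := by
  have hτ : 0 ≤ τ / 2 := le_trans (Finset.sum_nonneg fun b _ => abs_nonneg _) hv
  by_contra hcon
  have hfin : (Set.range fun i => L (Q i)).Finite := Set.finite_range _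
  have hsub : v ∉ convexHull ℝ (Set.range fun i => L (Q i)) := by
    intro hm
    apply hcon
    have e : (Set.range fun i => L (Q i)) = L '' (Set.range Q) := by
      rw [← Set.range_comp]; rfl
    rw [e, ← LinearMap.image_convexHull] at hm
    obtain ⟨P, hP, hPv⟩ := hm
    exact ⟨P, convexHull_min (by rintro _ ⟨i, rfl⟩; exact hQ i) hC hP, hPv⟩
  obtain ⟨f, u, hf1, hf2⟩ := geometric_hahn_banach_closed_point (convex_convexHull ℝ _) (hfin.isClosed_convexHull ℝ) hsub
  have hrep : ∀ z : κ → ℝ, f z = ∑ b, z b * f (Pi.single b 1) := by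
    intro z
    conv_lhs => rw [pi_eq_sum_univ' z]
    rw [map_sum]
    refine Finset.sum_congr rfl fun b _ => ?_
    rw [map_smul, smul_eq_mul]
  set c : κ → ℝ := fun b => f (Pi.single b 1) with hc
  obtain ⟨a, ha⟩ := Finite.exists_max (fun b => |c b|)
  have h1 : ∀ s, f (L (Q (a, s))) < u := fun s => hf1 _ (subset_convexHull ℝ _ ⟨(a, s), rfl⟩)
  have hfv : f v ≤ |c a| * (τ / 2) := by
    rw [hrep]
    calc ∑ b, v b * c b ≤ ∑ b, |v b| * |c a| := by
          refine Finset.sum_le_sum fun b _ => (le_abs_self _).trans ?_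
          rw [abs_mul]; exact mul_le_mul_of_nonneg_left (ha b) (abs_nonneg _)
      _ = (∑ b, |v b|) * |c a| := by rw [Finset.sum_mul]
      _ ≤ _ := by rw [mul_comm]; gcongr
  have h2 : ∀ s : Bool, (if s = true then τ else -τ) * c a - |c a| * (τ / 2) ≤ f (L (Q (a, s))) := by
    intro s
    have e1 : (if s = true then τ else -τ) * c a = ∑ b, (if b = a then (if s = true then τ else -τ) else 0) * c b := by
      simp [ite_mul]
    rw [hrep, e1, sub_le_iff_le_add', ← sub_le_iff_le_add, ← Finset.sum_sub_distrib]
    calc ∑ b, ((if b = a then (if s = true then τ else -τ) else 0) * c b - L (Q (a, s)) b * c b) ≤ ∑ b : κ, ε * |c a| := by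
          refine Finset.sum_le_sum fun b _ => ?_
          rw [← sub_mul]
          refine (le_abs_self _).trans ?_
          rw [abs_mul, abs_sub_comm]
          exact mul_le_mul (h a s b) (ha b) (abs_nonneg _) ((abs_nonneg _).trans (h a s b))
      _ = |c a| * (Fintype.card κ * ε) := by simp; ring
      _ ≤ _ := by gcongr
  rcases le_total 0 (c a) with hs | hs
  · have := h2 true; have := h1 true
    rw [abs_of_nonneg hs] at *
    simp at *
    nlinarith
  · have := h2 false; have := h1 false
    rw [abs_of_nonpos hs] at *
    simp at *
    nlinarith

variable {m n D : ℕ} {Γ : ℕ → En n → ℝ → Set (Jt m n D)}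

/-- transport of an element plus its error -/
lemma transport_err (hΓ : SFam Γ) {l : ℕ} {M : ℝ} {x y : En n} {δ η : ℝ} {g : Jt m n D} (hM : 0 < M) (hδ : 0 < δ)
    (hη : 0 < η) (hη1 : η ≤ 1) (hxy : ‖x - y‖ ≤ η * δ) (hg : g ∈ Γ (l+1) x M) :
    ∃ q ∈ Γ l y M, ∀ b, |nco y δ (q - g) b| ≤ CM m n * η * M := by
  obtain ⟨q, hq, hB⟩ := hΓ.transport l x M g hg y
  refine ⟨q, hq, fun b => ?_⟩
  have hηδ : 0 < η * δ := by positivity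
  have hCM := CM_ge m n
  have h1 := (hB.scale hM.le (norm_nonneg _) hxy).move (K := 1) (y := y) hM.le hηδ.le le_rfl (by rw [norm_sub_rev]; linarith)
  have h2 := h1.neg b
  rw [neg_sub, one_pow, mul_one] at h2
  rw [nco_apply, abs_div, abs_of_pos (pow_pos hδ _), div_le_iff₀ (pow_pos hδ _)]
  refine h2.trans ?_
  rw [mul_pow]
  have h3 : η ^ (m - od b) ≤ η := pow_le_of_le_one hη.le hη1 (by have := od_lt b; omega)
  calc CM m n * M * (η ^ (m - od b) * δ ^ (m - od b)) ≤ CM m n * M * (η * δ ^ (m - od b)) := by gcongr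
    _ = _ := by ring

lemma nco_move {x y : En n} {δ R η : ℝ} {p : Jt m n D} (hp : Bd x δ R p) (hR : 0 ≤ R) (hδ : 0 < δ) (hη : 0 ≤ η)
    (hη1 : η ≤ 1) (hxy : ‖x - y‖ ≤ η * δ) (b : Ix m n D) : |nco y δ p b - nco x δ p b| ≤ CM m n * η * R := by
  have := hp.move_refined hR hδ.le hη hη1 (by rwa [norm_sub_rev]) b
  rw [nco_apply, nco_apply, ← sub_div, abs_div, abs_of_pos (pow_pos hδ _), div_le_iff₀ (pow_pos hδ _)]
  exact this

/-- S1 constants -/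
def LS1 (N : ℕ) (Λ : ℝ) : ℝ := 4 * (N + 1) * Λ

/-- S1 -/
lemma Cert.move (hΓ : SFam Γ) {A : Finset (Ix m n D)} {Λ : ℝ} {l : ℕ} {M : ℝ} {x y : En n} {δ η : ℝ} {p0 : Jt m n D}
    (h : Cert Γ A Λ (l+1) M x δ p0) (hΛ : 1 ≤ Λ) (hM : 0 < M) (hδ : 0 < δ) (hη : 0 < η) (hη1 : η ≤ 1)
    (hη2 : η * (4 * (NN m n D + 1) * CM m n * Λ) ≤ 1) (hxy : ‖x - y‖ ≤ η * δ) :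
    ∃ q, Cert Γ A (LS1 (NN m n D) Λ) l M y δ q ∧ (∀ a ∈ A, co y (q - p0) a = 0) ∧ Bd y δ (2 * M) (q - p0) := by
  obtain ⟨hp, w, h1, h2, h3⟩ := h
  have hCM := CM_ge m n
  have hN0 : (0:ℝ) ≤ NN m n D := by positivity
  have herr : CM m n * η ≤ 1 / 4 := by
    have : η * CM m n * 1 ≤ η * CM m n * ((NN m n D + 1) * Λ) := by
      gcongr; nlinarith
    nlinarith
  have hconv := hΓ.conv l y M
  by_cases hA : A = ∅
  · subst hA
    obtain ⟨q, hq, hB⟩ := transport_err hΓ hM hδ hη hη1 hxy hp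
    refine ⟨q, ⟨hq, fun _ => 0, by simp, by simp, by simp⟩, by simp, (Bd_iff hδ).2 fun b => (hB b).trans (by nlinarith)⟩
  have hAne : A.Nonempty := Finset.nonempty_iff_ne_empty.2 hA
  have : Nonempty A := hAne.to_subtype
  set τ := M / Λ with hτ
  have hτ0 : 0 < τ := by positivity
  have hτΛ : τ * Λ = M := by rw [hτ]; field_simp
  -- points
  have hpt : ∀ i : A × Bool, ∃ q ∈ Γ l y M, ∀ b, |nco y δ (q - (p0 + (if i.2 = true then τ else -τ) • w i.1)) b| ≤ CM m n * η * M := by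
    rintro ⟨⟨a, ha⟩, s⟩
    obtain ⟨g1, g2⟩ := (h3 a ha).mem (by positivity)
    apply transport_err hΓ hM hδ hη hη1 hxy
    rw [one_div_div, ← hτ] at g1 g2
    cases s
    · simpa [sub_eq_add_neg] using g2
    · simpa using g1
  choose qf hq1 hq2 using hpt
  set C : Set (Jt m n D) := {P | p0 + P ∈ Γ l y M ∧ ∀ b, |nco y δ P b| ≤ 2 * M} with hCdef
  have hCc : Convex ℝ C := by
    intro P hP Q hQ a b ha hb hab
    refine ⟨?_, fun c => ?_⟩
    · have := hconv hP.1 hQ.1 ha hb hab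
      convert this using 1
      have : p0 = (a + b) • p0 := by rw [hab, one_smul]
      conv_lhs => rw [this]
      module
    · rw [map_add, map_smul, map_smul, Pi.add_apply, Pi.smul_apply, Pi.smul_apply, smul_eq_mul, smul_eq_mul]
      refine (abs_add_le _ _).trans ?_
      rw [abs_mul, abs_mul, abs_of_nonneg ha, abs_of_nonneg hb]
      have e1 := mul_le_mul_of_nonneg_left (hP.2 c) ha
      have e2 := mul_le_mul_of_nonneg_left (hQ.2 c) hb
      nlinarith
  have hBw : ∀ a ∈ A, ∀ s : Bool, Bd x δ M ((if s = true then τ else -τ) • w a) := by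
    intro a ha s
    rw [Bd_iff hδ]
    intro b
    rw [map_smul, Pi.smul_apply, smul_eq_mul, abs_mul]
    have : |if s = true then τ else -τ| = τ := by cases s <;> simp [abs_of_pos hτ0]
    rw [this, ← hτΛ]
    exact mul_le_mul_of_nonneg_left (h2 a ha b) hτ0.le
  have hcoord : ∀ i : A × Bool, ∀ b, |nco y δ (qf i - p0) b - nco x δ ((if i.2 = true then τ else -τ) • w i.1) b| ≤ 2 * (CM m n * η * M) := by
    intro i b
    have e1 := hq2 i b
    have e2 := nco_move (hBw i.1 i.1.2 i.2) hM.le hδ hη.le hη1 hxy b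
    have e3 : qf i - p0 = (qf i - (p0 + (if i.2 = true then τ else -τ) • w i.1)) + (if i.2 = true then τ else -τ) • w i.1 := by abel
    rw [e3, map_add, Pi.add_apply]
    rw [abs_le] at *
    constructor <;> linarith [e1.1, e1.2, e2.1, e2.2]
  let L : Jt m n D →ₗ[ℝ] (A → ℝ) := (LinearMap.funLeft ℝ ℝ (fun a : A => (a : Ix m n D))).comp (nco y δ)
  have hL : ∀ P (a : A), L P a = nco y δ P a := fun P a => rfl
  have hQC : ∀ i, qf i - p0 ∈ C := by
    intro i
    refine ⟨by simpa using hq1 i, fun b => ?_⟩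
    have e1 := hcoord i b
    have e2 := (Bd_iff hδ).1 (hBw i.1 i.1.2 i.2) b
    rw [abs_le] at *
    constructor <;> nlinarith [e1.1, e1.2, e2.1, e2.2]
  have hcr := cross hCc L (fun i => qf i - p0) hQC (τ := τ) (ε := 2 * (CM m n * η * M)) ?_ ?_
  rotate_left
  · rw [Fintype.card_coe]
    have hc := card_le_NN A
    have hMτ : M = τ * Λ := hτΛ.symm
    calc (A.card : ℝ) * (2 * (CM m n * η * M)) ≤ (NN m n D + 1) * (2 * (CM m n * η * (τ * Λ))) := by
          rw [← hMτ]; gcongr; linarith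
      _ = (η * (4 * (NN m n D + 1) * CM m n * Λ)) * (τ / 2) := by ring
      _ ≤ 1 * (τ / 2) := by gcongr
      _ = _ := one_mul _
  · intro a s b
    have e1 := hcoord (a, s) b
    rw [hL]
    have e2 : nco x δ ((if s = true then τ else -τ) • w a) b = if b = a then (if s = true then τ else -τ) else 0 := by
      rw [map_smul, Pi.smul_apply, h1 a a.2 b b.2]
      by_cases hba : b = a
      · simp [hba]
      · have : (b : Ix m n D) ≠ a := fun h => hba (Subtype.ext h)
        simp [hba, this]
    rw [e2] at e1
    exact e1
  have hP : ∀ a : A, ∀ s : Bool, ∃ P ∈ C, L P = Pi.single a (if s = true then τ / 2 else -(τ / 2)) := by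
    intro a s
    apply hcr
    rw [Finset.sum_eq_single a]
    · cases s <;> simp [abs_of_pos (half_pos hτ0)]
    · intro b _ hb; simp [Pi.single_apply, hb]
    · simp
  choose P hPC hPL using hP
  set k : ℝ := (A.card : ℝ) with hk
  have hk0 : 0 < k := by rw [hk]; exact_mod_cast hAne.card_pos
  set pa : A → Jt m n D := fun a => (1/2 : ℝ) • P a true + (1/2 : ℝ) • P a false with hpa
  set va : A → Jt m n D := fun a => (1/2 : ℝ) • P a true - (1/2 : ℝ) • P a false with hva
  have hpaC : ∀ a, pa a ∈ C := fun a => hCc (hPC a true) (hPC a false) (by norm_num) (by norm_num) (by norm_num)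
  have hsumC : ∀ z : A → Jt m n D, (∀ a, z a ∈ C) → ∑ a, (1 / k) • z a ∈ C := by
    intro z hz
    apply hCc.sum_mem (fun _ _ => by positivity) _ (fun a _ => hz a)
    simp only [Finset.sum_const, Finset.card_univ, Fintype.card_coe, nsmul_eq_mul]
    rw [← hk]; field_simp
  set r := ∑ a, (1 / k) • pa a with hr
  have hrC : r ∈ C := hsumC _ hpaC
  have hva_sym : ∀ a, SG (Γ l y M) (p0 + r) k (va a) := by
    intro a
    apply SG.mk hk0
    · have := hsumC (fun b => if b = a then P a true else pa b) (fun b => by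
        by_cases h : b = a
        · simp only [h, if_true]; exact hPC a true
        · simp only [h, if_false]; exact hpaC b)
      have e : ∑ b, (1 / k) • (if b = a then P a true else pa b) = r + (1 / k) • va a := by
        have : ∀ b, (1 / k) • (if b = a then P a true else pa b) = (1 / k) • pa b + (if b = a then (1 / k) • va a else 0) := by
          intro b
          by_cases h : b = a
          · subst h; simp only [if_true, hpa, hva]; module
          · simp [h]
        rw [Finset.sum_congr rfl (fun b _ => this b), Finset.sum_add_distrib]
        simp [hr]
      rw [e] at this
      rw [add_assoc]; exact this.1
    · have := hsumC (fun b => if b = a then P a false else pa b) (fun b => by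
        by_cases h : b = a
        · simp only [h, if_true]; exact hPC a false
        · simp only [h, if_false]; exact hpaC b)
      have e : ∑ b, (1 / k) • (if b = a then P a false else pa b) = r - (1 / k) • va a := by
        have : ∀ b, (1 / k) • (if b = a then P a false else pa b) = (1 / k) • pa b - (if b = a then (1 / k) • va a else 0) := by
          intro b
          by_cases h : b = a
          · subst h; simp only [if_true, hpa, hva]; module
          · simp [h]
        rw [Finset.sum_congr rfl (fun b _ => this b), Finset.sum_sub_distrib]
        simp [hr]
      rw [e] at this
      rw [add_sub_assoc]; exact this.1
  have hLpa : ∀ a, L (pa a) = 0 := by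
    intro a
    rw [hpa]; simp only []
    rw [map_add, map_smul, map_smul, hPL, hPL]
    funext b
    by_cases h : b = a <;> simp [Pi.single_apply, h]
  have hLva : ∀ a, L (va a) = Pi.single a (τ / 2) := by
    intro a
    rw [hva]; simp only []
    rw [map_sub, map_smul, map_smul, hPL, hPL]
    funext b
    by_cases h : b = a <;> simp [Pi.single_apply, h]
    ring
  have hLr : L r = 0 := by
    rw [hr, map_sum]
    apply Finset.sum_eq_zero
    intro a _
    rw [map_smul, hLpa, smul_zero]
  have hvab : ∀ a b, |nco y δ (va a) b| ≤ 2 * M := by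
    intro a b
    have e1 := (hPC a true).2 b
    have e2 := (hPC a false).2 b
    rw [hva]; simp only []
    rw [map_sub, map_smul, map_smul, Pi.sub_apply, Pi.smul_apply, Pi.smul_apply, smul_eq_mul, smul_eq_mul]
    rw [abs_le] at *
    constructor <;> linarith [e1.1, e1.2, e2.1, e2.2]
  have hLS : 4 * Λ ≤ LS1 (NN m n D) Λ := by unfold LS1; nlinarith [mul_nonneg hN0 (by linarith : (0:ℝ) ≤ Λ)]
  refine ⟨p0 + r, ⟨hrC.1, fun a => if ha : a ∈ A then (2 / τ) • va ⟨a, ha⟩ else 0, ?_, ?_, ?_⟩, ?_, ?_⟩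
  · intro a ha a' ha'
    simp only [ha, dif_pos]
    have := congrFun (hLva ⟨a, ha⟩) ⟨a', ha'⟩
    rw [hL] at this
    rw [map_smul, Pi.smul_apply, this, smul_eq_mul]
    by_cases h : a' = a
    · subst h; rw [Pi.single_eq_same, if_pos rfl]; field_simp
    · simp [Pi.single_apply, h]
  · intro a ha b
    simp only [ha, dif_pos]
    rw [map_smul, Pi.smul_apply, smul_eq_mul, abs_mul, abs_of_pos (by positivity), div_mul_eq_mul_div, div_le_iff₀ hτ0]
    have := hvab ⟨a, ha⟩ b
    nlinarith
  · intro a ha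
    simp only [ha, dif_pos]
    refine ((hva_sym ⟨a, ha⟩).smul (2 / τ)).mono hconv ?_
    rw [abs_of_pos (by positivity), hτ, le_div_iff₀ hM]
    have hc := card_le_NN A
    have : 2 / (M / Λ) * k * M = 2 * k * Λ := by field_simp
    rw [this]; unfold LS1
    have : k * Λ ≤ NN m n D * Λ := by gcongr
    nlinarith
  · intro a ha
    have := congrFun hLr ⟨a, ha⟩
    rw [hL] at this
    rw [add_sub_cancel_left]
    exact (nco_eq_zero hδ).1 this
  · rw [add_sub_cancel_left, Bd_iff hδ]
    exact hrC.2

end CmSel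

namespace CmSel

variable {m n D : ℕ}

lemma mono_of_steps {A : Finset (Ix m n D)}
    (h : ∀ a ∈ A, ∀ (i : Fin n) (b : Ix m n D), b.2 = a.2 → b.1.1 = a.1.1 + Pi.single i 1 → b ∈ A) : Mono A := by
  suffices H : ∀ k : ℕ, ∀ a ∈ A, ∀ b : Ix m n D, b.2 = a.2 → a.1.1 ≤ b.1.1 → od b ≤ od a + k → b ∈ A by
    intro a ha b h2 hle
    exact H (od b) a ha b h2 hle (by omega)
  intro k
  have hodle : ∀ a b : Ix m n D, a.1.1 ≤ b.1.1 → (∃ i, a.1.1 i < b.1.1 i) → od a < od b := by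
    rintro a b hle ⟨i, hi⟩
    exact Finset.sum_lt_sum (fun j _ => hle j) ⟨i, Finset.mem_univ _, hi⟩
  induction k with
  | zero =>
    intro a ha b h2 hle hod
    by_cases he : ∃ i, a.1.1 i < b.1.1 i
    · have := hodle a b hle he; omega
    · push Not at he
      have : b = a := Prod.ext (Subtype.ext (funext fun i => le_antisymm (he i) (hle i))) h2
      rw [this]; exact ha
  | succ k ih =>
    intro a ha b h2 hle hod
    by_cases he : ∃ i, a.1.1 i < b.1.1 i
    · obtain ⟨i, hi⟩ := he
      have hle' : a.1.1 + Pi.single i 1 ≤ b.1.1 := by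
        intro j
        by_cases hj : j = i
        · subst hj; simpa using hi
        · simpa [Pi.single_apply, hj] using hle j
      have hs : ∑ j, (a.1.1 + Pi.single i 1 : Fin n → ℕ) j = od a + 1 := by
        simp [od, Finset.sum_add_distrib]
      have hlt : ∑ j, (a.1.1 + Pi.single i 1 : Fin n → ℕ) j < m :=
        lt_of_le_of_lt (Finset.sum_le_sum fun j _ => hle' j) (od_lt b)
      let a' : Ix m n D := (⟨a.1.1 + Pi.single i 1, mem_miSet.2 hlt⟩, a.2)
      have ha' : a' ∈ A := h a ha i a' rfl rfl
      apply ih a' ha' b h2 hle'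
      have : od a' = od a + 1 := hs
      omega
    · push Not at he
      have : b = a := Prod.ext (Subtype.ext (funext fun i => le_antisymm (he i) (hle i))) h2
      rw [this]; exact ha

lemma nco_mulx (x : En n) {δ : ℝ} (hδ : 0 < δ) (i : Fin n) (p : Jt m n D) (b : Ix m n D) :
    nco x δ ((1 / δ) • mulx x i p) b = 0 ∨
      ∃ a, b.2 = a.2 ∧ b.1.1 = a.1.1 + Pi.single i 1 ∧ nco x δ ((1 / δ) • mulx x i p) b = nco x δ p a := by
  rw [map_smul, Pi.smul_apply, nco_apply]
  rcases co_mulx_cases x i p b with h | ⟨a, h1, h2, h3⟩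
  · left; rw [h]; simp
  · right
    refine ⟨a, h1, h2, ?_⟩
    rw [h3, nco_apply, smul_eq_mul]
    have : od b = od a + 1 := by simp [od, h2, Finset.sum_add_distrib]
    have hb := od_lt b
    have : m - od a = (m - od b) + 1 := by omega
    rw [this, pow_succ]; field_simp

lemma nco_mulx_succ (x : En n) {δ : ℝ} (hδ : 0 < δ) (i : Fin n) (p : Jt m n D) (a b : Ix m n D)
    (h1 : b.2 = a.2) (h2 : b.1.1 = a.1.1 + Pi.single i 1) : nco x δ ((1 / δ) • mulx x i p) b = nco x δ p a := by
  rw [map_smul, Pi.smul_apply, nco_apply, co_mulx_succ x i p a b h1 h2, nco_apply, smul_eq_mul]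
  have : od b = od a + 1 := by simp [od, h2, Finset.sum_add_distrib]
  have hb := od_lt b
  have : m - od a = (m - od b) + 1 := by omega
  rw [this, pow_succ]; field_simp

variable {Γ : ℕ → En n → ℝ → Set (Jt m n D)}

def SX (N : ℕ) (Λ : ℝ) : ℝ := 2 * (2 * Λ + N * Λ * Λ)
def ST (N : ℕ) (Λ : ℝ) : ℝ := 2 * (N + 1) * Λ * Lam1 N Λ
def SC (m n : ℕ) : ℝ := 2 * CWc m n
def SL (m n D : ℕ) (Λ : ℝ) : ℝ :=
  SC m n * (Λ + Λ * SX (NN m n D) Λ + SX (NN m n D) Λ) + SC m n * ((NN m n D + 1) * ST (NN m n D) Λ ^ Wt m n D * Λ)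

lemma mulx_smul (x : En n) (i : Fin n) (c : ℝ) (p : Jt m n D) : mulx x i (c • p) = c • mulx x i p := by
  unfold mulx
  rw [← map_smul]
  congr 1
  funext b
  simp [Finset.mul_sum]

lemma SC_ge (m n : ℕ) : 1 ≤ SC m n := by unfold SC; have := CWc_ge m n; linarith

lemma SL_ge {Λ : ℝ} (hΛ : 1 ≤ Λ) : 1 ≤ SL m n D Λ := by
  unfold SL
  have hSC := SC_ge m n
  have h1 : 0 ≤ SX (NN m n D) Λ := by unfold SX; positivity
  have h2 : 0 ≤ ST (NN m n D) Λ := by unfold ST; have := Lam1_ge (N := NN m n D) hΛ; positivity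
  have h3 : 0 ≤ SC m n * ((NN m n D + 1) * ST (NN m n D) Λ ^ Wt m n D * Λ) := by positivity
  have h4 : 1 ≤ Λ + Λ * SX (NN m n D) Λ + SX (NN m n D) Λ := by
    have : 0 ≤ Λ * SX (NN m n D) Λ := by positivity
    linarith
  nlinarith

lemma Cert.strong_step (hΓ : SFam Γ) {A : Finset (Ix m n D)} {Λ : ℝ} {l : ℕ} {M : ℝ} {x : En n} {δ : ℝ} {p : Jt m n D}
    (h : Cert Γ A Λ l M x δ p) (hΛ : 1 ≤ Λ) (hM : 0 < M) (hδ : 0 < δ) (hδ1 : δ ≤ 1) (hA : ¬ Mono A) :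
    ∃ B, Phi A < Phi B ∧ Cert Γ B (SL m n D Λ) l (SC m n * M) x δ p := by
  have hcert := h
  obtain ⟨hp, w, h1, h2, h3⟩ := h
  have hSC := SC_ge m n
  have hL1 := Lam1_ge (N := NN m n D) hΛ
  set N := NN m n D with hN
  have hN0 : (0:ℝ) ≤ N := by positivity
  set T := ST N Λ with hTd
  have hT2 : 2 * (N + 1) * Λ * Lam1 N Λ = T := rfl
  have hT : 1 ≤ T := by
    rw [← hT2]
    have : 1 ≤ (N + 1) * Λ * Lam1 N Λ := by
      have e : (1:ℝ) ≤ N + 1 := by linarith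
      have e2 : 1 ≤ (N + 1) * Λ := by nlinarith
      nlinarith
    nlinarith
  have hT0 : 0 < T := by linarith
  have hX0 : 0 ≤ SX N Λ := by unfold SX; positivity
  have hSL1 : SC m n * (Λ + Λ * SX N Λ + SX N Λ) ≤ SL m n D Λ := by
    unfold SL
    have : 0 ≤ SC m n * ((NN m n D + 1) * ST (NN m n D) Λ ^ Wt m n D * Λ) := by positivity
    linarith
  have hSL2 : SC m n * ((N + 1) * T ^ Wt m n D * Λ) ≤ SL m n D Λ := by
    unfold SL
    have : 0 ≤ SC m n * (Λ + Λ * SX N Λ + SX N Λ) := by positivity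
    linarith
  have hconv0 := hΓ.conv l x M
  rcases exch A (fun a b => nco x δ (w a) b) hΛ h1 h2 (fun b => wt b) (Wt m n D) (fun b => (wt_lt b).le) hT with hc | hc
  · -- alternative 1
    have hsmall : ∀ a ∈ A, ∀ b, wt b < wt a → |nco x δ (w a) b| * T ≤ Lam1 N Λ := by
      intro a ha b hlt
      have e := hc a ha b
      have hw1 := wt_lt a
      have hw2 := wt_lt b
      have e2 : T * T ^ (Wt m n D - wt a) ≤ T ^ (Wt m n D - wt b) := by
        rw [← pow_succ']; exact pow_le_pow_right₀ hT (by omega)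
      have hp0 : 0 < T ^ (Wt m n D - wt a) := by positivity
      refine le_of_mul_le_mul_right ?_ hp0
      calc |nco x δ (w a) b| * T * T ^ (Wt m n D - wt a) = |nco x δ (w a) b| * (T * T ^ (Wt m n D - wt a)) := by ring
        _ ≤ |nco x δ (w a) b| * T ^ (Wt m n D - wt b) := by gcongr
        _ ≤ _ := e
    have hst : ∃ a ∈ A, ∃ (i : Fin n) (b : Ix m n D), b.2 = a.2 ∧ b.1.1 = a.1.1 + Pi.single i 1 ∧ b ∉ A := by
      by_contra hcon
      push Not at hcon
      exact hA (mono_of_steps fun a ha i b e1 e2 => hcon a ha i b e1 e2)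
    obtain ⟨a, ha, i, a', e1, e2, ha'⟩ := hst
    set z : Jt m n D := (1 / δ) • mulx x i (w a) with hz
    have hza' : nco x δ z a' = 1 := by
      rw [hz, nco_mulx_succ x hδ i (w a) a a' e1 e2, h1 a ha a ha]; simp
    have hzb : ∀ b, |nco x δ z b| ≤ Λ := by
      intro b
      rcases nco_mulx x hδ i (w a) b with h | ⟨c, _, _, h⟩
      · rw [hz, h]; simp; linarith
      · rw [hz, h]; exact h2 a ha c
    have hzsmall : ∀ b, wt b < wt a' → |nco x δ z b| * T ≤ Lam1 N Λ := by
      intro b hlt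
      rcases nco_mulx x hδ i (w a) b with h | ⟨c, f1, f2, h⟩
      · rw [hz, h]; simp; linarith
      · rw [hz, h]
        apply hsmall a ha c
        have g1 := wt_succ e1 e2
        have g2 := wt_succ f1 f2
        omega
    have hterm : ∀ b ∈ A, |nco x δ z b * nco x δ (w b) a'| * T ≤ Λ * Lam1 N Λ := by
      intro b hb
      have hne : wt b ≠ wt a' := fun h => ha' ((wt_inj h) ▸ hb)
      rw [abs_mul]
      rcases lt_or_gt_of_ne hne with hlt | hlt
      · calc |nco x δ z b| * |nco x δ (w b) a'| * T = |nco x δ (w b) a'| * (|nco x δ z b| * T) := by ring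
          _ ≤ Λ * Lam1 N Λ := mul_le_mul (h2 b hb a') (hzsmall b hlt) (by positivity) (by linarith)
      · calc |nco x δ z b| * |nco x δ (w b) a'| * T = |nco x δ z b| * (|nco x δ (w b) a'| * T) := by ring
          _ ≤ Λ * Lam1 N Λ := mul_le_mul (hzb b) (hsmall b hb a' hlt) (by positivity) (by linarith)
    set z' : Jt m n D := z - ∑ b ∈ A, nco x δ z b • w b with hz'
    have hz'c : ∀ c, nco x δ z' c = nco x δ z c - ∑ b ∈ A, nco x δ z b * nco x δ (w b) c := by
      intro c
      rw [hz', map_sub, map_sum, Pi.sub_apply, Finset.sum_apply]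
      simp
    set ζ := nco x δ z' a' with hζ
    have hcA := card_le_NN A
    have hζ2 : 1 / 2 ≤ ζ := by
      rw [hζ, hz'c, hza']
      have : ∑ b ∈ A, nco x δ z b * nco x δ (w b) a' ≤ 1 / 2 := by
        have e : (∑ b ∈ A, nco x δ z b * nco x δ (w b) a') * T ≤ A.card * (Λ * Lam1 N Λ) := by
          rw [Finset.sum_mul, ← nsmul_eq_mul]
          apply Finset.sum_le_card_nsmul
          intro b hb
          refine le_trans ?_ (hterm b hb)
          gcongr; exact le_abs_self _
        have e3 : (A.card : ℝ) * (Λ * Lam1 N Λ) ≤ (N + 1) * (Λ * Lam1 N Λ) := by gcongr; linarith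
        by_contra hcon
        push Not at hcon
        nlinarith
      linarith
    have hζ0 : 0 < ζ := by linarith
    have hz'A : ∀ b ∈ A, nco x δ z' b = 0 := by
      intro b hb
      rw [hz'c, Finset.sum_eq_single b]
      · rw [h1 b hb b hb]; simp
      · intro c hc hne; rw [h1 c hc b hb]; simp [Ne.symm hne]
      · intro h; exact absurd hb h
    have hz'b : ∀ c, |nco x δ z' c| ≤ Λ + N * Λ * Λ := by
      intro c
      rw [hz'c]
      refine (abs_sub _ _).trans ?_
      have : |∑ b ∈ A, nco x δ z b * nco x δ (w b) c| ≤ A.card * (Λ * Λ) := by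
        refine (Finset.abs_sum_le_sum_abs _ _).trans ?_
        rw [← nsmul_eq_mul]
        apply Finset.sum_le_card_nsmul
        intro b hb
        rw [abs_mul]
        exact mul_le_mul (hzb b) (h2 b hb c) (abs_nonneg _) (by linarith)
      have e3 : (A.card : ℝ) * (Λ * Λ) ≤ N * (Λ * Λ) := by gcongr
      linarith [hzb c]
    -- SG facts
    have hsubM : Γ l x M ⊆ Γ l x (SC m n * M) := hΓ.mono _ _ _ _ (by nlinarith)
    have hsub2 : Γ l x M ⊆ Γ l x (2 * M) := hΓ.mono _ _ _ _ (by nlinarith)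
    have hconv := hΓ.conv l x (SC m n * M)
    obtain ⟨g1, g2⟩ := (h3 a ha).mem (by positivity)
    rw [one_div_div] at g1 g2
    have hBd : Bd x δ (2 * M) ((2 * (M / Λ)) • w a) := by
      rw [Bd_iff hδ]; intro b
      rw [map_smul, Pi.smul_apply, smul_eq_mul, abs_mul, abs_of_pos (by positivity)]
      calc 2 * (M / Λ) * |nco x δ (w a) b| ≤ 2 * (M / Λ) * Λ := by gcongr; exact h2 a ha b
        _ = 2 * M := by field_simp
    have hSz : SG (Γ l x (SC m n * M)) p (2 * Λ / M) z := by
      have hCWM : CWc m n * (2 * M) = SC m n * M := by unfold SC; ring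
      apply SG.mk (by positivity)
      · have := hΓ.wc l x (2 * M) δ _ _ (hsub2 g1) (hsub2 g2) hδ hδ1 (by convert hBd using 1; module) i
        rw [hCWM] at this
        have e : (p + (M / Λ) • w a - (p - (M / Λ) • w a)) = (2 * (M / Λ)) • w a := by module
        rw [e, mulx_smul] at this
        convert this using 1
        rw [hz, smul_smul, smul_smul]
        have e5 : 1 / (2 * Λ / M) * (1 / δ) = 1 / (4 * δ) * (2 * (M / Λ)) := by field_simp; norm_num
        rw [e5]; module
      · have := hΓ.wc l x (2 * M) δ _ _ (hsub2 g2) (hsub2 g1) hδ hδ1 (by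
          have := hBd.neg
          convert this using 1; module) i
        rw [hCWM] at this
        have e : (p - (M / Λ) • w a - (p + (M / Λ) • w a)) = (-(2 * (M / Λ))) • w a := by module
        rw [e, mulx_smul] at this
        convert this using 1
        rw [hz, smul_smul, smul_smul]
        have e5 : 1 / (2 * Λ / M) * (1 / δ) = 1 / (4 * δ) * (2 * (M / Λ)) := by field_simp; norm_num
        rw [e5]; module
    have hSw : ∀ b ∈ A, SG (Γ l x (SC m n * M)) p (Λ / M) (w b) := fun b hb => (h3 b hb).subset hsubM
    have hSz' : SG (Γ l x (SC m n * M)) p ((2 * Λ + N * Λ * Λ) / M) z' := by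
      refine (SG.sub hconv hSz (SG.sum hconv (hsubM hp) A (fun b hb => (hSw b hb).smul (nco x δ z b)))).mono hconv ?_
      have : ∑ b ∈ A, |nco x δ z b| * (Λ / M) ≤ A.card * (Λ * (Λ / M)) := by
        rw [← nsmul_eq_mul]
        apply Finset.sum_le_card_nsmul
        intro b hb
        gcongr; exact hzb b
      have e3 : (A.card : ℝ) * (Λ * (Λ / M)) ≤ N * (Λ * (Λ / M)) := by gcongr
      have e4 : (2 * Λ + N * Λ * Λ) / M = 2 * Λ / M + N * (Λ * (Λ / M)) := by field_simp
      rw [e4]; linarith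
    set y : Jt m n D := (1 / ζ) • z' with hy
    have hζi : 1 / ζ ≤ 2 := by rw [div_le_iff₀ hζ0]; linarith
    have hSy : SG (Γ l x (SC m n * M)) p (SX N Λ / M) y := by
      refine (hSz'.smul (1 / ζ)).mono hconv ?_
      rw [abs_of_pos (by positivity)]
      unfold SX
      rw [mul_div_assoc]; gcongr
    have hya' : nco x δ y a' = 1 := by
      rw [hy, map_smul, Pi.smul_apply, smul_eq_mul, ← hζ]; field_simp
    have hyA : ∀ b ∈ A, nco x δ y b = 0 := by
      intro b hb; rw [hy, map_smul, Pi.smul_apply, hz'A b hb, smul_zero]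
    have hyb : ∀ c, |nco x δ y c| ≤ SX N Λ := by
      intro c
      rw [hy, map_smul, Pi.smul_apply, smul_eq_mul, abs_mul, abs_of_pos (by positivity)]
      unfold SX
      refine mul_le_mul hζi ((hz'b c).trans (by nlinarith)) (abs_nonneg _) (by norm_num)
    refine ⟨insert a' A, Phi_insert ha', ?_⟩
    have hLbig : (Λ + Λ * SX N Λ + SX N Λ) ≤ SL m n D Λ := by
      refine le_trans ?_ hSL1
      have : 0 ≤ (Λ + Λ * SX N Λ + SX N Λ) := by positivity
      nlinarith
    have hΛX : 0 ≤ Λ * SX N Λ := by positivity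
    have htbig : (Λ + Λ * SX N Λ + SX N Λ) / M ≤ SL m n D Λ / (SC m n * M) := by
      rw [div_le_div_iff₀ hM (by positivity)]
      calc _ = SC m n * (Λ + Λ * SX N Λ + SX N Λ) * M := by ring
        _ ≤ _ := by gcongr
    refine ⟨hsubM hp, fun b => if b = a' then y else w b - nco x δ (w b) a' • y, ?_, ?_, ?_⟩
    · intro b hb b' hb'
      rw [Finset.mem_insert] at hb hb'
      beta_reduce
      by_cases hab : b = a'
      · subst hab
        rw [if_pos rfl]
        rcases hb' with rfl | hb'
        · simp [hya']
        · have : b' ≠ b := fun h => ha' (h ▸ hb')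
          simp [this, hyA b' hb']
      · rw [if_neg hab, map_sub, map_smul, Pi.sub_apply, Pi.smul_apply, smul_eq_mul]
        have hbA := hb.resolve_left hab
        rcases hb' with rfl | hb'
        · rw [hya']; simp [Ne.symm hab]
        · rw [hyA b' hb', h1 b hbA b' hb']; simp
    · intro b hb c
      rw [Finset.mem_insert] at hb
      beta_reduce
      by_cases hab : b = a'
      · rw [if_pos hab]; exact (hyb c).trans (by linarith)
      · rw [if_neg hab, map_sub, map_smul, Pi.sub_apply, Pi.smul_apply, smul_eq_mul]
        have hbA := hb.resolve_left hab
        refine (abs_sub _ _).trans ?_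
        rw [abs_mul]
        have q1 := h2 b hbA c
        have q2 : |nco x δ (w b) a'| * |nco x δ y c| ≤ Λ * SX N Λ := mul_le_mul (h2 b hbA a') (hyb c) (abs_nonneg _) (by linarith)
        linarith
    · intro b hb
      rw [Finset.mem_insert] at hb
      beta_reduce
      by_cases hab : b = a'
      · rw [if_pos hab]
        refine hSy.mono hconv (le_trans ?_ htbig)
        gcongr; linarith
      · rw [if_neg hab]
        have hbA := hb.resolve_left hab
        refine (SG.sub hconv (hSw b hbA) (hSy.smul (nco x δ (w b) a'))).mono hconv (le_trans ?_ htbig)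
        calc Λ / M + |nco x δ (w b) a'| * (SX N Λ / M) ≤ Λ / M + Λ * (SX N Λ / M) := by gcongr; exact h2 b hbA a'
          _ = (Λ + Λ * SX N Λ) / M := by ring
          _ ≤ _ := by
            apply div_le_div_of_nonneg_right _ hM.le
            linarith
  · -- alternative 2
    obtain ⟨B, hB1, hB2, g, hg1, hg2, hg3⟩ := hc
    set Om := Wt m n D with hOm
    have key : ∀ b c, nco x δ (∑ a ∈ A, (g b a * (T ^ (Om - wt b) / T ^ (Om - wt a))) • w a) c =
        T ^ (Om - wt b) / T ^ (Om - wt c) * ∑ a ∈ A, g b a * (T ^ (Om - wt c) / T ^ (Om - wt a) * nco x δ (w a) c) := by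
      intro b c
      rw [map_sum, Finset.sum_apply, Finset.mul_sum]
      apply Finset.sum_congr rfl
      intro a ha
      rw [map_smul, Pi.smul_apply, smul_eq_mul]
      field_simp
    have hratio : ∀ b c : Ix m n D, T ^ (Om - wt b) / T ^ (Om - wt c) ≤ T ^ Om := by
      intro b c
      calc T ^ (Om - wt b) / T ^ (Om - wt c) ≤ T ^ (Om - wt b) / 1 := by
            gcongr; exact one_le_pow₀ hT
        _ ≤ T ^ Om := by rw [div_one]; exact pow_le_pow_right₀ hT (Nat.sub_le _ _)
    have hTO : 1 ≤ T ^ Om := one_le_pow₀ hT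
    have hC : Cert Γ B ((N + 1) * T ^ Om * Λ) l M x δ p := by
      refine ⟨hp, fun b => ∑ a ∈ A, (g b a * (T ^ (Om - wt b) / T ^ (Om - wt a))) • w a, ?_, ?_, ?_⟩
      · intro b hb b' hb'
        rw [key, hg2 b hb b' hb']
        by_cases h : b' = b
        · subst h; rw [if_pos rfl, mul_one]; exact div_self (by positivity)
        · simp [h]
      · intro b hb c
        rw [key, abs_mul, abs_of_pos (by positivity)]
        calc _ ≤ T ^ Om * 1 := mul_le_mul (hratio b c) (hg3 b hb c) (abs_nonneg _) (by positivity)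
          _ ≤ _ := by
            have : 1 ≤ (N + 1) * Λ := by nlinarith
            nlinarith
      · intro b hb
        refine (SG.sum hconv0 hp A (t := fun _ => T ^ Om * (Λ / M)) (fun a ha => ?_)).mono hconv0 ?_
        · refine ((h3 a ha).smul _).mono hconv0 ?_
          rw [abs_mul, abs_of_pos (show 0 < T ^ (Om - wt b) / T ^ (Om - wt a) by positivity)]
          gcongr
          calc _ ≤ 1 * T ^ Om := mul_le_mul (hg1 b hb a ha) (hratio b a) (by positivity) (by norm_num)
            _ = _ := one_mul _
        · rw [Finset.sum_const, nsmul_eq_mul]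
          have := card_le_NN A
          calc (A.card : ℝ) * (T ^ Om * (Λ / M)) ≤ (N + 1) * (T ^ Om * (Λ / M)) := by gcongr; linarith
            _ = _ := by ring
    refine ⟨B, Phi_exch_wt hB1 hB2, ?_⟩
    exact (hC.monoM hΓ (by positivity) hM hSC).monoΛ hΓ hSL2 (by positivity)

/-- S4 -/
lemma strongify (m n D : ℕ) (q : ℕ) : ∀ Λ : ℝ, 1 ≤ Λ → ∃ Λ' C' : ℝ, 1 ≤ Λ' ∧ 1 ≤ C' ∧
    ∀ (Γ : ℕ → En n → ℝ → Set (Jt m n D)), SFam Γ → ∀ (A : Finset (Ix m n D)) (l : ℕ) (M : ℝ) (x : En n) (δ : ℝ) (p : Jt m n D),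
      PhiMax m n D ≤ Phi A + q → 0 < M → 0 < δ → δ ≤ 1 → Cert Γ A Λ l M x δ p →
      ∃ B, Mono B ∧ Phi A ≤ Phi B ∧ Cert Γ B Λ' l (C' * M) x δ p := by
  induction q with
  | zero =>
    intro Λ hΛ
    refine ⟨Λ, 1, hΛ, le_rfl, fun Γ hΓ A l M x δ p hA hM hδ hδ1 h => ⟨A, ?_, le_rfl, by rwa [one_mul]⟩⟩
    by_contra hmono
    obtain ⟨B, hB, _⟩ := h.strong_step hΓ hΛ hM hδ hδ1 hmono
    have := Phi_le B
    omega
  | succ q ih =>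
    intro Λ hΛ
    obtain ⟨Λ', C', hΛ', hC', H⟩ := ih (SL m n D Λ) (SL_ge hΛ)
    have hSC := SC_ge m n
    refine ⟨C' * SC m n * Λ + Λ', C' * SC m n, by nlinarith [mul_nonneg (mul_nonneg (by linarith : 0 ≤ C') (by linarith : 0 ≤ SC m n)) (by linarith : 0 ≤ Λ)], by nlinarith, ?_⟩
    intro Γ hΓ A l M x δ p hA hM hδ hδ1 h
    have hCS : 1 ≤ C' * SC m n := by nlinarith
    by_cases hmono : Mono A
    · exact ⟨A, hmono, le_rfl, (h.monoM hΓ (by linarith) hM hCS).monoΛ hΓ (by linarith) (by positivity)⟩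
    · obtain ⟨B, hB, hBc⟩ := h.strong_step hΓ hΛ hM hδ hδ1 hmono
      obtain ⟨B', hB'1, hB'2, hB'3⟩ := H Γ hΓ B l (SC m n * M) x δ p (by omega) (by positivity) hδ hδ1 hBc
      refine ⟨B', hB'1, by omega, ?_⟩
      rw [← mul_assoc] at hB'3
      refine hB'3.monoΛ hΓ ?_ (by positivity)
      have : 0 ≤ C' * SC m n * Λ := by positivity
      linarith

end CmSel

namespace CmSel

variable {m n D : ℕ} {Γ : ℕ → En n → ℝ → Set (Jt m n D)}

def SOK (Γ : ℕ → En n → ℝ → Set (Jt m n D)) (A : Finset (Ix m n D)) (p0 : Jt m n D) (Λ1 : ℝ) (l : ℕ) (M : ℝ) (δ0 : ℝ)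
    (y : En n) (r : ℝ) : Prop :=
  ∃ r', r ≤ r' ∧ r' ≤ δ0 ∧ ∃ p, (∀ a ∈ A, co y (p - p0) a = 0) ∧ ∃ A', Phi A < Phi A' ∧ Cert Γ A' Λ1 l M y r' p

lemma SOK.anti {A : Finset (Ix m n D)} {p0 : Jt m n D} {Λ1 : ℝ} {l : ℕ} {M δ0 : ℝ} {y : En n} {r r1 : ℝ}
    (h : SOK Γ A p0 Λ1 l M δ0 y r) (hr : r1 ≤ r) : SOK Γ A p0 Λ1 l M δ0 y r1 := by
  obtain ⟨r', h1, h2⟩ := h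
  exact ⟨r', hr.trans h1, h2⟩

lemma co_sub_zero {A : Finset (Ix m n D)} {y : En n} {p q p0 : Jt m n D} (h1 : ∀ a ∈ A, co y (p - p0) a = 0)
    (h2 : ∀ a ∈ A, co y (q - p0) a = 0) : ∀ a ∈ A, co y (p - q) a = 0 := by
  intro a ha
  have e : p - q = (p - p0) - (q - p0) := by abel
  rw [e, map_sub, Pi.sub_apply, h1 a ha, h2 a ha, sub_zero]

lemma weakOK (hΓ : SFam Γ) {A : Finset (Ix m n D)} {p0 : Jt m n D} {Λa : ℝ} {l : ℕ} {M δ0 : ℝ} {y : En n} {r : ℝ} {py : Jt m n D}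
    (hΛ : 1 ≤ Λa) (hM : 0 < M) (hr : 0 < r)
    (hy : Cert Γ A Λa (l+1) M y δ0 py) (hz : ∀ a ∈ A, co y (py - p0) a = 0)
    (h : SOK Γ A p0 (3 * LS2 (NN m n D) Λa) l M δ0 y r) :
    ∃ p A', Phi A < Phi A' ∧ Cert Γ A' (LS2 (NN m n D) (3 * LS2 (NN m n D) Λa)) l M y r p ∧ Bd y r (4 * M) (p - py) := by
  obtain ⟨r', h1, h2, p, hp0, A', hA', hc⟩ := h
  have hL2 := LS2_ge (N := NN m n D) hΛ
  have hL3 : 1 ≤ 3 * LS2 (NN m n D) Λa := by linarith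
  have hL4 := LS2_ge (N := NN m n D) hL3
  obtain ⟨B, hB, hBc⟩ := hc.rescale hΓ hL3 hM hr h1
  have hPB : Phi A < Phi B := by
    rcases hB with rfl | hB
    · exact hA'
    · omega
  obtain ⟨B2, hB2, hBc2⟩ := (hy.mono_l hΓ).rescale hΓ hΛ hM hr (h1.trans h2)
  by_cases hc2 : Phi A < Phi B2
  · exact ⟨py, B2, hc2, hBc2.monoΛ hΓ (by linarith) hM, by rw [sub_self]; exact Bd.zero hr.le (by linarith)⟩
  have hB2A : B2 = A := hB2.resolve_right hc2
  subst hB2A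
  by_cases hBd : Bd y r (4 * M) (p - py)
  · exact ⟨p, B, hPB, hBc, hBd⟩
  · obtain ⟨b, hb, κ, hκ0, hκ1, hκB, hcert⟩ := hBc2.add hΓ (by linarith) hM hr hBc.1 (co_sub_zero hp0 hz) hBd
    refine ⟨_, _, Phi_insert hb, hcert.monoΛ hΓ (by linarith) hM, ?_⟩
    rw [add_sub_cancel_left]
    exact hκB.mono hr.le (by linarith)

/-- compatibility constant -/
def CQ (m n D : ℕ) (Λa Q : ℝ) : ℝ :=
  let R1 := CM m n * Q ^ m
  let t := (NN m n D + 1) * R1 * LS2 (NN m n D) Λa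
  4 * (1 + t) + t + R1

lemma CQ_ge {Λa Q : ℝ} (hΛ : 1 ≤ Λa) (hQ : 1 ≤ Q) : 1 ≤ CQ m n D Λa Q := by
  unfold CQ
  have := CM_ge m n
  have := LS2_ge (N := NN m n D) hΛ
  have hΛb0 : 0 < LS2 (NN m n D) Λa := by linarith
  have h0 : 0 ≤ CM m n * Q ^ m := by positivity
  have h1 : 0 ≤ (NN m n D + 1) * (CM m n * Q ^ m) * LS2 (NN m n D) Λa := by positivity
  simp only []
  linarith

lemma compat (hΓ : SFam Γ) {A : Finset (Ix m n D)} (hA : Mono A) {p0 : Jt m n D} {Λa : ℝ} {l : ℕ} {M δ0 : ℝ} {y y0 : En n} {r Q : ℝ} {py py0 : Jt m n D}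
    (hΛ : 1 ≤ Λa) (hM : 0 < M) (hr : 0 < r) (hrδ : r ≤ δ0) (hQ : 1 ≤ Q)
    (hy : Cert Γ A Λa (l+1) M y δ0 py) (hz : ∀ a ∈ A, co y (py - p0) a = 0)
    (hy0 : Cert Γ A Λa (l+1) M y0 δ0 py0) (hz0 : ∀ a ∈ A, co y0 (py0 - p0) a = 0)
    (h : ¬ SOK Γ A p0 (3 * LS2 (NN m n D) Λa) l M δ0 y0 r) (hd : ‖y - y0‖ ≤ Q * r) :
    Bd y0 r (CQ m n D Λa Q * M) (py - py0) := by
  have hCM := CM_ge m n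
  have hL2 := LS2_ge (N := NN m n D) hΛ
  set Λb := LS2 (NN m n D) Λa with hΛb
  have hΛb0 : 0 < Λb := by linarith
  obtain ⟨B2, hB2, hBc2⟩ := (hy0.mono_l hΓ).rescale hΓ hΛ hM hr hrδ
  have hB2A : B2 = A := by
    rcases hB2 with h' | h'
    · exact h'
    · exact absurd ⟨r, le_rfl, hrδ, py0, hz0, B2, h', hBc2.monoΛ hΓ (by linarith) hM⟩ h
  subst hB2A
  obtain ⟨p2, hp2, hB⟩ := hΓ.transport l y M py hy.1 y0
  set R1 := CM m n * Q ^ m with hR1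
  have hR1p : 0 < R1 := by positivity
  have hQr : 0 < Q * r := by positivity
  have hB1 : Bd y0 r (R1 * M) (py - p2) := by
    have h1 := (hB.scale hM.le (norm_nonneg _) hd).move (K := 1) (y := y0) hM.le hQr.le le_rfl (by rw [norm_sub_rev]; linarith)
    intro b
    refine (h1 b).trans ?_
    rw [mul_pow, one_pow, mul_one, hR1]
    have : Q ^ (m - od b) ≤ Q ^ m := pow_le_pow_right₀ hQ (Nat.sub_le _ _)
    calc CM m n * M * (Q ^ (m - od b) * r ^ (m - od b)) ≤ CM m n * M * (Q ^ m * r ^ (m - od b)) := by gcongr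
      _ = _ := by ring
  have hzall : ∀ a ∈ B2, co y0 (py - py0) a = 0 :=
    co_sub_zero (fun a ha => co_zero_on hA hz y0 a ha) hz0
  obtain ⟨hpy0, w, h1, h2, h3⟩ := hBc2
  set s : Ix m n D → ℝ := fun a => nco y0 r (p2 - py0) a with hs
  have hsb : ∀ a ∈ B2, |s a| ≤ R1 * M := by
    intro a ha
    have e : p2 - py0 = (py - py0) - (py - p2) := by abel
    rw [hs]; simp only []
    rw [e, map_sub, Pi.sub_apply, (nco_eq_zero hr).2 (hzall a ha), zero_sub, abs_neg]
    exact (Bd_iff hr).1 hB1 a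
  have hconv := hΓ.conv l y0 M
  set W : Jt m n D := ∑ a ∈ B2, s a • w a with hW
  set t := (NN m n D + 1) * R1 * Λb with ht
  have htp : 0 < t := by positivity
  have hcard := card_le_NN B2
  have hsumb : ∑ a ∈ B2, |s a| ≤ NN m n D * (R1 * M) := by
    calc _ ≤ B2.card • (R1 * M) := Finset.sum_le_card_nsmul _ _ _ hsb
      _ ≤ _ := by rw [nsmul_eq_mul]; gcongr
  have hSW : SG (Γ l y0 M) py0 t W := by
    refine (SG.sum hconv hpy0 B2 (fun a ha => (h3 a ha).smul (s a))).mono hconv ?_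
    rw [← Finset.sum_mul]
    calc (∑ a ∈ B2, |s a|) * (Λb / M) ≤ (NN m n D * (R1 * M)) * (Λb / M) := by gcongr
      _ = NN m n D * R1 * Λb := by field_simp
      _ ≤ t := by rw [ht]; gcongr; linarith
  have hWb : ∀ c, |nco y0 r W c| ≤ t * M := by
    intro c
    rw [hW, map_sum, Finset.sum_apply]
    refine (Finset.abs_sum_le_sum_abs _ _).trans ?_
    calc ∑ a ∈ B2, |nco y0 r (s a • w a) c| ≤ ∑ a ∈ B2, |s a| * Λb := by
          refine Finset.sum_le_sum fun a ha => ?_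
          rw [map_smul, Pi.smul_apply, smul_eq_mul, abs_mul]
          gcongr; exact h2 a ha c
      _ = (∑ a ∈ B2, |s a|) * Λb := by rw [Finset.sum_mul]
      _ ≤ (NN m n D * (R1 * M)) * Λb := by gcongr
      _ = (NN m n D * R1 * Λb) * M := by ring
      _ ≤ t * M := by rw [ht]; gcongr; linarith
  have hWA : ∀ a ∈ B2, nco y0 r W a = s a := by
    intro a ha
    rw [hW, map_sum, Finset.sum_apply, Finset.sum_eq_single a]
    · rw [map_smul, Pi.smul_apply, h1 a ha a ha]; simp
    · intro b hb hne; rw [map_smul, Pi.smul_apply, h1 b hb a ha]; simp [Ne.symm hne]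
    · intro h; exact absurd ha h
  have hpt := (hSW.mem htp).2
  set σ := 1 / (1 + t) with hσ
  have hσ0 : 0 < σ := by positivity
  have hσt : σ * (1 + t) = 1 := by rw [hσ]; field_simp
  have hp3 := hconv hp2 hpt (a := σ) (b := σ * t) hσ0.le (by positivity) (by linarith)
  set p3 := σ • p2 + (σ * t) • (py0 - (1 / t) • W) with hp3d
  have e3 : p3 - py0 = σ • ((p2 - py0) - W) := by
    rw [hp3d, smul_sub (σ * t), smul_smul]
    have : σ * t * (1 / t) = σ := by field_simp
    rw [this]
    have e : py0 = (σ + σ * t) • py0 := by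
      have : σ + σ * t = 1 := by linarith
      rw [this, one_smul]
    conv_lhs => rw [e]
    conv_rhs => rw [e]
    have : σ * t = 1 - σ := by linarith
    rw [this]; module
  have hz3 : ∀ a ∈ B2, co y0 (p3 - py0) a = 0 := by
    intro a ha
    rw [← nco_eq_zero hr, e3, map_smul, map_sub, Pi.smul_apply, Pi.sub_apply, hWA a ha]
    simp [hs]
  have hBd3 : Bd y0 r (4 * M) (p3 - py0) := by
    by_contra hcon
    have hcert : Cert Γ B2 Λb l M y0 r py0 := ⟨hpy0, w, h1, h2, h3⟩
    obtain ⟨b, hb, κ, hκ0, hκ1, hκB, hcert'⟩ := hcert.add hΓ (by linarith) hM hr hp3 hz3 hcon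
    apply h
    refine ⟨r, le_rfl, hrδ, _, ?_, _, Phi_insert hb, hcert'⟩
    intro a ha
    have e : py0 + κ • (p3 - py0) - p0 = (py0 - p0) + κ • (p3 - py0) := by abel
    rw [e, map_add, map_smul, Pi.add_apply, Pi.smul_apply, hz0 a ha, hz3 a ha]; simp
  rw [Bd_iff hr] at hBd3 hB1 ⊢
  intro b
  have f1 := hBd3 b
  rw [e3, map_smul, Pi.smul_apply, smul_eq_mul, abs_mul, abs_of_pos hσ0, map_sub, Pi.sub_apply] at f1
  have f2 : |nco y0 r (p2 - py0) b - nco y0 r W b| ≤ 4 * (1 + t) * M := by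
    have : (1 + t) * (σ * |nco y0 r (p2 - py0) b - nco y0 r W b|) ≤ (1 + t) * (4 * M) := by gcongr
    have e : (1 + t) * (σ * |nco y0 r (p2 - py0) b - nco y0 r W b|) = |nco y0 r (p2 - py0) b - nco y0 r W b| := by
      rw [← mul_assoc, mul_comm (1 + t) σ, hσt, one_mul]
    rw [e] at this; linarith
  have f3 := hWb b
  have f4 := hB1 b
  have e5 : py - py0 = (py - p2) + (p2 - py0) := by abel
  rw [e5, map_add, Pi.add_apply]
  have : CQ m n D Λa Q * M = 4 * (1 + t) * M + t * M + R1 * M := by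
    unfold CQ; simp only []; rw [ht, hΛb, hR1]; ring
  rw [this]
  rw [abs_le] at *
  constructor <;> linarith [f2.1, f2.2, f3.1, f3.2, f4.1, f4.2]

end CmSel

namespace CmSel

section glue
variable {n D : ℕ} {ι : Type*} (c : ι → En n) (ρ : ι → ℝ) (G : ι → En n → Fin D → ℝ) (F0 : En n → Fin D → ℝ)

/-- sequential gluing -/
def glue : List ι → En n → Fin D → ℝ
  | [] => F0
  | z :: L => fun y => bump (c z) (ρ z) y • G z y + (1 - bump (c z) (ρ z) y) • glue L y

variable {c ρ G F0}

lemma glue_contDiff {m : ℕ} (L : List ι) (hG : ∀ z ∈ L, ContDiff ℝ m (G z)) (hF : ContDiff ℝ m F0) :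
    ContDiff ℝ m (glue c ρ G F0 L) := by
  induction L with
  | nil => exact hF
  | cons z L ih =>
    have h1 := ih (fun w hw => hG w (List.mem_cons_of_mem _ hw))
    have h2 := hG z List.mem_cons_self
    have h3 := bump_contDiff (c z) (ρ z) m
    exact (h3.smul h2).add ((contDiff_const.sub h3).smul h1)

lemma glue_val {K : Set (Fin D → ℝ)} (hK : Convex ℝ K) {x : En n} (L : List ι) (hρ : ∀ z ∈ L, 0 < ρ z)
    (h : ∀ z ∈ L, ‖x - c z‖ ≤ 2 * ρ z → G z x ∈ K)
    (h0 : (∃ z ∈ L, ‖x - c z‖ ≤ ρ z) ∨ F0 x ∈ K) : glue c ρ G F0 L x ∈ K := by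
  induction L with
  | nil =>
    rcases h0 with ⟨z, hz, _⟩ | h0
    · simp at hz
    · exact h0
  | cons z L ih =>
    have hzp := hρ z List.mem_cons_self
    have ih' := ih (fun w hw => hρ w (List.mem_cons_of_mem _ hw)) (fun w hw => h w (List.mem_cons_of_mem _ hw))
    have e : glue c ρ G F0 (z :: L) x = bump (c z) (ρ z) x • G z x + (1 - bump (c z) (ρ z) x) • glue c ρ G F0 L x := rfl
    rw [e]
    by_cases h1 : ‖x - c z‖ ≤ ρ z
    · rw [bump_one hzp h1, one_smul, sub_self, zero_smul, add_zero]
      exact h z List.mem_cons_self (by linarith)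
    have ih2 := ih' (by
      rcases h0 with ⟨w, hw, hwx⟩ | h0
      · rcases List.mem_cons.1 hw with rfl | hw
        · exact absurd hwx h1
        · exact Or.inl ⟨w, hw, hwx⟩
      · exact Or.inr h0)
    by_cases h2 : ‖x - c z‖ ≤ 2 * ρ z
    · exact hK (h z List.mem_cons_self h2) ih2 (bump_nonneg _ _ _) (by linarith [bump_le_one (c z) x (ρ z)]) (by ring)
    · rw [bump_zero hzp (by linarith), zero_smul, zero_add, sub_zero, one_smul]; exact ih2

end glue

def CG (m n : ℕ) : ℝ := 2 ^ (m+1) * (1 + BB m n * 4 ^ m)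
lemma CG_ge (m n : ℕ) : 1 ≤ CG m n := by
  unfold CG
  have h1 := BB_ge m n
  have h2 : (1:ℝ) ≤ 2 ^ (m+1) := one_le_pow₀ (by norm_num)
  have h3 : 0 ≤ BB m n * 4 ^ m := by positivity
  nlinarith

lemma glue_bound {m n D : ℕ} {ι : Type*} {c : ι → En n} {ρ : ι → ℝ} {G : ι → En n → Fin D → ℝ}
    {F0 H : En n → Fin D → ℝ} (L : List ι) {y : En n} {r R : ℝ} (hr : 0 < r) (hR : 0 ≤ R)
    (hρ : ∀ z ∈ L, 0 < ρ z)
    (hG : ∀ z ∈ L, ContDiff ℝ m (G z)) (hF : ContDiff ℝ m F0) (hH : ContDiff ℝ m H)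
    (h : ∀ z ∈ L, ‖y - c z‖ ≤ 2 * ρ z → r ≤ 4 * ρ z ∧ ∀ k ≤ m, ‖iteratedFDeriv ℝ k (G z - H) y‖ ≤ R * r ^ (m - k))
    (h0 : (∃ z ∈ L, G z = H ∧ ‖y - c z‖ < ρ z) ∨ ∀ k ≤ m, ‖iteratedFDeriv ℝ k (F0 - H) y‖ ≤ R * r ^ (m - k)) :
    ∀ k ≤ m, ‖iteratedFDeriv ℝ k (glue c ρ G F0 L - H) y‖ ≤
      CG m n ^ (L.countP (fun z => ‖y - c z‖ ≤ 2 * ρ z)) * R * r ^ (m - k) := by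
  induction L with
  | nil =>
    rcases h0 with ⟨z, hz, _⟩ | h0
    · simp at hz
    · intro k hk; simpa [glue] using h0 k hk
  | cons z L ih =>
    have hzp := hρ z List.mem_cons_self
    have hGz := hG z List.mem_cons_self
    have hGL : ∀ w ∈ L, ContDiff ℝ m (G w) := fun w hw => hG w (List.mem_cons_of_mem _ hw)
    have ih' := ih (fun w hw => hρ w (List.mem_cons_of_mem _ hw)) hGL
      (fun w hw => h w (List.mem_cons_of_mem _ hw))
    have hL := glue_contDiff (c := c) (ρ := ρ) L hGL hF
    have hb := bump_contDiff (c z) (ρ z) m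
    have hCG := CG_ge m n
    by_cases ha : ‖y - c z‖ ≤ 2 * ρ z
    · have hcount : (z :: L).countP (fun z => ‖y - c z‖ ≤ 2 * ρ z) = L.countP (fun z => ‖y - c z‖ ≤ 2 * ρ z) + 1 := by
        rw [List.countP_cons]; simp [ha]
      rw [hcount]
      set a := L.countP (fun z => ‖y - c z‖ ≤ 2 * ρ z) with had
      by_cases hz0 : G z = H ∧ ‖y - c z‖ < ρ z
      · intro k hk
        have ev : (glue c ρ G F0 (z :: L) - H) =ᶠ[nhds y] (0 : En n → Fin D → ℝ) := by
          have : ∀ᶠ w in nhds y, ‖w - c z‖ < ρ z := by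
            have hc : ContinuousAt (fun w : En n => ‖w - c z‖) y := by fun_prop
            exact hc.eventually_lt continuousAt_const hz0.2
          filter_upwards [this] with w hw
          have e : (glue c ρ G F0 (z :: L) - H) w = bump (c z) (ρ z) w • G z w + (1 - bump (c z) (ρ z) w) • glue c ρ G F0 L w - H w := rfl
          rw [e, bump_one hzp hw.le, hz0.1]; simp
        rw [(ev.iteratedFDeriv ℝ k).eq_of_nhds]
        have : (0 : En n → Fin D → ℝ) = fun _ => 0 := rfl
        rw [this]
        have hz : ‖iteratedFDeriv ℝ k (fun _ : En n => (0 : Fin D → ℝ)) y‖ = 0 := by simp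
        rw [hz]
        positivity
      have ih2 := ih' (by
        rcases h0 with ⟨w, hw, hwx⟩ | h0
        · rcases List.mem_cons.1 hw with rfl | hw
          · exact absurd hwx hz0
          · exact Or.inl ⟨w, hw, hwx⟩
        · exact Or.inr h0)
      obtain ⟨h1, h2⟩ := h z List.mem_cons_self ha
      have hBB := BB_ge m n
      have hbd : ∀ k ≤ m, ‖iteratedFDeriv ℝ k (bump (c z) (ρ z)) y‖ ≤ (1 + BB m n * 4 ^ m) / r ^ k := by
        intro k hk
        refine (bump_bound (c z) hzp hk y).trans ?_
        rw [div_le_div_iff₀ (by positivity) (by positivity)]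
        calc BB m n * r ^ k ≤ BB m n * (4 * ρ z) ^ k := by gcongr
          _ = BB m n * 4 ^ k * ρ z ^ k := by rw [mul_pow]; ring
          _ ≤ BB m n * 4 ^ m * ρ z ^ k := by gcongr; norm_num
          _ ≤ _ := by gcongr; linarith
      have hbd2 : ∀ k ≤ m, ‖iteratedFDeriv ℝ k (fun w => 1 - bump (c z) (ρ z) w) y‖ ≤ (1 + BB m n * 4 ^ m) / r ^ k := by
        intro k hk
        rcases Nat.eq_zero_or_pos k with rfl | hkp
        · rw [norm_iteratedFDeriv_zero, pow_zero, div_one, Real.norm_eq_abs]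
          have i1 := bump_nonneg (c z) y (ρ z)
          have i2 := bump_le_one (c z) y (ρ z)
          rw [abs_of_nonneg (by linarith)]
          have : 0 ≤ BB m n * 4 ^ m := by positivity
          linarith
        · have c1 : ContDiff ℝ k (fun _ : En n => (1:ℝ)) := contDiff_const
          have c2 := bump_contDiff (c z) (ρ z) k
          have e : (fun w => 1 - bump (c z) (ρ z) w) = (fun _ : En n => (1:ℝ)) - bump (c z) (ρ z) := rfl
          rw [e, iteratedFDeriv_sub_apply c1.contDiffAt c2.contDiffAt, iteratedFDeriv_const_of_ne (by omega)]
          simpa using hbd k hk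
      have hl1 := leib hb (hGz.sub hH) hr hbd h2
      have hl2 := leib (contDiff_const.sub hb) (hL.sub hH) hr hbd2 ih2
      intro k hk
      have hks : (k : WithTop ℕ∞) ≤ m := by exact_mod_cast hk
      have e : glue c ρ G F0 (z :: L) - H = (fun w => bump (c z) (ρ z) w • (G z - H) w) +
          (fun w => (1 - bump (c z) (ρ z) w) • (glue c ρ G F0 L - H) w) := by
        funext w
        have e : (glue c ρ G F0 (z :: L) - H) w = bump (c z) (ρ z) w • G z w + (1 - bump (c z) (ρ z) w) • glue c ρ G F0 L w - H w := rfl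
        rw [e]
        simp only [Pi.add_apply, Pi.sub_apply]
        module
      have c1 : ContDiff ℝ k (fun w => bump (c z) (ρ z) w • (G z - H) w) := (hb.smul (hGz.sub hH)).of_le hks
      have c2 : ContDiff ℝ k (fun w => (1 - bump (c z) (ρ z) w) • (glue c ρ G F0 L - H) w) :=
        ((contDiff_const.sub hb).smul (hL.sub hH)).of_le hks
      rw [e, iteratedFDeriv_add_apply c1.contDiffAt c2.contDiffAt]
      refine (norm_add_le _ _).trans ((add_le_add (hl1 k hk) (hl2 k hk)).trans ?_)
      have hCa : 1 ≤ CG m n ^ a := one_le_pow₀ hCG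
      have hB0 : 0 ≤ 1 + BB m n * 4 ^ m := by positivity
      have e1 : 2 ^ m * (1 + BB m n * 4 ^ m) * R * r ^ (m - k) ≤ 2 ^ m * (1 + BB m n * 4 ^ m) * (CG m n ^ a * R) * r ^ (m - k) := by
        gcongr; nlinarith
      have e2 : CG m n ^ (a+1) * R * r ^ (m-k) = 2 ^ m * (1 + BB m n * 4 ^ m) * (CG m n ^ a * R) * r ^ (m - k) +
          2 ^ m * (1 + BB m n * 4 ^ m) * (CG m n ^ a * R) * r ^ (m - k) := by
        rw [pow_succ]; nth_rewrite 2 [CG]; ring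
      rw [e2]
      linarith
    · have hcount : (z :: L).countP (fun z => ‖y - c z‖ ≤ 2 * ρ z) = L.countP (fun z => ‖y - c z‖ ≤ 2 * ρ z) := by
        rw [List.countP_cons]; simp [ha]
      rw [hcount]
      have ih2 := ih' (by
        rcases h0 with ⟨w, hw, hwx⟩ | h0
        · rcases List.mem_cons.1 hw with rfl | hw
          · exact absurd (show ‖y - c w‖ ≤ 2 * ρ w by linarith [hwx.2]) ha
          · exact Or.inl ⟨w, hw, hwx⟩
        · exact Or.inr h0)
      intro k hk
      have ev : (glue c ρ G F0 (z :: L) - H) =ᶠ[nhds y] (glue c ρ G F0 L - H) := by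
        have : ∀ᶠ w in nhds y, 2 * ρ z < ‖w - c z‖ := by
          have hc : ContinuousAt (fun w : En n => ‖w - c z‖) y := by fun_prop
          exact continuousAt_const.eventually_lt hc (not_le.1 ha)
        filter_upwards [this] with w hw
        have e : (glue c ρ G F0 (z :: L) - H) w = bump (c z) (ρ z) w • G z w + (1 - bump (c z) (ρ z) w) • glue c ρ G F0 L w - H w := rfl
        rw [e, bump_zero hzp hw.le]; simp
      rw [(ev.iteratedFDeriv ℝ k).eq_of_nhds]
      exact ih2 k hk

end CmSel

namespace CmSel

def gcen {n : ℕ} (s : ℝ) (k : Fin n → ℤ) : En n := WithLp.toLp 2 (fun i => s * (k i : ℝ))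

lemma gcen_apply {n : ℕ} (s : ℝ) (k : Fin n → ℤ) (i : Fin n) : gcen s k i = s * (k i : ℝ) := rfl

lemma norm_le_of_coord {n : ℕ} {x : En n} {t : ℝ} (ht : 0 ≤ t) (h : ∀ i, |x i| ≤ t) : ‖x‖ ≤ n * t := by
  rw [EuclideanSpace.norm_eq]
  rw [Real.sqrt_le_left (by positivity)]
  calc ∑ i, ‖x i‖ ^ 2 ≤ ∑ i : Fin n, t ^ 2 := Finset.sum_le_sum fun i _ => by
        rw [Real.norm_eq_abs]; gcongr; exact h i
    _ = n * t ^ 2 := by simp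
    _ ≤ n * (n * t ^ 2) := by
        rcases Nat.eq_zero_or_pos n with rfl | hn
        · simp
        · have : (1:ℝ) ≤ n := by exact_mod_cast hn
          have h2 : 0 ≤ (n:ℝ) * t ^ 2 := by positivity
          nlinarith
    _ = (n * t) ^ 2 := by ring

lemma exists_gcen {n : ℕ} (hn : 1 ≤ n) (y : En n) {s : ℝ} (hs : 0 < s) : ∃ k : Fin n → ℤ, ‖y - gcen s k‖ < n * s := by
  have hn' : (1:ℝ) ≤ n := by exact_mod_cast hn
  refine ⟨fun i => round (y i / s), ?_⟩
  have : ‖y - gcen s (fun i => round (y i / s))‖ ≤ n * (s / 2) := by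
    apply norm_le_of_coord (by positivity)
    intro i
    have e : (y - gcen s (fun i => round (y i / s))) i = s * (y i / s - round (y i / s)) := by
      rw [PiLp.sub_apply, gcen_apply]; field_simp
    rw [e, abs_mul, abs_of_pos hs]
    have := abs_sub_round (y i / s)
    nlinarith
  nlinarith

lemma lattice_count {n : ℕ} {s : ℝ} (hs : 0 < s) (y : En n) : ∃ T : Finset (Fin n → ℤ), T.card ≤ (4 * n + 1) ^ n ∧
    ∀ k, ‖y - gcen s k‖ ≤ 2 * (n * s) → k ∈ T := by
  refine ⟨Fintype.piFinset (fun i => Finset.Icc ⌈y i / s - 2 * n⌉ ⌊y i / s + 2 * n⌋), ?_, ?_⟩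
  · rw [Fintype.card_piFinset]
    refine (Finset.prod_le_pow_card _ _ (4 * n + 1) ?_).trans (by simp)
    intro i _
    rw [Int.card_Icc]
    have h1 := Int.le_ceil (y i / s - 2 * n)
    have h2 := Int.floor_le (y i / s + 2 * n)
    have h3 : ((⌊y i / s + 2 * n⌋ : ℤ) : ℝ) ≤ ((⌈y i / s - 2 * n⌉ + 4 * n : ℤ) : ℝ) := by push_cast; linarith
    have h4 := Int.cast_le.1 h3
    omega
  · intro k hk
    rw [Fintype.mem_piFinset]
    intro i
    have h1 : |(y - gcen s k) i| ≤ 2 * (n * s) := (PiLp.norm_apply_le (y - gcen s k) i).trans hk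
    rw [PiLp.sub_apply, gcen_apply, abs_le] at h1
    have e : y i = s * (y i / s) := by field_simp
    rw [e] at h1
    rw [Finset.mem_Icc]
    constructor
    · apply Int.ceil_le.2
      by_contra hc
      push Not at hc
      have := mul_lt_mul_of_pos_left hc hs
      linarith [h1.2]
    · apply Int.le_floor.2
      by_contra hc
      push Not at hc
      have := mul_lt_mul_of_pos_left hc hs
      linarith [h1.1]

def Cell {n : ℕ} (OK : En n → ℝ → Prop) (a ρ0 : ℝ) (c : En n) (ρ : ℝ) : Prop :=
  0 < ρ ∧ ρ ≤ ρ0 ∧ OK c (a * ρ) ∧ (ρ = ρ0 ∨ ¬ OK c (5 * a * ρ))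

lemma grid_glue (m n D : ℕ) (hn : 1 ≤ n) : ∃ C : ℝ, 1 ≤ C ∧ ∀ (OK : En n → ℝ → Prop)
    (_ : ∀ z z' r r', OK z r → ‖z - z'‖ + r' ≤ r → OK z' r') (a ρ0 rmin R0 : ℝ) (_ : 16 ≤ a) (_ : 0 < ρ0)
    (_ : 0 < rmin) (_ : ∀ z, OK z rmin) (G : En n → ℝ → En n → Fin D → ℝ) (_ : ∀ c ρ, ContDiff ℝ m (G c ρ)),
    ∃ F : En n → Fin D → ℝ, ContDiff ℝ m F ∧ ∀ y, ‖y‖ ≤ R0 →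
      (∃ c ρ, Cell OK a ρ0 c ρ ∧ ‖y - c‖ < ρ ∧ ∀ R, 0 ≤ R →
        (∀ c' ρ', Cell OK a ρ0 c' ρ' → ‖y - c'‖ ≤ 2 * ρ' → ρ ≤ 4 * ρ' → ρ' ≤ 4 * ρ → ∀ k ≤ m,
          ‖iteratedFDeriv ℝ k (G c' ρ' - G c ρ) y‖ ≤ R * ρ ^ (m - k)) →
        ∀ k ≤ m, ‖iteratedFDeriv ℝ k (F - G c ρ) y‖ ≤ C * R * ρ ^ (m - k)) ∧
      (∀ K : Set (Fin D → ℝ), Convex ℝ K →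
        (∀ c' ρ', Cell OK a ρ0 c' ρ' → ‖y - c'‖ ≤ 2 * ρ' → G c' ρ' y ∈ K) → F y ∈ K) := by
  have hCG := CG_ge m n
  refine ⟨CG m n ^ (5 * (4 * n + 1) ^ n), one_le_pow₀ hCG, ?_⟩
  intro OK hOK a ρ0 rmin R0 ha hρ0 hrmin hOKmin G hG
  have hn' : (1:ℝ) ≤ n := by exact_mod_cast hn
  have hn0 : (n:ℝ) ≠ 0 := by positivity
  let rr : ℕ → ℝ := fun j => ρ0 / 2 ^ j
  have hrr : ∀ j, rr j = ρ0 / 2 ^ j := fun j => rfl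
  have hrp : ∀ j, 0 < rr j := fun j => by rw [hrr]; positivity
  have hr0 : ∀ j, rr j ≤ ρ0 := fun j => by
    rw [hrr]; exact div_le_self hρ0.le (one_le_pow₀ (by norm_num))
  have hrs : ∀ j d, rr (j + d) * 2 ^ d = rr j := fun j d => by rw [hrr, hrr, pow_add]; field_simp
  have hranti : ∀ j j', j ≤ j' → rr j' ≤ rr j := fun j j' h => by
    rw [hrr, hrr]; apply div_le_div_of_nonneg_left hρ0.le (by positivity)
    exact pow_le_pow_right₀ (by norm_num) h
  obtain ⟨J, hJ⟩ : ∃ J, 2 * a * rr J ≤ rmin := by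
    obtain ⟨J, hJ⟩ := pow_unbounded_of_one_lt (2 * a * ρ0 / rmin) (show (1:ℝ) < 2 by norm_num)
    refine ⟨J, ?_⟩
    rw [hrr, mul_div_assoc', div_le_iff₀ (by positivity)]
    rw [div_lt_iff₀ hrmin] at hJ; linarith
  obtain ⟨B, hB⟩ := exists_nat_gt ((R0 + ρ0) / (rr J / n))
  let cc : ℕ × (Fin n → ℤ) → En n := fun z => gcen (rr z.1 / n) z.2
  let ρρ : ℕ × (Fin n → ℤ) → ℝ := fun z => rr z.1
  let I : Finset (ℕ × (Fin n → ℤ)) :=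
    ((Finset.range (J+1)) ×ˢ (Fintype.piFinset (fun _ : Fin n => Finset.Icc (-(B:ℤ)) B))).filter
      (fun z => Cell OK a ρ0 (cc z) (ρρ z))
  let L := I.toList
  have hLc : ∀ z ∈ L, Cell OK a ρ0 (cc z) (ρρ z) := fun z hz =>
    (Finset.mem_filter.1 (Finset.mem_toList.1 hz)).2
  have hLρ : ∀ z ∈ L, 0 < ρρ z := fun z _ => hrp _
  -- covering
  have hcover : ∀ y, ‖y‖ ≤ R0 → ∃ z ∈ L, ‖y - cc z‖ < ρρ z := by
    intro y hy
    have hex : ∃ j, OK y (2 * a * rr j) := ⟨J, hOK y y rmin _ (hOKmin y) (by simpa using hJ)⟩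
    set j := Nat.find hex with hj
    have hjs := Nat.find_spec hex
    rw [← hj] at hjs
    have hjJ : j ≤ J := Nat.find_min' hex (hOK y y rmin _ (hOKmin y) (by simpa using hJ))
    have hsp : 0 < rr j / n := div_pos (hrp j) (by positivity)
    obtain ⟨k, hk⟩ := exists_gcen hn y hsp
    have e : (n:ℝ) * (rr j / n) = rr j := by field_simp
    rw [e] at hk
    refine ⟨(j, k), ?_, hk⟩
    have hrj := hrp j
    rw [Finset.mem_toList, Finset.mem_filter]
    refine ⟨?_, hrp j, hr0 j, ?_, ?_⟩
    · rw [Finset.mem_product]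
      refine ⟨Finset.mem_range.2 (by show j < J + 1; omega), ?_⟩
      rw [Fintype.mem_piFinset]
      intro i
      have h1 : |gcen (rr j / n) k i| ≤ R0 + ρ0 := by
        refine (PiLp.norm_apply_le (gcen (rr j / n) k) i).trans ?_
        have := norm_sub_norm_le (gcen (rr j / n) k) y
        rw [norm_sub_rev] at this
        linarith [hr0 j]
      rw [gcen_apply, abs_mul, abs_of_pos hsp] at h1
      have hsJ : rr J / n ≤ rr j / n := by gcongr; exact hranti _ _ hjJ
      have hsJp : 0 < rr J / n := div_pos (hrp J) (by positivity)
      rw [div_lt_iff₀ hsJp] at hB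
      have h2 : |((k i : ℤ) : ℝ)| < B := by
        by_contra hc
        push Not at hc
        have : (B:ℝ) * (rr J / n) ≤ rr j / n * |((k i : ℤ) : ℝ)| := by
          rw [mul_comm]; gcongr
        linarith
      rw [abs_lt] at h2
      rw [Finset.mem_Icc]
      have h3 : ((-(B:ℤ) : ℤ) : ℝ) < (k i : ℝ) := by push_cast; exact h2.1
      have h4 : (k i : ℝ) < ((B:ℤ) : ℝ) := by push_cast; exact h2.2
      exact ⟨(Int.cast_lt.1 h3).le, (Int.cast_lt.1 h4).le⟩
    · apply hOK y _ _ _ hjs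
      show ‖y - gcen (rr j / n) k‖ + a * rr j ≤ 2 * a * rr j
      nlinarith
    · by_cases hj0 : j = 0
      · left; show rr j = ρ0; rw [hj0, hrr]; simp
      · right
        intro hok
        have h1 : ¬ OK y (2 * a * rr (j - 1)) := Nat.find_min hex (by omega)
        apply h1
        apply hOK _ y _ _ hok
        have h2 := hrs (j-1) 1
        rw [Nat.sub_add_cancel (by omega)] at h2
        show ‖gcen (rr j / n) k - y‖ + 2 * a * rr (j-1) ≤ 5 * a * rr j
        rw [norm_sub_rev, ← h2]
        nlinarith
  -- comparability
  have hcmp : ∀ (y : En n) (z z' : ℕ × (Fin n → ℤ)), Cell OK a ρ0 (cc z) (ρρ z) → Cell OK a ρ0 (cc z') (ρρ z') →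
      ‖y - cc z‖ ≤ 2 * ρρ z → ‖y - cc z'‖ ≤ 2 * ρρ z' → z'.1 ≤ z.1 + 2 := by
    intro y z z' hz hz' h1 h2
    by_contra hc
    push Not at hc
    obtain ⟨d, hd⟩ : ∃ d, z'.1 = (z.1 + d) + 3 := ⟨z'.1 - z.1 - 3, by omega⟩
    have e1 := hrs (z.1 + d) 3
    have e2 := hranti z.1 (z.1 + d) (by omega)
    rw [← hd] at e1
    have hp := hrp z.1
    have hp' := hrp z'.1
    rcases hz'.2.2.2 with h3 | h3
    · have : ρρ z' < ρρ z := by show rr z'.1 < rr z.1; linarith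
      have := hz.2.1
      linarith
    · apply h3
      apply hOK _ _ _ _ hz.2.2.1
      have h5 : ‖cc z - cc z'‖ ≤ 2 * rr z.1 + 2 * rr z'.1 := by
        have : cc z - cc z' = (y - cc z') - (y - cc z) := by abel
        rw [this]
        refine (norm_sub_le _ _).trans ?_
        have h1' : ‖y - cc z‖ ≤ 2 * rr z.1 := h1
        have h2' : ‖y - cc z'‖ ≤ 2 * rr z'.1 := h2
        linarith
      show ‖cc z - cc z'‖ + 5 * a * rr z'.1 ≤ a * rr z.1
      have h6 : rr z'.1 * 8 ≤ rr z.1 := by norm_num at e1; linarith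
      have h7 : 5 * a * (rr z'.1 * 8) ≤ 5 * a * rr z.1 := by gcongr
      nlinarith
  have hcmpr : ∀ j j', j' ≤ j + 2 → rr j ≤ 4 * rr j' := by
    intro j j' h
    have h1 := hranti j' (j+2) h
    have h2 := hrs j 2
    norm_num at h2
    linarith
  have hGL : ∀ z ∈ L, ContDiff ℝ m ((fun z => G (cc z) (ρρ z)) z) := fun z _ => hG _ _
  refine ⟨glue cc ρρ (fun z => G (cc z) (ρρ z)) 0 L, glue_contDiff L hGL contDiff_const, ?_⟩
  intro y hy
  obtain ⟨z0, hz0, hyz0⟩ := hcover y hy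
  have hz0p := hrp z0.1
  have hz0' : ‖y - cc z0‖ ≤ 2 * ρρ z0 := by
    show _ ≤ 2 * rr z0.1
    have : ‖y - cc z0‖ < rr z0.1 := hyz0
    linarith
  refine ⟨⟨cc z0, ρρ z0, hLc z0 hz0, hyz0, ?_⟩, ?_⟩
  · intro R hR h k hk
    have key := glue_bound (c := cc) (ρ := ρρ) (G := fun z => G (cc z) (ρρ z)) (F0 := 0) (H := G (cc z0) (ρρ z0)) L (y := y)
      hz0p hR hLρ hGL contDiff_const (hG _ _) ?_ (Or.inl ⟨z0, hz0, rfl, hyz0⟩) k hk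
    · refine key.trans ?_
      have hp := pow_pos hz0p (m - k)
      have hcount : L.countP (fun z => ‖y - cc z‖ ≤ 2 * ρρ z) ≤ 5 * (4 * n + 1) ^ n := by
        have e : L.countP (fun z => ‖y - cc z‖ ≤ 2 * ρρ z) = (I.filter (fun z => ‖y - cc z‖ ≤ 2 * ρρ z)).card := by
          rw [List.countP_eq_length_filter]
          rw [← List.toFinset_card_of_nodup]
          · congr 1; ext z; simp [L]
          · exact (Finset.nodup_toList I).filter _
        rw [e]
        have hsp : ∀ j, 0 < rr j / n := fun j => div_pos (hrp j) (by positivity)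
        choose T hT1 hT2 using fun j => lattice_count (hsp j) y
        have hsub : I.filter (fun z => ‖y - cc z‖ ≤ 2 * ρρ z) ⊆
            (Finset.Icc (z0.1 - 2) (z0.1 + 2)).biUnion (fun j => (T j).image (fun k => (j, k))) := by
          intro z hz
          rw [Finset.mem_filter] at hz
          have hzL : z ∈ L := Finset.mem_toList.2 hz.1
          have i1 := hcmp y z z0 (hLc z hzL) (hLc z0 hz0) hz.2 hz0'
          have i2 := hcmp y z0 z (hLc z0 hz0) (hLc z hzL) hz0' hz.2
          rw [Finset.mem_biUnion]
          refine ⟨z.1, Finset.mem_Icc.2 ⟨by omega, i2⟩, ?_⟩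
          rw [Finset.mem_image]
          refine ⟨z.2, hT2 z.1 z.2 ?_, rfl⟩
          have e : (n:ℝ) * (rr z.1 / n) = rr z.1 := by field_simp
          rw [e]; exact hz.2
        refine (Finset.card_le_card hsub).trans ?_
        refine (Finset.card_biUnion_le_card_mul _ _ ((4 * n + 1) ^ n) ?_).trans ?_
        · intro j _
          exact Finset.card_image_le.trans (hT1 j)
        · apply Nat.mul_le_mul_right
          rw [Nat.card_Icc]; omega
      have := pow_le_pow_right₀ hCG hcount
      show _ ≤ CG m n ^ (5 * (4 * n + 1) ^ n) * R * (rr z0.1) ^ (m - k)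
      gcongr
    · intro z hz hyz
      have i1 := hcmp y z z0 (hLc z hz) (hLc z0 hz0) hyz hz0'
      have i2 := hcmp y z0 z (hLc z0 hz0) (hLc z hz) hz0' hyz
      exact ⟨hcmpr _ _ i2, h (cc z) (ρρ z) (hLc z hz) hyz (hcmpr _ _ i2) (hcmpr _ _ i1)⟩
  · intro K hK h
    exact glue_val hK L hLρ (fun z hz hyz => h _ _ (hLc z hz) hyz) (Or.inl ⟨z0, hz0, hyz0.le⟩)

end CmSel

namespace CmSel

/-- derivative bounds at a point and a scale -/
def DB {n D : ℕ} (m : ℕ) (y : En n) (r R : ℝ) (F : En n → Fin D → ℝ) : Prop :=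
  ContDiff ℝ m F ∧ ∀ k ≤ m, ‖iteratedFDeriv ℝ k F y‖ ≤ R * r ^ (m - k)

section DB
variable {m n D : ℕ} {y : En n} {r R S : ℝ} {F G H : En n → Fin D → ℝ}

lemma DB.add (h : DB m y r R F) (h' : DB m y r S G) : DB m y r (R + S) (F + G) := by
  refine ⟨h.1.add h'.1, fun k hk => ?_⟩
  have hks : (k : WithTop ℕ∞) ≤ m := by exact_mod_cast hk
  rw [iteratedFDeriv_add_apply (h.1.of_le hks).contDiffAt (h'.1.of_le hks).contDiffAt, add_mul]
  exact (norm_add_le _ _).trans (add_le_add (h.2 k hk) (h'.2 k hk))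
lemma DB.tri (h : DB m y r R (F - G)) (h' : DB m y r S (G - H)) : DB m y r (R + S) (F - H) := by
  have := h.add h'; rwa [sub_add_sub_cancel] at this
lemma DB.symm (h : DB m y r R (F - G)) : DB m y r R (G - F) := by
  have e : G - F = (-1 : ℝ) • (F - G) := by simp
  rw [e]
  refine ⟨h.1.const_smul (-1 : ℝ), fun k hk => ?_⟩
  have hks : (k : WithTop ℕ∞) ≤ m := by exact_mod_cast hk
  rw [iteratedFDeriv_const_smul_apply (h.1.of_le hks).contDiffAt, norm_smul]
  simpa using h.2 k hk
lemma DB.mono (h : DB m y r R F) (hr : 0 ≤ r) (hRS : R ≤ S) : DB m y r S F :=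
  ⟨h.1, fun k hk => (h.2 k hk).trans (by gcongr)⟩
lemma DB.scale {r' : ℝ} (h : DB m y r R F) (hr : 0 ≤ r) (hR : 0 ≤ R) (hrr : r ≤ r') : DB m y r' R F :=
  ⟨h.1, fun k hk => (h.2 k hk).trans (by gcongr)⟩
lemma DB.scaleT {T : ℝ} (h : DB m y (T * r) R F) (hr : 0 ≤ r) (hR : 0 ≤ R) (hT : 1 ≤ T) : DB m y r (R * T ^ m) F :=
  ⟨h.1, fun k hk => (h.2 k hk).trans (by
    rw [mul_pow, ← mul_assoc]
    have : T ^ (m - k) ≤ T ^ m := pow_le_pow_right₀ hT (Nat.sub_le _ _)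
    gcongr)⟩
lemma DB.self (cF : ContDiff ℝ m F) (hr : 0 ≤ r) (hR : 0 ≤ R) : DB m y r R (F - F) := by
  rw [sub_self]
  refine ⟨contDiff_const, fun k _ => ?_⟩
  have : (0 : En n → Fin D → ℝ) = fun _ => 0 := rfl
  have hz : ‖iteratedFDeriv ℝ k (fun _ : En n => (0 : Fin D → ℝ)) y‖ = 0 := by simp
  rw [this, hz]; positivity
lemma DB.of_Bd {x : En n} {K : ℝ} {p q : Jt m n D} (hp : Bd x r R (p - q)) (hR : 0 ≤ R) (hr : 0 ≤ r) (hK : 1 ≤ K)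
    (h : ‖y - x‖ ≤ K * r) : DB m y r (CP m n * K ^ m * R) (pl p - pl q) := by
  rw [← pl_sub]
  exact ⟨contDiff_pl _ _, fun k hk => pl_bound hp hR hr hK h hk⟩
end DB

lemma Bd.scaleT {m n D : ℕ} {x : En n} {r R T : ℝ} {p : Jt m n D} (h : Bd x (T * r) R p) (hr : 0 ≤ r) (hR : 0 ≤ R)
    (hT : 1 ≤ T) : Bd x r (R * T ^ m) p := by
  intro b
  refine (h b).trans ?_
  rw [mul_pow, ← mul_assoc]
  have : T ^ (m - od b) ≤ T ^ m := pow_le_pow_right₀ hT (Nat.sub_le _ _)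
  gcongr

structure Stp {m n D : ℕ} (q : ℕ) (E0 E1 : Finset (En n)) (K : En n → Set (Fin D → ℝ)) (A : Finset (Ix m n D))
    (Λa a η M δ0 ρ0 : ℝ) (p0 : Jt m n D) (py : En n → Jt m n D) : Prop where
  hm : 1 ≤ m
  hK : ∀ x ∈ E0, Convex ℝ (K x)
  hA : Mono A
  hPhi : PhiMax m n D < Phi A + (q + 1)
  hΛ : 1 ≤ Λa
  hM : 0 < M
  hδ : 0 < δ0
  hδ1 : δ0 ≤ 1
  ha : 16 ≤ a
  hη : 0 < η
  hη1 : η ≤ 1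
  hρ0 : 10 * a * ρ0 = η * δ0
  hE : E1 ⊆ E0
  hcert : ∀ y ∈ E1, Cert (GLv m D E0 K) A Λa (2 * q + 1) M y δ0 (py y)
  hz : ∀ y ∈ E1, ∀ b ∈ A, co y (py y - p0) b = 0
  hB : ∀ y ∈ E1, Bd y δ0 (2 * M) (py y - p0)

section step
variable {m n D q : ℕ} {E0 E1 : Finset (En n)} {K : En n → Set (Fin D → ℝ)} {A : Finset (Ix m n D)}
    {Λa a η M δ0 ρ0 : ℝ} {p0 : Jt m n D} {py : En n → Jt m n D}

def sok (m D q : ℕ) (E0 : Finset (En n)) (K : En n → Set (Fin D → ℝ)) (A : Finset (Ix m n D)) (Λa M δ0 : ℝ) (p0 : Jt m n D)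
    (y : En n) (r : ℝ) : Prop :=
  SOK (GLv m D E0 K) A p0 (3 * LS2 (NN m n D) Λa) (2 * q) M δ0 y r

def PS (q : ℕ) (E0 E1 : Finset (En n)) (K : En n → Set (Fin D → ℝ)) (A : Finset (Ix m n D))
    (Λa a M δ0 ρ0 : ℝ) (p0 : Jt m n D) (py : En n → Jt m n D) (c : En n) (ρ : ℝ) (P : Jt m n D) : Prop :=
  (ρ = ρ0 ∧ P = p0) ∨ ∃ y0 ∈ E1, ‖y0 - c‖ ≤ 5 * a * ρ ∧ ¬ sok m D q E0 K A Λa M δ0 p0 y0 (5 * a * ρ) ∧ P = py y0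

def C2 (m n D : ℕ) (Λa a η : ℝ) : ℝ := CM m n * CQ m n D Λa 8 * (5 * a) ^ m + CM m n * 4 ^ m * 2 * (10 * a / η) ^ m

lemma C2_ge (hΛ : 1 ≤ Λa) (ha : 16 ≤ a) (hη : 0 < η) : 1 ≤ C2 m n D Λa a η := by
  unfold C2
  have h1 := CM_ge m n
  have h2 := CQ_ge (m := m) (n := n) (D := D) hΛ (show (1:ℝ) ≤ 8 by norm_num)
  have h3 : (1:ℝ) ≤ (5 * a) ^ m := one_le_pow₀ (by linarith)
  have h4 : 0 ≤ CM m n * 4 ^ m * 2 * (10 * a / η) ^ m := by positivity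
  have h5 : 1 ≤ CM m n * CQ m n D Λa 8 := by nlinarith
  nlinarith

lemma Stp.K2 (h : Stp q E0 E1 K A Λa a η M δ0 ρ0 p0 py) {c : En n} {ρ : ℝ} {P : Jt m n D} (hρ : 0 < ρ) (hρ' : ρ ≤ ρ0)
    (hP : PS q E0 E1 K A Λa a M δ0 ρ0 p0 py c ρ P) {y1 : En n} (hy1 : y1 ∈ E1) (hd : ‖y1 - c‖ ≤ 32 * a * ρ) :
    Bd c ρ (C2 m n D Λa a η * M) (py y1 - P) := by
  have hM := h.hM
  have hδ := h.hδ
  have ha := h.ha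
  have hη := h.hη
  have hη1 := h.hη1
  have h1 := CM_ge m n
  have h2 := CQ_ge (m := m) (n := n) (D := D) h.hΛ (show (1:ℝ) ≤ 8 by norm_num)
  have hρ0 := h.hρ0
  have hηδ : η * δ0 ≤ δ0 := by nlinarith
  have haρ : a * ρ ≤ a * ρ0 := by gcongr
  have h4 : 0 ≤ CM m n * 4 ^ m * 2 * (10 * a / η) ^ m := by positivity
  have h5 : 0 ≤ CM m n * CQ m n D Λa 8 * (5 * a) ^ m := by positivity
  rcases hP with ⟨rfl, rfl⟩ | ⟨y0, hy0, hd0, hs, rfl⟩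
  · have k1 := (h.hB y1 hy1).move (y := c) (K := 4) (by positivity) hδ.le (by norm_num) (by rw [norm_sub_rev]; nlinarith)
    have e : δ0 = (10 * a / η) * ρ := by field_simp; linarith
    rw [e] at k1
    have hT : 1 ≤ 10 * a / η := by rw [le_div_iff₀ hη]; linarith
    refine (k1.scaleT hρ.le (by positivity) hT).mono hρ.le ?_
    unfold C2
    rw [add_mul]
    have : 0 ≤ CM m n * CQ m n D Λa 8 * (5 * a) ^ m * M := by positivity
    calc CM m n * 4 ^ m * (2 * M) * (10 * a / η) ^ m = CM m n * 4 ^ m * 2 * (10 * a / η) ^ m * M := by ring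
      _ ≤ _ := by linarith
  · have k1 := compat (GLv_sfam m D h.hK) h.hA h.hΛ hM (r := 5 * a * ρ) (Q := 8) (by positivity) (by nlinarith) (by norm_num)
      (h.hcert y1 hy1) (h.hz y1 hy1) (h.hcert y0 hy0) (h.hz y0 hy0) hs (by
        have : y1 - y0 = (y1 - c) - (y0 - c) := by abel
        rw [this]
        refine (norm_sub_le _ _).trans ?_
        nlinarith)
    have k2 := k1.move (y := c) (K := 1) (by positivity) (by positivity) le_rfl (by rw [norm_sub_rev]; linarith)
    refine (k2.scaleT hρ.le (by positivity) (by linarith)).mono hρ.le ?_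
    unfold C2
    rw [add_mul, one_pow]
    have : 0 ≤ CM m n * 4 ^ m * 2 * (10 * a / η) ^ m * M := by positivity
    calc CM m n * 1 * (CQ m n D Λa 8 * M) * (5 * a) ^ m = CM m n * CQ m n D Λa 8 * (5 * a) ^ m * M := by ring
      _ ≤ _ := by linarith

def C3 (m n D : ℕ) (Λa a η : ℝ) : ℝ := CP m n * (CM m n * 4 ^ m * C2 m n D Λa a η * 4 ^ m)

/-- two active cells -/
lemma Stp.K2' (h : Stp q E0 E1 K A Λa a η M δ0 ρ0 p0 py) {c c' y : En n} {ρ ρ' : ℝ} {P P' : Jt m n D} (hρ : 0 < ρ) (hρ0 : ρ ≤ ρ0)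
    (hρ' : 0 < ρ') (hρ0' : ρ' ≤ ρ0)
    (hP : PS q E0 E1 K A Λa a M δ0 ρ0 p0 py c ρ P) (hP' : PS q E0 E1 K A Λa a M δ0 ρ0 p0 py c' ρ' P')
    (hy : ‖y - c‖ ≤ ρ) (hy' : ‖y - c'‖ ≤ 2 * ρ') (h1 : ρ ≤ 4 * ρ') (h2 : ρ' ≤ 4 * ρ) :
    DB m y ρ (C3 m n D Λa a η * M) (pl P' - pl P) := by
  have hM := h.hM
  have ha := h.ha
  have hC2 := C2_ge (m := m) (n := n) (D := D) h.hΛ ha h.hη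
  have hCM := CM_ge m n
  have hCP := CP_ge m n
  have hcc : ‖c' - c‖ ≤ ρ + 2 * ρ' := by
    have : c' - c = (y - c) - (y - c') := by abel
    rw [this]; exact (norm_sub_le _ _).trans (by linarith)
  have h44 : (1:ℝ) ≤ 4 ^ m := one_le_pow₀ (by norm_num)
  have hfin : ∀ R, R ≤ CM m n * 4 ^ m * C2 m n D Λa a η * 4 ^ m * M → 0 ≤ R → Bd c ρ R (P' - P) →
      DB m y ρ (C3 m n D Λa a η * M) (pl P' - pl P) := by
    intro R hR hR0 hB
    refine (DB.of_Bd (K := 1) hB hR0 hρ.le le_rfl (by linarith)).mono hρ.le ?_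
    unfold C3
    rw [one_pow, mul_one, mul_assoc]
    gcongr
  have hle : C2 m n D Λa a η * M ≤ CM m n * 4 ^ m * C2 m n D Λa a η * 4 ^ m * M := by
    have i1 : 1 ≤ CM m n * 4 ^ m := by nlinarith
    have i2 : C2 m n D Λa a η ≤ CM m n * 4 ^ m * C2 m n D Λa a η := by nlinarith
    have i3 : CM m n * 4 ^ m * C2 m n D Λa a η ≤ CM m n * 4 ^ m * C2 m n D Λa a η * 4 ^ m := by nlinarith
    gcongr; linarith
  have hP'0 := hP'
  rcases hP' with ⟨e1, e2⟩ | ⟨y0, hy0, hd0, hs, rfl⟩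
  · have hP0 := hP
    rcases hP with ⟨e3, e4⟩ | ⟨y0, hy0, hd0, hs, rfl⟩
    · rw [e2, e4]
      exact DB.self (contDiff_pl _ _) hρ.le (by unfold C3; positivity)
    · have k1 := h.K2 hρ' hρ0' hP'0 hy0 (by
        have : y0 - c' = (y0 - c) - (c' - c) := by abel
        rw [this]
        refine (norm_sub_le _ _).trans ?_
        have : 5 * a * ρ ≤ 5 * a * (4 * ρ') := by gcongr
        nlinarith)
      have k2 := ((k1.scale (by positivity) hρ'.le h2).move (y := c) (K := 4) (by positivity) (by positivity) (by norm_num)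
        (by rw [norm_sub_rev]; linarith)).symm
      have k3 := k2.scaleT hρ.le (by positivity) (by norm_num)
      exact hfin _ (le_of_eq (by ring)) (by positivity) k3
  · have k1 := h.K2 hρ hρ0 hP hy0 (by
        have : y0 - c = (y0 - c') + (c' - c) := by abel
        rw [this]
        refine (norm_add_le _ _).trans ?_
        have : 5 * a * ρ' ≤ 5 * a * (4 * ρ) := by gcongr
        nlinarith)
    exact hfin _ hle (by positivity) k1

end step

/-- The main inductive statement -/
def HH (m n D q : ℕ) : Prop := ∀ Λ : ℝ, 1 ≤ Λ → ∃ C c : ℝ, 1 ≤ C ∧ 0 < c ∧ c ≤ 1 ∧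
  ∀ (E0 : Finset (En n)) (K : En n → Set (Fin D → ℝ)), (∀ x ∈ E0, Convex ℝ (K x)) →
  ∀ A : Finset (Ix m n D), Mono A → PhiMax m n D < Phi A + q →
  ∀ (M δ0 : ℝ) (x0 : En n) (p0 : Jt m n D), 0 < M → 0 < δ0 → δ0 ≤ 1 →
  Cert (GLv m D E0 K) A Λ (2 * q) M x0 δ0 p0 →
  ∃ F : En n → Fin D → ℝ, ContDiff ℝ m F ∧ (∀ y, ‖y - x0‖ ≤ c * δ0 → DB m y δ0 (C * M) (F - pl p0)) ∧
    ∀ y ∈ E0, ‖y - x0‖ ≤ c * δ0 → F y ∈ K y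

end CmSel

namespace CmSel

def okp {n : ℕ} (E1 : Finset (En n)) (s : En n → ℝ → Prop) (z : En n) (r : ℝ) : Prop :=
  (∀ y ∈ E1, ∀ y' ∈ E1, ‖y - z‖ ≤ r → ‖y' - z‖ ≤ r → y = y') ∨ ∀ y ∈ E1, ‖y - z‖ ≤ r → s y r

lemma okp_mono {n : ℕ} {E1 : Finset (En n)} {s : En n → ℝ → Prop} (hs : ∀ y r r1, s y r → r1 ≤ r → s y r1)
    (z z' : En n) (r r' : ℝ) (h : okp E1 s z r) (hd : ‖z - z'‖ + r' ≤ r) : okp E1 s z' r' := by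
  have hsub : ∀ y, ‖y - z'‖ ≤ r' → ‖y - z‖ ≤ r := by
    intro y hy
    have : y - z = (y - z') - (z - z') := by abel
    rw [this]; exact (norm_sub_le _ _).trans (by linarith)
  rcases h with h | h
  · left; intro y hy y' hy' h1 h2; exact h y hy y' hy' (hsub _ h1) (hsub _ h2)
  · right; intro y hy h1
    exact hs _ _ _ (h y hy (hsub _ h1)) (by linarith [norm_nonneg (z - z')])

lemma exists_sep {n : ℕ} (E1 : Finset (En n)) : ∃ r : ℝ, 0 < r ∧ ∀ y ∈ E1, ∀ y' ∈ E1, ‖y - y'‖ ≤ 2 * r → y = y' := by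
  rcases E1.offDiag.eq_empty_or_nonempty with h | h
  · refine ⟨1, one_pos, fun y hy y' hy' _ => ?_⟩
    by_contra hne
    have : (y, y') ∈ E1.offDiag := Finset.mem_offDiag.2 ⟨hy, hy', hne⟩
    rw [h] at this; simp at this
  · obtain ⟨w, hw, hmin⟩ := Finset.exists_min_image _ (fun p : En n × En n => ‖p.1 - p.2‖) h
    have hw' := Finset.mem_offDiag.1 hw
    have hp : 0 < ‖w.1 - w.2‖ := norm_pos_iff.2 (sub_ne_zero.2 hw'.2.2)
    refine ⟨‖w.1 - w.2‖ / 3, by positivity, fun y hy y' hy' hd => ?_⟩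
    by_contra hne
    have := hmin (y, y') (Finset.mem_offDiag.2 ⟨hy, hy', hne⟩)
    simp only at this
    linarith

lemma okp_small {n : ℕ} (E1 : Finset (En n)) (s : En n → ℝ → Prop) : ∃ r : ℝ, 0 < r ∧ ∀ z, okp E1 s z r := by
  obtain ⟨r, hr, h⟩ := exists_sep E1
  refine ⟨r, hr, fun z => Or.inl fun y hy y' hy' h1 h2 => h y hy y' hy' ?_⟩
  have : y - y' = (y - z) - (y' - z) := by abel
  rw [this]; exact (norm_sub_le _ _).trans (by linarith)

section step
variable {m n D q : ℕ} {E0 E1 : Finset (En n)} {K : En n → Set (Fin D → ℝ)} {A : Finset (Ix m n D)}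
    {Λa a η M δ0 ρ0 : ℝ} {p0 : Jt m n D} {py : En n → Jt m n D}

lemma GLv_val (hm : 1 ≤ m) {l : ℕ} {x : En n} {M : ℝ} {p : Jt m n D} (hp : p ∈ GLv m D E0 K l x M) (hx : x ∈ E0) :
    pl p x ∈ K x :=
  Gam.val hm (Nat.one_le_pow _ _ (by omega)) hp hx

lemma PS.exists {c : En n} {ρ : ℝ}
    (h : ρ = ρ0 ∨ ¬ okp E1 (sok m D q E0 K A Λa M δ0 p0) c (5 * a * ρ)) :
    ∃ P, PS q E0 E1 K A Λa a M δ0 ρ0 p0 py c ρ P := by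
  rcases h with h | h
  · exact ⟨p0, Or.inl ⟨h, rfl⟩⟩
  · unfold okp at h
    push Not at h
    obtain ⟨-, y0, hy0, hd, hs⟩ := h
    exact ⟨py y0, Or.inr ⟨y0, hy0, hd, hs, rfl⟩⟩

def C1 (m n D : ℕ) (Λa a η Cs CH : ℝ) : ℝ := CH * Cs * a ^ m + CP m n * 4 * a ^ m + CP m n * 2 ^ m * C2 m n D Λa a η

lemma Stp.cell (h : Stp q E0 E1 K A Λa a η M δ0 ρ0 p0 py) {Λs Cs CH cH : ℝ}
    (hCs : 1 ≤ Cs)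
    (hstr : ∀ A l M x δ p, 0 < M → 0 < δ → δ ≤ 1 →
      Cert (GLv m D E0 K) A (LS2 (NN m n D) (3 * LS2 (NN m n D) Λa)) l M x δ p → ∃ B, Mono B ∧ Phi A ≤ Phi B ∧
      Cert (GLv m D E0 K) B Λs l (Cs * M) x δ p)
    (hCH : 1 ≤ CH) (hcH : 16 ≤ cH * a)
    (hH : ∀ A : Finset (Ix m n D), Mono A → PhiMax m n D < Phi A + q →
      ∀ (M δ0 : ℝ) (x0 : En n) (p0 : Jt m n D), 0 < M → 0 < δ0 → δ0 ≤ 1 →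
      Cert (GLv m D E0 K) A Λs (2 * q) M x0 δ0 p0 →
      ∃ F : En n → Fin D → ℝ, ContDiff ℝ m F ∧ (∀ y, ‖y - x0‖ ≤ cH * δ0 → DB m y δ0 (CH * M) (F - pl p0)) ∧
        ∀ y ∈ E0, ‖y - x0‖ ≤ cH * δ0 → F y ∈ K y)
    {c : En n} {ρ : ℝ} {P : Jt m n D} (hρ : 0 < ρ) (hρ' : ρ ≤ ρ0)
    (hP : PS q E0 E1 K A Λa a M δ0 ρ0 p0 py c ρ P) (hok : okp E1 (sok m D q E0 K A Λa M δ0 p0) c (a * ρ)) :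
    ∃ G : En n → Fin D → ℝ, ContDiff ℝ m G ∧ (∀ y, ‖y - c‖ ≤ 2 * ρ → DB m y ρ (C1 m n D Λa a η Cs CH * M) (G - pl P)) ∧
      ∀ y ∈ E1, ‖y - c‖ ≤ 2 * ρ → G y ∈ K y := by
  have hM := h.hM
  have ha := h.ha
  have hη1 := h.hη1
  have hη := h.hη
  have hδ := h.hδ
  have hδ1 := h.hδ1
  have hρ0 := h.hρ0
  have hC2 := C2_ge (m := m) (n := n) (D := D) h.hΛ ha h.hη
  have hCP := CP_ge m n
  have haρ : a * ρ ≤ a * ρ0 := by gcongr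
  have haρ1 : a * ρ ≤ 1 := by nlinarith
  have t1 : 0 ≤ CH * Cs * a ^ m := by positivity
  have t2 : 0 ≤ CP m n * 4 * a ^ m := by positivity
  have t3 : 0 ≤ CP m n * 2 ^ m * C2 m n D Λa a η := by positivity
  have hC1 : C1 m n D Λa a η Cs CH * M = CH * Cs * a ^ m * M + CP m n * 4 * a ^ m * M + CP m n * 2 ^ m * C2 m n D Λa a η * M := by
    unfold C1; ring
  have s1 := mul_nonneg t1 hM.le
  have s2 := mul_nonneg t2 hM.le
  have s3 := mul_nonneg t3 hM.le
  by_cases hex : ∃ y1 ∈ E1, ‖y1 - c‖ ≤ 2 * ρ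
  swap
  · push Not at hex
    refine ⟨pl P, contDiff_pl _ _, fun y _ => DB.self (contDiff_pl _ _) hρ.le (by rw [hC1]; linarith), ?_⟩
    intro y hy hd
    exact absurd hd (not_le.2 (hex y hy))
  obtain ⟨y1, hy1, hd1⟩ := hex
  have h2a : 2 * ρ ≤ a * ρ := by nlinarith
  have k1 := h.K2 hρ hρ' hP hy1 (by nlinarith)
  have k2 : ∀ y, ‖y - c‖ ≤ 2 * ρ → DB m y ρ (CP m n * 2 ^ m * C2 m n D Λa a η * M) (pl (py y1) - pl P) := by
    intro y hy
    exact (DB.of_Bd (K := 2) k1 (by positivity) hρ.le (by norm_num) hy).mono hρ.le (le_of_eq (by ring))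
  rcases hok with hok | hok
  · refine ⟨pl (py y1), contDiff_pl _ _, fun y hy => (k2 y hy).mono hρ.le (by rw [hC1]; linarith), ?_⟩
    intro y hy hd
    have : y = y1 := hok y hy y1 hy1 (by linarith) (by linarith)
    rw [this]
    exact GLv_val h.hm (h.hcert y1 hy1).1 (h.hE hy1)
  · have hs := hok y1 hy1 (by linarith)
    have haρp : 0 < a * ρ := by positivity
    obtain ⟨p, A', hA', hcA, hBp⟩ := weakOK (GLv_sfam m D h.hK) h.hΛ hM haρp (h.hcert y1 hy1) (h.hz y1 hy1) hs
    obtain ⟨B, hBm, hBP, hBc⟩ := hstr A' _ M y1 (a * ρ) p hM haρp haρ1 hcA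
    have hPhi := h.hPhi
    obtain ⟨F, hF, hF1, hF2⟩ := hH B hBm (by omega) (Cs * M) (a * ρ) y1 p (by positivity) haρp haρ1 hBc
    have hyy : ∀ y, ‖y - c‖ ≤ 2 * ρ → ‖y - y1‖ ≤ 4 * ρ := by
      intro y hy
      have : y - y1 = (y - c) - (y1 - c) := by abel
      rw [this]; exact (norm_sub_le _ _).trans (by linarith)
    have h16 : 16 * ρ ≤ cH * (a * ρ) := by rw [← mul_assoc]; gcongr
    refine ⟨F, hF, ?_, ?_⟩
    · intro y hy
      have i1 := (hF1 y ((hyy y hy).trans (by linarith))).scaleT hρ.le (by positivity) (by linarith)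
      have i2 := (DB.of_Bd (y := y) (K := 1) hBp (by positivity) haρp.le le_rfl ((hyy y hy).trans (by nlinarith))).scaleT hρ.le
        (by positivity) (by linarith)
      refine ((i1.tri i2).tri (k2 y hy)).mono hρ.le ?_
      rw [hC1, one_pow]
      apply le_of_eq; ring
    · intro y hy hd
      exact hF2 y (h.hE hy) ((hyy y hd).trans (by linarith))

end step

set_option maxHeartbeats 1000000 in
lemma HH_step {m n D q : ℕ} (hm : 1 ≤ m) (hn : 1 ≤ n) (hq : HH m n D q) : HH m n D (q+1) := by
  intro Λ hΛ
  obtain ⟨Cg, hCg, hgrid⟩ := grid_glue m n D hn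
  have hCM := CM_ge m n
  set Λa := LS1 (NN m n D) Λ with hΛa
  have hΛa1 : 1 ≤ Λa := by
    rw [hΛa]; unfold LS1
    have : (0:ℝ) ≤ NN m n D := by positivity
    nlinarith
  set η : ℝ := 1 / (4 * (NN m n D + 1) * CM m n * Λ) with hη
  have hden : 1 ≤ 4 * ((NN m n D : ℝ) + 1) * CM m n * Λ := by
    have i1 : (1:ℝ) ≤ 4 * ((NN m n D : ℝ) + 1) := by
      have : (0:ℝ) ≤ NN m n D := by positivity
      linarith
    have i2 : (1:ℝ) ≤ 4 * ((NN m n D : ℝ) + 1) * CM m n := by nlinarith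
    nlinarith
  have hη0 : 0 < η := by rw [hη]; positivity
  have hη1 : η ≤ 1 := by rw [hη, div_le_one (by linarith)]; exact hden
  have hη2 : η * (4 * (NN m n D + 1) * CM m n * Λ) ≤ 1 := by
    rw [hη]; apply le_of_eq; field_simp
  set Λc := LS2 (NN m n D) (3 * LS2 (NN m n D) Λa) with hΛc
  have hΛb1 := LS2_ge (N := NN m n D) hΛa1
  have hΛc1 : 1 ≤ Λc := by
    have := LS2_ge (N := NN m n D) (show 1 ≤ 3 * LS2 (NN m n D) Λa by linarith)
    rw [hΛc]; linarith
  obtain ⟨Λs, Cs, hΛs, hCs, hstr⟩ := strongify m n D (PhiMax m n D) Λc hΛc1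
  obtain ⟨CH, cH, hCH, hcH, hcH1, hH⟩ := hq Λs hΛs
  set a : ℝ := 16 / cH with ha
  have ha16 : 16 ≤ a := by rw [ha, le_div_iff₀ hcH]; nlinarith
  have hca : 16 ≤ cH * a := by rw [ha]; apply le_of_eq; field_simp
  set c1 := C1 m n D Λa a η Cs CH with hc1
  set c3 := C3 m n D Λa a η with hc3
  have hCP := CP_ge m n
  have hC2 := C2_ge (m := m) (n := n) (D := D) hΛa1 ha16 hη0
  have hc1p : 0 ≤ c1 := by rw [hc1]; unfold C1; positivity
  have hc3p : 0 ≤ c3 := by rw [hc3]; unfold C3; positivity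
  refine ⟨Cg * (c1 * 4 ^ m + c3 + c1) + c1 + CP m n * 2, η / 2, ?_, by positivity, by linarith, ?_⟩
  · have : 0 ≤ Cg * (c1 * 4 ^ m + c3 + c1) := by positivity
    linarith
  intro E0 K hK A hA hPhi M δ0 x0 p0 hM hδ hδ1 hcert
  have hΓ := GLv_sfam m D hK
  have hmv : ∀ y, ∃ q', ‖x0 - y‖ ≤ η * δ0 → Cert (GLv m D E0 K) A Λa (2*q+1) M y δ0 q' ∧ (∀ b ∈ A, co y (q' - p0) b = 0) ∧
      Bd y δ0 (2 * M) (q' - p0) := by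
    intro y
    by_cases hy : ‖x0 - y‖ ≤ η * δ0
    · obtain ⟨q', hq'⟩ := Cert.move hΓ (l := 2*q+1) hcert hΛ hM hδ hη0 hη1 hη2 hy
      exact ⟨q', fun _ => hq'⟩
    · exact ⟨0, fun h => absurd h hy⟩
  choose py hpy using hmv
  set E1 := E0.filter (fun y => ‖x0 - y‖ ≤ η * δ0) with hE1
  set ρ0 := η * δ0 / (10 * a) with hρ0
  have hap : 0 < a := by linarith
  have hρzp : 0 < ρ0 := by rw [hρ0]; positivity
  have hρze : 10 * a * ρ0 = η * δ0 := by rw [hρ0]; field_simp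
  have hst : Stp q E0 E1 K A Λa a η M δ0 ρ0 p0 py :=
    { hm := hm, hK := hK, hA := hA, hPhi := by omega, hΛ := hΛa1, hM := hM, hδ := hδ, hδ1 := hδ1, ha := ha16, hη := hη0,
      hη1 := hη1, hρ0 := hρze, hE := Finset.filter_subset _ _
      hcert := fun y hy => (hpy y (Finset.mem_filter.1 hy).2).1
      hz := fun y hy => (hpy y (Finset.mem_filter.1 hy).2).2.1
      hB := fun y hy => (hpy y (Finset.mem_filter.1 hy).2).2.2 }
  set OK := okp E1 (sok m D q E0 K A Λa M δ0 p0) with hOKd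
  have hOKm : ∀ z z' r r', OK z r → ‖z - z'‖ + r' ≤ r → OK z' r' :=
    okp_mono (fun y r r1 h hr => SOK.anti h hr)
  obtain ⟨rmin, hrmin, hOKs⟩ := okp_small E1 (sok m D q E0 K A Λa M δ0 p0)
  have hcell : ∀ c ρ, ∃ G : En n → Fin D → ℝ, ContDiff ℝ m G ∧ (Cell OK a ρ0 c ρ → ∃ P, PS q E0 E1 K A Λa a M δ0 ρ0 p0 py c ρ P ∧
      (∀ y, ‖y - c‖ ≤ 2 * ρ → DB m y ρ (c1 * M) (G - pl P)) ∧
      ∀ y ∈ E1, ‖y - c‖ ≤ 2 * ρ → G y ∈ K y) := by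
    intro c ρ
    by_cases hc : Cell OK a ρ0 c ρ
    · obtain ⟨P, hP⟩ := PS.exists (py := py) hc.2.2.2
      obtain ⟨G, g1, g2, g3⟩ := hst.cell hCs (fun A l M x δ p => hstr _ hΓ A l M x δ p (by omega)) hCH hca (hH E0 K hK) hc.1 hc.2.1 hP hc.2.2.1
      exact ⟨G, g1, fun _ => ⟨P, hP, g2, g3⟩⟩
    · exact ⟨0, contDiff_const, fun h => absurd h hc⟩
  choose G hG1 hG2 using hcell
  obtain ⟨F, hF, hFy⟩ := hgrid OK hOKm a ρ0 rmin (‖x0‖ + δ0) ha16 hρzp hrmin hOKs G hG1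
  have hηδ : η * δ0 ≤ δ0 := by nlinarith
  have hy0 : ∀ y, ‖y - x0‖ ≤ η / 2 * δ0 → ‖y‖ ≤ ‖x0‖ + δ0 := by
    intro y hy
    have e : y = (y - x0) + x0 := by abel
    rw [e]; refine (norm_add_le _ _).trans ?_
    nlinarith
  refine ⟨F, hF, ?_, ?_⟩
  · intro y hy
    obtain ⟨⟨c, ρ, hc, hyc, hb⟩, -⟩ := hFy y (hy0 y hy)
    obtain ⟨P, hP, hP1, -⟩ := hG2 c ρ hc
    have hρ := hc.1
    have hρρ0 := hc.2.1
    have haρ : a * ρ ≤ a * ρ0 := by gcongr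
    have hρδ : ρ ≤ δ0 := by nlinarith
    have d1 := hP1 y (by linarith)
    have d2 : DB m y ρ (Cg * ((c1 * 4 ^ m + c3 + c1) * M)) (F - G c ρ) := by
      refine ⟨hF.sub (hG1 c ρ), hb ((c1 * 4 ^ m + c3 + c1) * M) (by positivity) ?_⟩
      intro c' ρ' hc' hyc' i1 i2
      obtain ⟨P', hP', hP1', -⟩ := hG2 c' ρ' hc'
      have e1 := ((hP1' y hyc').scale hc'.1.le (by positivity) i2).scaleT hρ.le (by positivity) (by norm_num)
      have e2 := hst.K2' hρ hρρ0 hc'.1 hc'.2.1 hP hP' hyc.le hyc' i1 i2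
      have e3 := ((e1.tri e2).tri d1.symm)
      exact (e3.mono hρ.le (le_of_eq (by rw [hc3]; ring))).2
    have d3 : DB m y δ0 (CP m n * 2 * M) (pl P - pl p0) := by
      rcases hP with ⟨e1, e2⟩ | ⟨y0, hy0, hd0, hs, rfl⟩
      · rw [e2]; exact DB.self (contDiff_pl _ _) hδ.le (by positivity)
      · refine (DB.of_Bd (y := y) (K := 1) (hst.hB y0 hy0) (by positivity) hδ.le le_rfl ?_).mono hδ.le (le_of_eq (by ring))
        have e : y - y0 = (y - c) - (y0 - c) := by abel
        rw [e]; refine (norm_sub_le _ _).trans ?_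
        nlinarith
    have d4 := ((d2.tri d1).scale hρ.le (by positivity) hρδ).tri d3
    exact d4.mono hδ.le (le_of_eq (by ring))
  · intro y hyE hy
    obtain ⟨-, hv⟩ := hFy y (hy0 y hy)
    apply hv (K y) (hK y hyE)
    intro c' ρ' hc' hyc'
    obtain ⟨P', hP', -, hv'⟩ := hG2 c' ρ' hc'
    apply hv' y _ hyc'
    rw [hE1, Finset.mem_filter]
    refine ⟨hyE, ?_⟩
    rw [norm_sub_rev]; nlinarith

lemma HH_all {m n D : ℕ} (hm : 1 ≤ m) (hn : 1 ≤ n) (q : ℕ) : HH m n D q := by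
  induction q with
  | zero =>
    intro Λ hΛ
    refine ⟨1, 1, le_rfl, one_pos, le_rfl, ?_⟩
    intro E0 K hK A hA hPhi
    have := Phi_le A
    omega
  | succ q ih => exact HH_step hm hn ih

end CmSel

namespace CmSel

lemma fp_local {m n : ℕ} (D : ℕ) (hm : 1 ≤ m) (hn : 1 ≤ n) :
    ∃ k0 : ℕ, ∃ C c : ℝ, 1 ≤ C ∧ 0 < c ∧ c ≤ 1 ∧
      ∀ (E : Finset (En n)) (K : En n → Set (Fin D → ℝ)), (∀ x ∈ E, Convex ℝ (K x)) →
        (∀ S ⊆ E, S.card ≤ k0 → ∃ F, NB m F 1 ∧ ∀ x ∈ S, F x ∈ K x) →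
        ∀ x, ∃ F : En n → Fin D → ℝ, ContDiff ℝ m F ∧ (∀ y, ‖y - x‖ ≤ c → DB m y 1 C F) ∧
          ∀ y ∈ E, ‖y - x‖ ≤ c → F y ∈ K y := by
  obtain ⟨C, c, hC, hc, hc1, H⟩ := HH_all (m := m) (n := n) (D := D) hm hn (PhiMax m n D + 1) 1 le_rfl
  set kk := (Fintype.card (Ix m n D) + 1) ^ (2 * (PhiMax m n D + 1)) with hkk
  refine ⟨(Fintype.card (Ix m n D) + 1) * kk, C + 2, c, by linarith, hc, hc1, ?_⟩
  intro E K hK hS x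
  have key := helly_jets (E0 := E) kk
    (fun S => {q : Jt m n D | ∃ F : En n → Fin D → ℝ, NB m F 1 ∧ Jet F x q ∧ ∀ z ∈ S, F z ∈ K z}) ?_ ?_ ?_
  · obtain ⟨p, hp⟩ := key
    have hpG : p ∈ GLv m D E K (2 * (PhiMax m n D + 1)) x 1 := fun S hS hc => hp S hS hc
    obtain ⟨F, h1, h2, h3⟩ := H E K hK ∅ (by intro a ha; simp at ha) (by omega) 1 1 x p one_pos one_pos le_rfl
      ⟨hpG, 0, by simp, by simp, by simp⟩
    obtain ⟨G, g1, g2, -⟩ := hp ∅ (by simp) (by simp)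
    simp only [mul_one] at h2 h3
    refine ⟨F, h1, fun y hy => ?_, h3⟩
    have e : F = (F - pl p) + ((pl p - G) + G) := by abel
    have d1 : DB m y 1 1 (G - pl p) := by
      refine ⟨g1.1.sub (contDiff_pl _ _), fun k hk => (g2.taylor g1 hk y).trans ?_⟩
      have : ‖y - x‖ ^ (m - k) ≤ 1 := pow_le_one₀ (norm_nonneg _) (hy.trans hc1)
      simpa using this
    have d2 : DB m y 1 1 G := ⟨g1.1, fun k hk => by simpa using g1.2 k hk y⟩
    rw [e]
    exact ((h2 y hy).add (d1.symm.add d2)).mono zero_le_one (by linarith)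
  · rintro S hS q ⟨F, h1, h3, h4⟩ q' ⟨G, g1, g3, g4⟩ a b ha hb hab
    refine ⟨a • F + b • G, h1.convex g1 ha hb hab, ?_, ?_⟩
    · exact (h3.smul h1.1 a).add (g3.smul g1.1 b) (h1.1.const_smul a) (g1.1.const_smul b)
    · intro y hy
      exact hK y (hS hy) (h4 y hy) (g4 y hy) ha hb hab
  · rintro S T hST hT q ⟨F, h1, h3, h4⟩
    exact ⟨F, h1, h3, fun z hz => h4 z (hST hz)⟩
  · intro S hS' hc
    obtain ⟨F, h1, h3⟩ := hS S hS' hc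
    obtain ⟨q, hq⟩ := Jet.exists h1.1 x
    exact ⟨q, F, h1, hq, h3⟩

theorem fp_big {m n : ℕ} (D : ℕ) (hm : 1 ≤ m) (hn : 1 ≤ n) :
    ∃ k0 : ℕ, ∃ C : ℝ, 1 ≤ C ∧
      ∀ (E : Finset (En n)) (K : En n → Set (Fin D → ℝ)), (∀ x ∈ E, Convex ℝ (K x)) →
        (∀ S ⊆ E, S.card ≤ k0 → ∃ F, NB m F 1 ∧ ∀ x ∈ S, F x ∈ K x) →
        ∃ F, NB m F C ∧ ∀ x ∈ E, F x ∈ K x := by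
  obtain ⟨k0, C, c, hC, hc, hc1, H⟩ := fp_local (m := m) (n := n) D hm hn
  obtain ⟨CG, hCG, HG⟩ := grid_glue m n D hn
  set ρ0 := c / 2 with hρ0
  have hρ : 0 < ρ0 := by positivity
  have hBB := BB_ge m n
  set C2 := CG * (2 * C * (1 / ρ0) ^ m) + C with hC2
  have hC2p : 0 ≤ C2 := by positivity
  refine ⟨k0, max 1 (2 ^ m * BB m n * C2), le_max_left _ _, ?_⟩
  intro E K hK hS
  choose G g1 g2 g3 using H E K hK hS
  obtain ⟨R1, hR1, hER⟩ : ∃ R1 : ℝ, 1 ≤ R1 ∧ ∀ x ∈ E, ‖x‖ ≤ R1 := by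
    refine ⟨1 + ∑ x ∈ E, ‖x‖, ?_, fun x hx => ?_⟩
    · have : 0 ≤ ∑ x ∈ E, ‖x‖ := Finset.sum_nonneg (fun _ _ => norm_nonneg _)
      linarith
    · have := Finset.single_le_sum (f := fun x : En n => ‖x‖) (fun _ _ => norm_nonneg _) hx
      linarith
  obtain ⟨F, cF, hF⟩ := HG (fun _ _ => True) (fun _ _ _ _ _ _ => trivial) 16 ρ0 1 (2 * R1) le_rfl hρ one_pos
    (fun _ => trivial) (fun c _ => G c) (fun c _ => g1 c)
  have cell : ∀ c' ρ', Cell (fun (_ : En n) (_ : ℝ) => True) 16 ρ0 c' ρ' → ρ' = ρ0 := by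
    rintro c' ρ' ⟨-, -, -, h⟩
    simpa using h
  have hFb : ∀ y, ‖y‖ ≤ 2 * R1 → DB m y 1 C2 F := by
    intro y hy
    obtain ⟨⟨z, ρ, hz, hyz, h⟩, -⟩ := hF y hy
    have hρz := cell _ _ hz
    subst hρz
    have dz : DB m y 1 C (G z) := g2 z y (by linarith)
    have h' := h (2 * C * (1 / ρ0) ^ m) (by positivity) (fun c' ρ' hc' hy' _ _ => by
      have := cell _ _ hc'
      subst this
      have d' : DB m y 1 C (G c') := g2 c' y (by linarith)
      have d3 : DB m y 1 (C + C) (G c' - G z) := by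
        have h0 : ∀ {W : En n → Fin D → ℝ}, DB m y 1 C W → DB m y 1 C (W - 0) := by simp
        exact (h0 d').tri (h0 dz).symm
      have e1 : (1 : ℝ) = 1 / ρ0 * ρ0 := by field_simp
      rw [e1] at d3
      have := (d3.scaleT hρ.le (by positivity) (by rw [le_div_iff₀ hρ]; linarith)).2
      intro k hk
      have := this k hk
      rwa [← two_mul] at this)
    have d4 : DB m y ρ0 (CG * (2 * C * (1 / ρ0) ^ m)) (F - G z) := ⟨cF.sub (g1 z), h'⟩
    have := (d4.scale hρ.le (by positivity) (show ρ0 ≤ 1 by linarith)).add dz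
    rwa [sub_add_cancel] at this
  refine ⟨fun y => bump 0 R1 y • F y, ⟨(bump_contDiff _ _ _).smul cF, fun k hk y => ?_⟩, fun x hx => ?_⟩
  · rcases le_or_gt ‖y‖ (2 * R1) with hy | hy
    · have := leib (m := m) (δ := 1) (B := BB m n) (R := C2) (bump_contDiff 0 R1 m) cF one_pos (fun k hk => by
        refine (bump_bound 0 (by linarith) hk y).trans ?_
        have : 1 ≤ R1 ^ k := one_le_pow₀ hR1
        simpa using div_le_self (by linarith) this) (hFb y hy).2 k hk
      refine this.trans ?_
      simp
    · have ev : (fun y => bump 0 R1 y • F y) =ᶠ[nhds y] fun _ => 0 := by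
        filter_upwards [continuous_norm.continuousAt.eventually_const_lt hy] with z hz
        rw [bump_zero (by linarith) (by simpa using hz.le), zero_smul]
      rw [(ev.iteratedFDeriv ℝ k).eq_of_nhds]
      have hz : ‖iteratedFDeriv ℝ k (fun _ : En n => (0 : Fin D → ℝ)) y‖ = 0 := by simp
      rw [hz]
      exact zero_le_one.trans (le_max_left _ _)
  · have hxR := hER x hx
    simp only
    rw [bump_one (by linarith) (by simpa using hxR), one_smul]
    obtain ⟨-, h⟩ := hF x (by linarith)
    refine h _ (hK x hx) (fun c' ρ' hc' h' => ?_)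
    have := cell _ _ hc'
    subst this
    exact g3 c' x hx (by linarith)

end CmSel

namespace CmSel

section greedy
variable {ι W : Type*} [AddCommGroup W] [Module ℝ W]

/-- distance of `v` to the span of the family `μ` over `J`, measured by `q` -/
def dJ (q : Seminorm ℝ W) (μ : ι → W) (J : Finset ι) (v : W) : ℝ := ⨅ c : ι → ℝ, q (v + ∑ j ∈ J, c j • μ j)

lemma dJ_bdd (q : Seminorm ℝ W) (μ : ι → W) (J : Finset ι) (v : W) :
    BddBelow (Set.range (fun c : ι → ℝ => q (v + ∑ j ∈ J, c j • μ j))) :=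
  ⟨0, by rintro _ ⟨c, rfl⟩; exact apply_nonneg q _⟩
lemma dJ_le (q : Seminorm ℝ W) (μ : ι → W) (J : Finset ι) (v : W) (c : ι → ℝ) :
    dJ q μ J v ≤ q (v + ∑ j ∈ J, c j • μ j) := ciInf_le (dJ_bdd q μ J v) c
lemma dJ_nonneg (q : Seminorm ℝ W) (μ : ι → W) (J : Finset ι) (v : W) : 0 ≤ dJ q μ J v :=
  le_ciInf (fun _ => apply_nonneg q _)
lemma dJ_ex {q : Seminorm ℝ W} {μ : ι → W} {J : Finset ι} {v : W} {r : ℝ} (h : dJ q μ J v < r) :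
    ∃ c : ι → ℝ, q (v + ∑ j ∈ J, c j • μ j) < r := exists_lt_of_ciInf_lt h
lemma dJ_add (q : Seminorm ℝ W) (μ : ι → W) (J : Finset ι) (v w : W) :
    dJ q μ J (v + w) ≤ dJ q μ J v + dJ q μ J w := by
  refine le_of_forall_pos_le_add fun ε hε => ?_
  obtain ⟨c, hc⟩ := dJ_ex (show dJ q μ J v < dJ q μ J v + ε / 2 by linarith)
  obtain ⟨d, hd⟩ := dJ_ex (show dJ q μ J w < dJ q μ J w + ε / 2 by linarith)
  have := dJ_le q μ J (v + w) (fun j => c j + d j)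
  have e : v + w + ∑ j ∈ J, (c j + d j) • μ j = (v + ∑ j ∈ J, c j • μ j) + (w + ∑ j ∈ J, d j • μ j) := by
    simp only [add_smul, Finset.sum_add_distrib]; abel
  rw [e] at this
  have h3 := map_add_le_add q (v + ∑ j ∈ J, c j • μ j) (w + ∑ j ∈ J, d j • μ j)
  linarith
lemma dJ_smul (q : Seminorm ℝ W) (μ : ι → W) (J : Finset ι) (a : ℝ) (v : W) :
    dJ q μ J (a • v) ≤ |a| * dJ q μ J v := by
  refine le_of_forall_pos_le_add fun ε hε => ?_
  have hp : 0 < |a| + 1 := by positivity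
  obtain ⟨c, hc⟩ := dJ_ex (show dJ q μ J v < dJ q μ J v + ε / (|a| + 1) by
    have : 0 < ε / (|a| + 1) := by positivity
    linarith)
  have := dJ_le q μ J (a • v) (fun j => a * c j)
  have e : a • v + ∑ j ∈ J, (a * c j) • μ j = a • (v + ∑ j ∈ J, c j • μ j) := by
    simp only [mul_smul, smul_add, Finset.smul_sum]
  rw [e, map_smul_eq_mul, Real.norm_eq_abs] at this
  have h3 : |a| * (ε / (|a| + 1)) ≤ ε := by
    rw [mul_div_assoc', div_le_iff₀ hp]; nlinarith [abs_nonneg a]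
  have h4 := mul_le_mul_of_nonneg_left hc.le (abs_nonneg a)
  linarith
lemma dJ_sum (q : Seminorm ℝ W) (μ : ι → W) (J R : Finset ι) (c : ι → ℝ) {B D0 : ℝ} (hB : 0 ≤ B)
    (h1 : ∀ j ∈ R, |c j| ≤ B) (h2 : ∀ j ∈ R, dJ q μ J (μ j) ≤ D0) :
    dJ q μ J (∑ j ∈ R, c j • μ j) ≤ R.card * (B * D0) := by
  induction R using Finset.induction_on with
  | empty =>
    have := dJ_le q μ J 0 0
    simpa using this
  | insert a R ha ih =>
    rw [Finset.sum_insert ha, Finset.card_insert_of_notMem ha]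
    refine (dJ_add _ _ _ _ _).trans ?_
    have i1 := ih (fun j hj => h1 j (Finset.mem_insert_of_mem hj)) (fun j hj => h2 j (Finset.mem_insert_of_mem hj))
    have i2 := dJ_smul q μ J (c a) (μ a)
    have i3 : |c a| * dJ q μ J (μ a) ≤ B * D0 :=
      mul_le_mul (h1 a (by simp)) (h2 a (by simp)) (dJ_nonneg _ _ _ _) hB
    push_cast
    linarith
lemma dJ_key (q : Seminorm ℝ W) (μ : ι → W) (J : Finset ι) (a : ℝ) (u w : W) (c : ι → ℝ) :
    |a| * dJ q μ J u ≤ q (a • u + w + ∑ j ∈ J, c j • μ j) + dJ q μ J w := by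
  rcases eq_or_ne a 0 with rfl | ha
  · have h1 := dJ_nonneg q μ J w
    have h2 := apply_nonneg q ((0 : ℝ) • u + w + ∑ j ∈ J, c j • μ j)
    simp only [abs_zero, zero_mul]; linarith
  have h1 := dJ_smul q μ J a⁻¹ (a • u)
  rw [smul_smul, inv_mul_cancel₀ ha, one_smul, abs_inv] at h1
  have h2 : |a| * dJ q μ J u ≤ dJ q μ J (a • u) := by
    have := mul_le_mul_of_nonneg_left h1 (abs_nonneg a)
    rwa [← mul_assoc, mul_inv_cancel₀ (abs_ne_zero.2 ha), one_mul] at this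
  have h3 := dJ_add q μ J (a • u + w) ((-1 : ℝ) • w)
  have e : a • u + w + (-1 : ℝ) • w = a • u := by simp
  rw [e] at h3
  have h4 := dJ_smul q μ J (-1) w
  have h5 := dJ_le q μ J (a • u + w) c
  simp only [abs_neg, abs_one, one_mul] at h4
  linarith

lemma greedy (ι W : Type*) [AddCommGroup W] [Module ℝ W] (s : ℕ) : ∃ C : ℝ, 1 ≤ C ∧
    ∀ (q : Seminorm ℝ W) (μ : ι → W) (J Y : Finset ι), Disjoint J Y →
    Y.card ≤ s → ∃ R ⊆ Y, (∀ c : ι → ℝ, ∀ j ∈ R, |c j| ≤ C * q (∑ j ∈ J ∪ R, c j • μ j)) ∧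
      ∀ y ∈ Y \ R, ∃ c : ι → ℝ, (∀ j ∈ R, |c j| ≤ C) ∧ q (μ y + ∑ j ∈ J ∪ R, c j • μ j) ≤ C := by
  induction s with
  | zero =>
    refine ⟨1, le_rfl, fun q μ J Y _ hY => ⟨∅, by simp, by simp, ?_⟩⟩
    have : Y = ∅ := by simpa using hY
    subst this; simp
  | succ s ih =>
    obtain ⟨C, hC, H⟩ := ih
    refine ⟨2 * (1 + C + s * C) + 2, by nlinarith [show (0 : ℝ) ≤ s * C by positivity], ?_⟩
    have hsC : (0 : ℝ) ≤ s * C := by positivity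
    set C' := 2 * (1 + C + s * C) + 2 with hC'
    intro q μ J Y hd hY
    by_cases hall : ∀ y ∈ Y, dJ q μ J (μ y) ≤ 1
    · refine ⟨∅, by simp, by simp, fun y hy => ?_⟩
      simp only [Finset.sdiff_empty] at hy
      obtain ⟨c, hc⟩ := dJ_ex (show dJ q μ J (μ y) < 2 by linarith [hall y hy])
      refine ⟨c, by simp, ?_⟩
      simp only [Finset.union_empty]
      linarith
    push Not at hall
    obtain ⟨y1, hy1, hy1'⟩ := hall
    obtain ⟨y0, hy0, hmax⟩ := Finset.exists_max_image Y (fun y => dJ q μ J (μ y)) ⟨y1, hy1⟩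
    set D0 := dJ q μ J (μ y0) with hD0
    have hD01 : 1 < D0 := hy1'.trans_le (hmax y1 hy1)
    have hy0J : y0 ∉ J := fun h => Finset.disjoint_left.1 hd h hy0
    obtain ⟨R, hR, h2, h1⟩ := H q μ (insert y0 J) (Y.erase y0) (by
      rw [Finset.disjoint_insert_left]
      exact ⟨by simp, hd.mono_right (Finset.erase_subset _ _)⟩) (by
      rw [Finset.card_erase_of_mem hy0]; omega)
    have hRY : R ⊆ Y := hR.trans (Finset.erase_subset _ _)
    have hy0R : y0 ∉ R := fun h => by simpa using hR h
    have hJR : Disjoint J R := hd.mono_right hRY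
    have hun : J ∪ insert y0 R = insert y0 J ∪ R := by ext; simp
    have hRc : (R.card : ℝ) ≤ s := by
      have := Finset.card_le_card hR
      rw [Finset.card_erase_of_mem hy0] at this
      have : R.card ≤ s := by omega
      exact_mod_cast this
    have hsplit : ∀ c : ι → ℝ, ∑ j ∈ insert y0 J ∪ R, c j • μ j =
        c y0 • μ y0 + ∑ j ∈ R, c j • μ j + ∑ j ∈ J, c j • μ j := by
      intro c
      rw [Finset.sum_union (by rw [Finset.disjoint_insert_left]; exact ⟨hy0R, hJR⟩), Finset.sum_insert hy0J]
      abel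
    refine ⟨insert y0 R, Finset.insert_subset hy0 hRY, ?_, ?_⟩
    · intro c j hj
      rw [hun]
      set Q := q (∑ j ∈ insert y0 J ∪ R, c j • μ j) with hQ
      have hQ0 : 0 ≤ Q := apply_nonneg q _
      rcases Finset.mem_insert.1 hj with rfl | hj
      · have k1 := dJ_key q μ J (c j) (μ j) (∑ j ∈ R, c j • μ j) c
        rw [← hsplit c, ← hQ, ← hD0] at k1
        have k2 := dJ_sum q μ J R c (B := C * Q) (D0 := D0) (by positivity) (h2 c) (fun i hi => hmax i (hRY hi))
        have k3 : (R.card : ℝ) * (C * Q * D0) ≤ s * (C * Q * D0) := by gcongr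
        have k4 : |c j| * D0 ≤ ((1 + s * C) * Q) * D0 := by nlinarith
        have k5 := le_of_mul_le_mul_right k4 (by linarith)
        refine k5.trans ?_
        gcongr
        linarith
      · refine (h2 c j hj).trans ?_
        gcongr
        linarith
    · intro y hy
      rw [hun]
      simp only [Finset.mem_sdiff, Finset.mem_insert, not_or] at hy
      obtain ⟨c, hc1, hc2⟩ := h1 y (by simp [hy])
      refine ⟨c, fun j hj => ?_, by linarith⟩
      rcases Finset.mem_insert.1 hj with rfl | hj
      · have k1 := dJ_key q μ J (c j) (μ j) (μ y + ∑ j ∈ R, c j • μ j) c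
        have e : c j • μ j + (μ y + ∑ j ∈ R, c j • μ j) + ∑ j ∈ J, c j • μ j =
          μ y + ∑ j ∈ insert j J ∪ R, c j • μ j := by rw [hsplit]; abel
        rw [e] at k1
        have k2 := dJ_sum q μ J R c (B := C) (D0 := D0) (by positivity) hc1 (fun i hi => hmax i (hRY hi))
        have k3 : (R.card : ℝ) * (C * D0) ≤ s * (C * D0) := by gcongr
        have k6 := dJ_add q μ J (μ y) (∑ j ∈ R, c j • μ j)
        have k7 := hmax y hy.1
        have k4 : |c j| * D0 ≤ (1 + C + s * C) * D0 := by nlinarith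
        have k5 := le_of_mul_le_mul_right k4 (by linarith)
        linarith
      · exact (hc1 j hj).trans (by linarith)

/-- admissibility: all functionals in `T` are bounded by `R` on `v` -/
def Adm (T : Set (W →ₗ[ℝ] ℝ)) (R : ℝ) (v : W) : Prop := ∀ φ ∈ T, |φ v| ≤ R
lemma Adm.mono {T : Set (W →ₗ[ℝ] ℝ)} {R R' : ℝ} {v : W} (h : Adm T R v) (hR : R ≤ R') : Adm T R' v :=
  fun φ hφ => (h φ hφ).trans hR
lemma Adm.add {T : Set (W →ₗ[ℝ] ℝ)} {R R' : ℝ} {v w : W} (h : Adm T R v) (h' : Adm T R' w) :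
    Adm T (R + R') (v + w) := fun φ hφ => by
  rw [map_add]; exact (abs_add_le _ _).trans (add_le_add (h φ hφ) (h' φ hφ))
lemma Adm.sum {T : Set (W →ₗ[ℝ] ℝ)} {L Q : ℝ} {μ : ι → W} {c : ι → ℝ} {R : Finset ι} (hQ : 0 ≤ Q)
    (h : ∀ j ∈ R, Adm T L (μ j)) (hc : ∀ j ∈ R, |c j| ≤ Q) : Adm T (R.card * (Q * L)) (∑ j ∈ R, c j • μ j) := by
  intro φ hφ
  rw [map_sum]
  refine (Finset.abs_sum_le_sum_abs _ _).trans ?_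
  rw [← nsmul_eq_mul]
  refine Finset.sum_le_card_nsmul _ _ _ (fun j hj => ?_)
  rw [map_smul, smul_eq_mul, abs_mul]
  exact mul_le_mul (hc j hj) (h j hj φ hφ) (abs_nonneg _) hQ
lemma semi_sum (q : Seminorm ℝ W) {L Q : ℝ} {μ : ι → W} {c : ι → ℝ} {R : Finset ι} (hQ : 0 ≤ Q)
    (h : ∀ j ∈ R, q (μ j) ≤ L) (hc : ∀ j ∈ R, |c j| ≤ Q) : q (∑ j ∈ R, c j • μ j) ≤ R.card * (Q * L) := by
  refine (Finset.le_sum_of_subadditive q (map_zero q).le (map_add_le_add q) R _).trans ?_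
  rw [← nsmul_eq_mul]
  refine Finset.sum_le_card_nsmul _ _ _ (fun j hj => ?_)
  rw [map_smul_eq_mul, Real.norm_eq_abs]
  exact mul_le_mul (hc j hj) (h j hj) (apply_nonneg _ _) hQ

lemma rescale (ι W : Type*) [AddCommGroup W] [Module ℝ W] (s : ℕ) (L : ℝ) (hL : 1 ≤ L) : ∃ L' : ℝ, 1 ≤ L' ∧
    ∀ (q1 q : Seminorm ℝ W) (T : Set (W →ₗ[ℝ] ℝ)) (μ : ι → W) (J Y : Finset ι), Disjoint J Y → Y.card ≤ s →
    (∀ v, q1 v ≤ L * q v) → (∀ y ∈ Y, Adm T L (μ y) ∧ q1 (μ y) ≤ L) →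
    (∀ c : ι → ℝ, Adm T (L * q1 (∑ j ∈ J, c j • μ j)) (∑ j ∈ J, c j • μ j) ∧
      ∀ j ∈ J, |c j| ≤ L * q1 (∑ j ∈ J, c j • μ j)) →
    ∃ R ⊆ Y, (∀ y ∈ Y \ R, ∃ c : ι → ℝ, Adm T L' (μ y + ∑ j ∈ J ∪ R, c j • μ j) ∧
        q (μ y + ∑ j ∈ J ∪ R, c j • μ j) ≤ L') ∧
      ∀ c : ι → ℝ, Adm T (L' * q (∑ j ∈ J ∪ R, c j • μ j)) (∑ j ∈ J ∪ R, c j • μ j) ∧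
        ∀ j ∈ J ∪ R, |c j| ≤ L' * q (∑ j ∈ J ∪ R, c j • μ j) := by
  obtain ⟨C, hC, H⟩ := greedy ι W s
  have hs : (0 : ℝ) ≤ s := by positivity
  set L2 := L * ((s + 1) * L) + s * L + 1 with hL2
  have hLL : 0 ≤ L * ((s + 1) * L) := by positivity
  have hsL : 0 ≤ s * L := by positivity
  refine ⟨L2 * C, by nlinarith, ?_⟩
  intro q1 q T μ J Y hd hY hq h1 h2
  obtain ⟨R, hR, g2, g1⟩ := H q μ J Y hd hY
  have aux : ∀ (R' : Finset ι) (c : ι → ℝ) (Q : ℝ), R' ⊆ Y → 0 ≤ Q → (∀ j ∈ R', |c j| ≤ Q) →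
      q (∑ j ∈ J ∪ R', c j • μ j) ≤ Q → Adm T (L2 * Q) (∑ j ∈ J ∪ R', c j • μ j) ∧ ∀ j ∈ J, |c j| ≤ L2 * Q := by
    intro R' c Q hR' hQ hc hqQ
    have hRc : (R'.card : ℝ) ≤ s := by exact_mod_cast (Finset.card_le_card hR').trans hY
    rw [Finset.sum_union (hd.mono_right hR')] at hqQ ⊢
    have k1 := semi_sum q1 hQ (fun j hj => (h1 j (hR' hj)).2) hc
    have k2 : q1 (∑ j ∈ J, c j • μ j) ≤ (s + 1) * L * Q := by
      have e : ∑ j ∈ J, c j • μ j = (∑ j ∈ J, c j • μ j + ∑ j ∈ R', c j • μ j) - ∑ j ∈ R', c j • μ j := by abel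
      have k3 := map_sub_le_add q1 (∑ j ∈ J, c j • μ j + ∑ j ∈ R', c j • μ j) (∑ j ∈ R', c j • μ j)
      rw [← e] at k3
      have k4 := hq (∑ j ∈ J, c j • μ j + ∑ j ∈ R', c j • μ j)
      have k5 : L * q (∑ j ∈ J, c j • μ j + ∑ j ∈ R', c j • μ j) ≤ L * Q := by gcongr
      have k6 : (R'.card : ℝ) * (Q * L) ≤ s * (Q * L) := by gcongr
      linarith
    have k7 : L * q1 (∑ j ∈ J, c j • μ j) ≤ L * ((s + 1) * L * Q) := by gcongr
    have k6 : (R'.card : ℝ) * (Q * L) ≤ s * (Q * L) := by gcongr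
    refine ⟨((h2 c).1.add (Adm.sum hQ (fun j hj => (h1 j (hR' hj)).1) hc)).mono ?_, fun j hj => ?_⟩
    · rw [hL2]; nlinarith
    · refine ((h2 c).2 j hj).trans ?_
      rw [hL2]; nlinarith [mul_nonneg hsL hQ]
  refine ⟨R, hR, ?_, ?_⟩
  · intro y hy
    obtain ⟨c, hc1, hc2⟩ := g1 y hy
    simp only [Finset.mem_sdiff] at hy
    have hyJ : y ∉ J := fun h => Finset.disjoint_left.1 hd h hy.1
    have hun : J ∪ insert y R = insert y (J ∪ R) := by ext; simp
    have e : ∑ j ∈ J ∪ insert y R, (if j = y then 1 else c j) • μ j = μ y + ∑ j ∈ J ∪ R, c j • μ j := by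
      rw [hun, Finset.sum_insert (by simp [hyJ, hy.2])]
      simp only [if_true, one_smul]
      congr 1
      refine Finset.sum_congr rfl (fun j hj => ?_)
      rw [if_neg]
      rintro rfl
      simp [hyJ, hy.2] at hj
    have := aux (insert y R) (fun j => if j = y then 1 else c j) C (Finset.insert_subset hy.1 hR) (by linarith) (by
      intro j hj
      rcases Finset.mem_insert.1 hj with rfl | hj
      · simpa using hC
      · skip
        split_ifs
        · simpa using hC
        · exact hc1 j hj) (by beta_reduce; rw [e]; exact hc2)
    beta_reduce at this
    rw [e] at this
    refine ⟨c, this.1, hc2.trans ?_⟩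
    nlinarith
  · intro c
    set Q := q (∑ j ∈ J ∪ R, c j • μ j) with hQ
    have hQ0 : 0 ≤ Q := apply_nonneg _ _
    have := aux R c (C * Q) hR (by positivity) (g2 c) (by nlinarith)
    rw [← mul_assoc] at this
    refine ⟨this.1, fun j hj => ?_⟩
    rcases Finset.mem_union.1 hj with hj | hj
    · exact this.2 j hj
    · refine (g2 c j hj).trans ?_
      gcongr
      nlinarith
end greedy

end CmSel

namespace CmSel

lemma cut_exists (m n : ℕ) (k : ℕ) : ∃ B : ℝ, 1 ≤ B ∧ ∀ (C : Finset (En n)) (δ : ℝ), C.card ≤ k → 0 < δ →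
    ∃ θ : En n → ℝ, ContDiff ℝ m θ ∧ (∀ y, ∀ i ≤ m, ‖iteratedFDeriv ℝ i θ y‖ ≤ B / δ ^ i) ∧ (∀ x ∈ C, θ x = 1) ∧
      ∀ y, (∀ z ∈ C, δ ≤ ‖y - z‖) → θ y = 0 := by
  induction k with
  | zero =>
    refine ⟨1, le_rfl, fun C δ hC hδ => ⟨fun _ => 0, contDiff_const, fun y i hi => ?_, ?_, fun _ _ => rfl⟩⟩
    · have : ‖iteratedFDeriv ℝ i (fun _ : En n => (0 : ℝ)) y‖ = 0 := by simp
      rw [this]; positivity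
    · have : C = ∅ := by simpa using hC
      subst this; simp
  | succ k ih =>
    obtain ⟨B, hB, H⟩ := ih
    have hBB := BB_ge m n
    set B1 := BB m n * 2 ^ m with hB1
    have hB1p : 0 ≤ B1 := by positivity
    have hB2p : 0 ≤ 2 ^ m * B1 * B := by positivity
    refine ⟨B1 + B + 2 ^ m * B1 * B, by linarith, fun C δ hC hδ => ?_⟩
    rcases C.eq_empty_or_nonempty with rfl | ⟨a, ha⟩
    · obtain ⟨θ, h1, h2, h3, h4⟩ := H ∅ δ (by simp) hδ
      exact ⟨θ, h1, fun y i hi => (h2 y i hi).trans (by gcongr; linarith), by simp, h4⟩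
    obtain ⟨θ, h1, h2, h3, h4⟩ := H (C.erase a) δ (by rw [Finset.card_erase_of_mem ha]; omega) hδ
    set b := bump a (δ / 2) with hb
    have cb : ContDiff ℝ m b := bump_contDiff _ _ _
    have bb : ∀ y, ∀ i ≤ m, ‖iteratedFDeriv ℝ i b y‖ ≤ B1 / δ ^ i := by
      intro y i hi
      refine (bump_bound a (half_pos hδ) hi y).trans ?_
      rw [div_pow, div_div_eq_mul_div]
      have : (2 : ℝ) ^ i ≤ 2 ^ m := pow_le_pow_right₀ (by norm_num) hi
      rw [hB1]
      gcongr
    refine ⟨(b + θ) - (fun y => b y • θ y), (cb.add h1).sub (cb.smul h1), fun y i hi => ?_, fun x hx => ?_, fun y hy => ?_⟩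
    · have his : (i : WithTop ℕ∞) ≤ m := by exact_mod_cast hi
      have c1 : ContDiff ℝ i b := cb.of_le his
      have c2 : ContDiff ℝ i θ := h1.of_le his
      have c3 : ContDiff ℝ i (b + θ) := c1.add c2
      have c4 : ContDiff ℝ i (fun y => b y • θ y) := c1.smul c2
      have l := leib (m := m) (y := y) (R := B / δ ^ m) cb h1 hδ (bb y) (fun i hi => by
        refine (h2 y i hi).trans (le_of_eq ?_)
        have : δ ^ m = δ ^ (m - i) * δ ^ i := by rw [← pow_add]; congr 1; omega
        rw [this]; field_simp) i hi
      have e : 2 ^ m * B1 * (B / δ ^ m) * δ ^ (m - i) = 2 ^ m * B1 * B / δ ^ i := by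
        have : δ ^ m = δ ^ (m - i) * δ ^ i := by rw [← pow_add]; congr 1; omega
        rw [this]; field_simp
      rw [e] at l
      rw [iteratedFDeriv_sub_apply c3.contDiffAt c4.contDiffAt, iteratedFDeriv_add_apply c1.contDiffAt c2.contDiffAt,
        add_div, add_div]
      exact (norm_sub_le _ _).trans (add_le_add ((norm_add_le _ _).trans (add_le_add (bb y i hi) (h2 y i hi))) l)
    · simp only [Pi.sub_apply, Pi.add_apply, smul_eq_mul]
      rcases eq_or_ne x a with rfl | hxa
      · rw [hb, bump_one (half_pos hδ) (by simp; positivity)]; ring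
      · rw [h3 x (by simp [hxa, hx])]; ring
    · simp only [Pi.sub_apply, Pi.add_apply, smul_eq_mul]
      rw [h4 y (fun z hz => hy z (Finset.mem_of_mem_erase hz)), hb,
        bump_zero (half_pos hδ) (by linarith [hy a ha])]; ring

/-- `f` has dual norm at most `1` on `S` -/
def Dual {n D : ℕ} (m : ℕ) (S : Finset (En n)) (f : En n → (Fin D → ℝ) →ₗ[ℝ] ℝ) : Prop :=
  ∀ F : En n → Fin D → ℝ, NB m F 1 → |∑ x ∈ S, f x (F x)| ≤ 1

lemma Dual.scaled {m n D : ℕ} {S : Finset (En n)} {f : En n → (Fin D → ℝ) →ₗ[ℝ] ℝ} (h : Dual m S f)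
    {F : En n → Fin D → ℝ} {M : ℝ} (hM : 0 < M) (hF : NB m F M) : |∑ x ∈ S, f x (F x)| ≤ M := by
  have h1 : NB m (M⁻¹ • F) 1 := by
    refine ⟨hF.1.const_smul M⁻¹, fun k hk y => ?_⟩
    have hks : (k : WithTop ℕ∞) ≤ m := by exact_mod_cast hk
    rw [iteratedFDeriv_const_smul_apply (hF.1.of_le hks).contDiffAt, norm_smul, Real.norm_eq_abs,
      abs_of_pos (inv_pos.2 hM), inv_mul_le_iff₀ hM, mul_one]
    exact hF.2 k hk y
  have h2 := h _ h1
  have e : ∑ x ∈ S, f x ((M⁻¹ • F) x) = M⁻¹ * ∑ x ∈ S, f x (F x) := by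
    rw [Finset.mul_sum]; refine Finset.sum_congr rfl (fun x _ => ?_)
    rw [Pi.smul_apply, map_smul, smul_eq_mul]
  rw [e, abs_mul, abs_of_pos (inv_pos.2 hM), inv_mul_le_iff₀ hM, mul_one] at h2
  exact h2

lemma dual_cut (m n D : ℕ) (k : ℕ) : ∃ B : ℝ, 1 ≤ B ∧ ∀ (S C : Finset (En n)) (f : En n → (Fin D → ℝ) →ₗ[ℝ] ℝ) (δ R : ℝ)
    (H : En n → Fin D → ℝ), Dual m S f → C ⊆ S → C.card ≤ k → 0 < δ → δ ≤ 1 → (∀ z ∈ C, ∀ w ∈ S, w ∉ C → δ ≤ ‖w - z‖) →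
    ContDiff ℝ m H → 0 < R → (∀ y, (∃ z ∈ C, ‖y - z‖ ≤ δ) → ∀ i ≤ m, ‖iteratedFDeriv ℝ i H y‖ ≤ R * δ ^ (m - i)) →
    |∑ z ∈ C, f z (H z)| ≤ B * R := by
  obtain ⟨B, hB, HB⟩ := cut_exists m n k
  have h2m : (1 : ℝ) ≤ 2 ^ m := one_le_pow₀ (by norm_num)
  refine ⟨2 ^ m * B, by nlinarith, ?_⟩
  intro S C f δ R H hf hCS hCk hδ hδ1 hsep cH hR hH
  obtain ⟨θ, h1, h2, h3, h4⟩ := HB C δ hCk hδ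
  have nb : NB m (fun y => θ y • H y) (2 ^ m * B * R) := by
    refine ⟨h1.smul cH, fun i hi y => ?_⟩
    by_cases hy : ∃ z ∈ C, ‖y - z‖ ≤ δ
    · refine (leib h1 cH hδ (h2 y) (hH y hy) i hi).trans ?_
      have : δ ^ (m - i) ≤ 1 := pow_le_one₀ hδ.le hδ1
      exact mul_le_of_le_one_right (by positivity) this
    · push Not at hy
      have ev : (fun y => θ y • H y) =ᶠ[nhds y] fun _ => 0 := by
        have : ∀ᶠ w in nhds y, ∀ z ∈ C, δ < ‖w - z‖ := by
          rw [Filter.eventually_all_finset]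
          intro z hz
          have : ContinuousAt (fun w : En n => ‖w - z‖) y := by fun_prop
          exact this.eventually_const_lt (hy z hz)
        filter_upwards [this] with w hw
        rw [h4 w (fun z hz => (hw z hz).le), zero_smul]
      rw [(ev.iteratedFDeriv ℝ i).eq_of_nhds]
      have hz : ‖iteratedFDeriv ℝ i (fun _ : En n => (0 : Fin D → ℝ)) y‖ = 0 := by simp
      rw [hz]; positivity
  have := hf.scaled (by positivity) nb
  have e : ∑ x ∈ S, f x (θ x • H x) = ∑ z ∈ C, f z (H z) := by
    rw [← Finset.sum_subset hCS]
    · refine Finset.sum_congr rfl (fun x hx => ?_)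
      rw [h3 x hx, one_smul]
    · intro x hx hxC
      rw [h4 x (fun z hz => hsep z hz x hx hxC), zero_smul, map_zero]
  rwa [e] at this

section
variable {m n D : ℕ}

/-- polynomial part of the functional `ν f` -/
def Gn (m : ℕ) (S : Finset (En n)) (f : En n → (Fin D → ℝ) →ₗ[ℝ] ℝ) (ν : En n → ℝ) (p : Jt m n D) : ℝ :=
  ∑ z ∈ S, ν z * f z (pl p z)

lemma Gn_add (S : Finset (En n)) (f : En n → (Fin D → ℝ) →ₗ[ℝ] ℝ) (ν : En n → ℝ) (p q : Jt m n D) :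
    Gn m S f ν (p + q) = Gn m S f ν p + Gn m S f ν q := by
  simp only [Gn, pl_add, Pi.add_apply, map_add, mul_add, Finset.sum_add_distrib]
lemma Gn_smul (S : Finset (En n)) (f : En n → (Fin D → ℝ) →ₗ[ℝ] ℝ) (ν : En n → ℝ) (a : ℝ) (p : Jt m n D) :
    Gn m S f ν (a • p) = a * Gn m S f ν p := by
  simp only [Gn, pl_smul, Pi.smul_apply, map_smul, Finset.mul_sum, smul_eq_mul]
  exact Finset.sum_congr rfl (fun _ _ => by ring)
def GnL (S : Finset (En n)) (f : En n → (Fin D → ℝ) →ₗ[ℝ] ℝ) (ν : En n → ℝ) : Jt m n D →ₗ[ℝ] ℝ where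
  toFun := Gn m S f ν
  map_add' := Gn_add S f ν
  map_smul' := Gn_smul S f ν
lemma Gn_add_left (S : Finset (En n)) (f : En n → (Fin D → ℝ) →ₗ[ℝ] ℝ) (ν ν' : En n → ℝ) (p : Jt m n D) :
    Gn m S f (ν + ν') p = Gn m S f ν p + Gn m S f ν' p := by
  simp only [Gn, Pi.add_apply, add_mul, Finset.sum_add_distrib]
lemma Gn_smul_left (S : Finset (En n)) (f : En n → (Fin D → ℝ) →ₗ[ℝ] ℝ) (a : ℝ) (ν : En n → ℝ) (p : Jt m n D) :
    Gn m S f (a • ν) p = a * Gn m S f ν p := by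
  simp only [Gn, Pi.smul_apply, smul_eq_mul, Finset.mul_sum]
  exact Finset.sum_congr rfl (fun _ _ => by ring)

def eb (x : En n) (δ : ℝ) (b : Ix m n D) : Jt m n D := co (-x) (Pi.single b (δ ^ (m - od b)))

lemma eb_Bd (x : En n) {δ : ℝ} (hδ : 0 < δ) (b : Ix m n D) : Bd x δ 1 (eb x δ b) := by
  intro c
  rw [eb, co_neg, one_mul]
  rcases eq_or_ne c b with rfl | h
  · rw [Pi.single_eq_same, abs_of_pos (by positivity)]
  · rw [Pi.single_eq_of_ne h, abs_zero]; positivity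

lemma eb_expand (x : En n) {δ : ℝ} (hδ : 0 < δ) (p : Jt m n D) : p = ∑ b, nco x δ p b • eb x δ b := by
  have : co x p = ∑ b, nco x δ p b • (Pi.single b (δ ^ (m - od b)) : Jt m n D) := by
    funext c
    rw [Finset.sum_apply, Finset.sum_eq_single c]
    · rw [Pi.smul_apply, Pi.single_eq_same, nco_apply, smul_eq_mul]; field_simp
    · intro b _ hb
      rw [Pi.smul_apply, Pi.single_eq_of_ne hb.symm, smul_zero]
    · simp
  have h2 := congrArg (co (-x)) this
  rw [co_neg', map_sum] at h2
  refine h2.trans (Finset.sum_congr rfl (fun b _ => ?_))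
  rw [map_smul]; rfl

/-- dual norm at scale `δ` of the polynomial part -/
def qn (m : ℕ) (S : Finset (En n)) (f : En n → (Fin D → ℝ) →ₗ[ℝ] ℝ) (x : En n) (δ : ℝ) : Seminorm ℝ (En n → ℝ) :=
  Seminorm.of (fun ν => ∑ b : Ix m n D, |Gn m S f ν (eb x δ b)|)
    (fun ν ν' => by
      rw [← Finset.sum_add_distrib]
      refine Finset.sum_le_sum (fun b _ => ?_)
      rw [Gn_add_left]; exact abs_add_le _ _)
    (fun a ν => by
      rw [Finset.mul_sum]
      refine Finset.sum_congr rfl (fun b _ => ?_)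
      rw [Gn_smul_left, abs_mul, Real.norm_eq_abs])
lemma qn_def (S : Finset (En n)) (f : En n → (Fin D → ℝ) →ₗ[ℝ] ℝ) (x : En n) (δ : ℝ) (ν : En n → ℝ) :
    qn m S f x δ ν = ∑ b : Ix m n D, |Gn m S f ν (eb x δ b)| := rfl

lemma Gn_le_qn (S : Finset (En n)) (f : En n → (Fin D → ℝ) →ₗ[ℝ] ℝ) {x : En n} {δ R : ℝ} (hδ : 0 < δ) (ν : En n → ℝ)
    {p : Jt m n D} (hp : Bd x δ R p) : |Gn m S f ν p| ≤ R * qn m S f x δ ν := by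
  have e : Gn m S f ν p = ∑ b, nco x δ p b * Gn m S f ν (eb x δ b) := by
    conv_lhs => rw [eb_expand x hδ p]
    have := map_sum (GnL S f ν : Jt m n D →ₗ[ℝ] ℝ) (fun b => nco x δ p b • eb x δ b) Finset.univ
    refine this.trans (Finset.sum_congr rfl (fun b _ => ?_))
    rw [map_smul]; rfl
  rw [e, qn_def, Finset.mul_sum]
  refine (Finset.abs_sum_le_sum_abs _ _).trans (Finset.sum_le_sum (fun b _ => ?_))
  rw [abs_mul]
  exact mul_le_mul_of_nonneg_right ((Bd_iff hδ).1 hp b) (abs_nonneg _)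

lemma qn_le (S : Finset (En n)) (f : En n → (Fin D → ℝ) →ₗ[ℝ] ℝ) {x : En n} {δ R : ℝ} (hδ : 0 < δ) (ν : En n → ℝ)
    (h : ∀ p : Jt m n D, Bd x δ 1 p → |Gn m S f ν p| ≤ R) : qn m S f x δ ν ≤ Fintype.card (Ix m n D) * R := by
  rw [qn_def]
  have := Finset.sum_le_card_nsmul (Finset.univ : Finset (Ix m n D)) (fun b => |Gn m S f ν (eb x δ b)|) R
    (fun b _ => h _ (eb_Bd x hδ b))
  simpa using this

lemma qn_compare (S : Finset (En n)) (f : En n → (Fin D → ℝ) →ₗ[ℝ] ℝ) {x x' : En n} {δ δ' K : ℝ} (hδ : 0 < δ)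
    (hδ' : δ ≤ δ') (hK : 1 ≤ K) (hx : ‖x' - x‖ ≤ K * δ) (ν : En n → ℝ) :
    qn m S f x δ ν ≤ Fintype.card (Ix m n D) * (CM m n * K ^ m) * qn m S f x' δ' ν := by
  rw [mul_assoc]
  refine qn_le S f hδ ν (fun p hp => ?_)
  have h1 := hp.move zero_le_one hδ.le hK hx
  rw [mul_one] at h1
  have := CM_ge m n
  exact Gn_le_qn S f (hδ.trans_le hδ') ν (h1.scale (by positivity) hδ.le hδ')

/-- the test functionals: evaluations and costs -/
def Tst (m : ℕ) (S : Finset (En n)) (f : En n → (Fin D → ℝ) →ₗ[ℝ] ℝ) (x : En n) : Set ((En n → ℝ) →ₗ[ℝ] ℝ) :=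
  {φ | (∃ z, φ = LinearMap.proj z) ∨ ∃ (F : En n → Fin D → ℝ) (p : Jt m n D), NB m F 1 ∧ Jet F x p ∧
    φ = ∑ z ∈ S, (f z (F z - pl p z)) • (LinearMap.proj z : (En n → ℝ) →ₗ[ℝ] ℝ)}

lemma adm_iff {S : Finset (En n)} {f : En n → (Fin D → ℝ) →ₗ[ℝ] ℝ} {x : En n} {R : ℝ} {ν : En n → ℝ} :
    Adm (Tst m S f x) R ν ↔ (∀ z, |ν z| ≤ R) ∧ ∀ (F : En n → Fin D → ℝ) (p : Jt m n D), NB m F 1 → Jet F x p →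
      |∑ z ∈ S, ν z * f z (F z - pl p z)| ≤ R := by
  have e : ∀ (F : En n → Fin D → ℝ) (p : Jt m n D), (∑ z ∈ S, (f z (F z - pl p z)) •
      (LinearMap.proj z : (En n → ℝ) →ₗ[ℝ] ℝ)) ν = ∑ z ∈ S, ν z * f z (F z - pl p z) := by
    intro F p
    rw [LinearMap.sum_apply]
    refine Finset.sum_congr rfl (fun z _ => ?_)
    rw [LinearMap.smul_apply, LinearMap.proj_apply, smul_eq_mul, mul_comm]
  constructor
  · intro h
    refine ⟨fun z => h _ (Or.inl ⟨z, rfl⟩), fun F p hF hp => ?_⟩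
    rw [← e]
    exact h _ (Or.inr ⟨F, p, hF, hp, rfl⟩)
  · rintro ⟨h1, h2⟩ φ (⟨z, rfl⟩ | ⟨F, p, hF, hp, rfl⟩)
    · exact h1 z
    · rw [e]; exact h2 F p hF hp

lemma adm_move {S : Finset (En n)} {f : En n → (Fin D → ℝ) →ₗ[ℝ] ℝ} {x x' : En n} {R δ K : ℝ} {ν : En n → ℝ}
    (hδ : 0 < δ) (hK : 1 ≤ K) (hx : ‖x' - x‖ ≤ K * δ) (h : Adm (Tst m S f x) R ν) :
    Adm (Tst m S f x') (R + K ^ m * qn m S f x δ ν) ν := by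
  rw [adm_iff] at h ⊢
  have hq : 0 ≤ qn m S f x δ ν := apply_nonneg _ _
  refine ⟨fun z => (h.1 z).trans (by simp; positivity), fun F p' hF hp' => ?_⟩
  obtain ⟨p, hp⟩ := Jet.exists hF.1 x
  have e : ∑ z ∈ S, ν z * f z (F z - pl p' z) = ∑ z ∈ S, ν z * f z (F z - pl p z) + Gn m S f ν (p - p') := by
    rw [Gn, ← Finset.sum_add_distrib]
    refine Finset.sum_congr rfl (fun z _ => ?_)
    rw [← mul_add, ← map_add, pl_sub, Pi.sub_apply]
    congr 2; abel
  rw [e]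
  have b1 : Bd x (K * δ) 1 (p - p') := (hp.two hp' hF).scale zero_le_one (norm_nonneg _) (by rwa [norm_sub_rev])
  have b2 := b1.scaleT hδ.le zero_le_one hK
  rw [one_mul] at b2
  exact (abs_add_le _ _).trans (add_le_add (h.2 F p hF hp) (Gn_le_qn S f hδ ν b2))

/-- indicator of a cluster is an admissible multiplier -/
lemma ind_adm (m n D : ℕ) (k : ℕ) (K : ℝ) (hK : 1 ≤ K) : ∃ B : ℝ, 1 ≤ B ∧ ∀ (S C : Finset (En n))
    (f : En n → (Fin D → ℝ) →ₗ[ℝ] ℝ) (δ : ℝ) (x : En n), Dual m S f → C ⊆ S → C.card ≤ k → 0 < δ → δ ≤ 1 →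
    (∀ z ∈ C, ∀ w ∈ S, w ∉ C → δ ≤ ‖w - z‖) → (∀ z ∈ C, ‖z - x‖ ≤ K * δ) →
    Adm (Tst m S f x) B (fun z => if z ∈ C then 1 else 0) ∧ qn m S f x δ (fun z => if z ∈ C then 1 else 0) ≤ B := by
  obtain ⟨B, hB, H⟩ := dual_cut m n D k
  have hCP := CP_ge m n
  have e1 : 1 ≤ (K + 1) ^ m := one_le_pow₀ (by linarith)
  have hBm : 0 ≤ B * (K + 1) ^ m := by positivity
  have hBc : 0 ≤ Fintype.card (Ix m n D) * (B * (CP m n * (K + 1) ^ m)) := by positivity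
  refine ⟨1 + B * (K + 1) ^ m + Fintype.card (Ix m n D) * (B * (CP m n * (K + 1) ^ m)), by linarith, ?_⟩
  intro S C f δ x hf hCS hCk hδ hδ1 hsep hdiam
  have hnear : ∀ y, (∃ z ∈ C, ‖y - z‖ ≤ δ) → ‖y - x‖ ≤ (K + 1) * δ := by
    rintro y ⟨z, hz, hyz⟩
    have := norm_sub_le_norm_sub_add_norm_sub y z x
    linarith [hdiam z hz]
  have esum : ∀ g : En n → Fin D → ℝ, ∑ z ∈ S, (if z ∈ C then (1 : ℝ) else 0) * f z (g z) = ∑ z ∈ C, f z (g z) := by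
    intro g
    rw [← Finset.sum_subset hCS]
    · exact Finset.sum_congr rfl (fun z hz => by rw [if_pos hz, one_mul])
    · intro z _ hz; rw [if_neg hz, zero_mul]
  constructor
  · rw [adm_iff]
    refine ⟨fun z => ?_, fun F p hF hp => ?_⟩
    · beta_reduce
      split_ifs
      · rw [abs_one]; linarith
      · rw [abs_zero]; linarith
    · rw [esum (fun z => F z - pl p z)]
      refine (H S C f δ ((K + 1) ^ m) (F - pl p) hf hCS hCk hδ hδ1 hsep (hF.1.sub (contDiff_pl _ _)) (by positivity)
        (fun y hy i hi => ?_)).trans (by linarith)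
      refine (hp.taylor hF hi y).trans ?_
      rw [one_mul]
      calc ‖y - x‖ ^ (m - i) ≤ ((K + 1) * δ) ^ (m - i) := by gcongr; exact hnear y hy
        _ = (K + 1) ^ (m - i) * δ ^ (m - i) := mul_pow _ _ _
        _ ≤ _ := by gcongr; · linarith
                    · omega
  · refine (qn_le S f hδ _ (R := B * (CP m n * (K + 1) ^ m)) (fun p hp => ?_)).trans (by linarith)
    rw [Gn, esum (fun z => pl p z)]
    refine H S C f δ _ (pl p) hf hCS hCk hδ hδ1 hsep (contDiff_pl _ _) (by positivity) (fun y hy i hi => ?_)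
    have := pl_bound hp zero_le_one hδ.le (show 1 ≤ K + 1 by linarith) (hnear y hy) hi
    rwa [mul_one] at this
end

end CmSel

namespace CmSel

lemma rescale' (ι W : Type*) [inst : DecidableEq ι] [AddCommGroup W] [Module ℝ W] (s : ℕ) (L : ℝ) (hL : 1 ≤ L) : ∃ L' : ℝ, 1 ≤ L' ∧
    ∀ (q1 q : Seminorm ℝ W) (T : Set (W →ₗ[ℝ] ℝ)) (μ : ι → W) (J Y : Finset ι), Disjoint J Y → Y.card ≤ s →
    (∀ v, q1 v ≤ L * q v) → (∀ y ∈ Y, Adm T L (μ y) ∧ q1 (μ y) ≤ L) →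
    (∀ c : ι → ℝ, Adm T (L * q1 (∑ j ∈ J, c j • μ j)) (∑ j ∈ J, c j • μ j) ∧
      ∀ j ∈ J, |c j| ≤ L * q1 (∑ j ∈ J, c j • μ j)) →
    ∃ R ⊆ Y, (∀ y ∈ Y \ R, ∃ c : ι → ℝ, Adm T L' (μ y + ∑ j ∈ J ∪ R, c j • μ j) ∧
        q (μ y + ∑ j ∈ J ∪ R, c j • μ j) ≤ L') ∧
      ∀ c : ι → ℝ, Adm T (L' * q (∑ j ∈ J ∪ R, c j • μ j)) (∑ j ∈ J ∪ R, c j • μ j) ∧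
        ∀ j ∈ J ∪ R, |c j| ≤ L' * q (∑ j ∈ J ∪ R, c j • μ j) := by
  have e : inst = fun a b => Classical.propDecidable (a = b) := Subsingleton.elim _ _
  subst e
  exact rescale ι W s L hL

structure Good {n D : ℕ} (m : ℕ) (S : Finset (En n)) (f : En n → (Fin D → ℝ) →ₗ[ℝ] ℝ) (C : Finset (En n)) (x : En n)
    (δ L : ℝ) (Y J : Finset (En n)) (μ : En n → En n → ℝ) : Prop where
  YC : Y ⊆ C
  JC : J ⊆ C
  disj : Disjoint J Y
  ne : Y.Nonempty
  suppY : ∀ y ∈ Y, ∀ z, z ∉ C → μ y z = 0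
  suppJ : ∀ y ∈ J, ∀ z, z ∉ C → μ y z = 0
  kron : ∀ y ∈ Y, ∀ y' ∈ Y, μ y y' = if y' = y then 1 else 0
  kz : ∀ j ∈ J, ∀ y ∈ Y, μ j y = 0
  a1 : ∀ y ∈ Y, Adm (Tst m S f x) L (μ y) ∧ qn m S f x δ (μ y) ≤ L
  a2 : ∀ c : En n → ℝ, Adm (Tst m S f x) (L * qn m S f x δ (∑ j ∈ J, c j • μ j)) (∑ j ∈ J, c j • μ j) ∧
      ∀ j ∈ J, |c j| ≤ L * qn m S f x δ (∑ j ∈ J, c j • μ j)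
  card : C.card ≤ Y.card * 2 ^ J.card

section
variable {m n D : ℕ} {S C C1 C2 : Finset (En n)} {f : En n → (Fin D → ℝ) →ₗ[ℝ] ℝ} {x x' : En n} {δ δ' L K B : ℝ}
  {Y J Y1 J1 Y2 J2 : Finset (En n)} {μ μ1 μ2 : En n → En n → ℝ}

lemma Good.mono (h : Good m S f C x δ L Y J μ) {L' : ℝ} (hL : L ≤ L') : Good m S f C x δ L' Y J μ := by
  refine { h with a1 := ?_, a2 := ?_ }
  · intro y hy
    exact ⟨(h.a1 y hy).1.mono hL, (h.a1 y hy).2.trans hL⟩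
  · intro c
    have hq : 0 ≤ qn m S f x δ (∑ j ∈ J, c j • μ j) := apply_nonneg _ _
    exact ⟨(h.a2 c).1.mono (by gcongr), fun j hj => ((h.a2 c).2 j hj).trans (by gcongr)⟩

set_option maxHeartbeats 1000000 in
lemma Good.move (h : Good m S f C x δ L Y J μ) (hL : 1 ≤ L) (hδ : 0 < δ) (hK : 1 ≤ K) (hx : ‖x' - x‖ ≤ K * δ) :
    Good m S f C x' δ ((L + K ^ m * L) * ((Fintype.card (Ix m n D) + 1) * (CM m n * K ^ m))) Y J μ := by
  set Q := ((Fintype.card (Ix m n D) : ℝ) + 1) * (CM m n * K ^ m) with hQ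
  have hCM := CM_ge m n
  have hKm : 1 ≤ K ^ m := one_le_pow₀ hK
  have hKL : 0 ≤ K ^ m * L := by positivity
  have hQ1 : 1 ≤ Q := by
    have h1 : (1 : ℝ) ≤ (Fintype.card (Ix m n D) : ℝ) + 1 := by
      have : (0:ℝ) ≤ (Fintype.card (Ix m n D) : ℝ) := Nat.cast_nonneg _
      linarith
    have h2 : 1 ≤ CM m n * K ^ m := by nlinarith
    nlinarith
  have q1 : ∀ ν, qn m S f x δ ν ≤ Q * qn m S f x' δ ν := by
    intro ν
    have hq : 0 ≤ qn m S f x' δ ν := apply_nonneg _ _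
    refine (qn_compare S f hδ le_rfl hK hx ν).trans ?_
    rw [hQ]; gcongr; linarith
  have q2 : ∀ ν, qn m S f x' δ ν ≤ Q * qn m S f x δ ν := by
    intro ν
    have hq : 0 ≤ qn m S f x δ ν := apply_nonneg _ _
    refine (qn_compare S f hδ le_rfl hK (by rwa [norm_sub_rev] at hx) ν).trans ?_
    rw [hQ]; gcongr; linarith
  refine { h with a1 := ?_, a2 := ?_ }
  · intro y hy
    have h1 := (h.a1 y hy).2
    refine ⟨(adm_move hδ hK hx (h.a1 y hy).1).mono ?_, (q2 _).trans ?_⟩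
    · have : K ^ m * qn m S f x δ (μ y) ≤ K ^ m * L := by gcongr
      nlinarith
    · have : Q * qn m S f x δ (μ y) ≤ Q * L := by gcongr
      nlinarith
  · intro c
    have h1 := q1 (∑ j ∈ J, c j • μ j)
    have hq : 0 ≤ qn m S f x δ (∑ j ∈ J, c j • μ j) := apply_nonneg _ _
    have hq' : 0 ≤ qn m S f x' δ (∑ j ∈ J, c j • μ j) := apply_nonneg _ _
    have h2 : (L + K ^ m * L) * qn m S f x δ (∑ j ∈ J, c j • μ j) ≤
        (L + K ^ m * L) * (Q * qn m S f x' δ (∑ j ∈ J, c j • μ j)) := by gcongr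
    rw [← mul_assoc] at h2
    refine ⟨(adm_move hδ hK hx (h.a2 c).1).mono (le_trans ?_ h2), fun j hj => ((h.a2 c).2 j hj).trans (le_trans ?_ h2)⟩
    · rw [add_mul]
      have h3 : K ^ m ≤ K ^ m * L := le_mul_of_one_le_right (by linarith) hL
      exact add_le_add le_rfl (mul_le_mul_of_nonneg_right h3 hq)
    · exact mul_le_mul_of_nonneg_right (by linarith) hq

lemma Good.merge_aux (h1 : Good m S f C1 x δ L Y1 J1 μ1) (h2 : Good m S f C2 x δ L Y2 J2 μ2) (hd : Disjoint C1 C2)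
    (hJ : J2.card ≤ J1.card) : ∃ Y J μ, Good m S f (C1 ∪ C2) x δ L Y J μ := by
  have hn1 : ∀ y ∈ C2, y ∉ C1 := fun y hy hy' => Finset.disjoint_left.1 hd hy' hy
  have hn2 : ∀ y ∈ C1, y ∉ C2 := fun y hy hy' => Finset.disjoint_left.1 hd hy hy'
  set μ : En n → En n → ℝ := fun y => if y ∈ C1 then μ1 y else μ2 y with hμ
  have e1 : ∀ y ∈ C1, μ y = μ1 y := fun y hy => if_pos hy
  have e2 : ∀ y ∈ C2, μ y = μ2 y := fun y hy => if_neg (hn1 y hy)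
  have es : ∀ c : En n → ℝ, ∑ j ∈ J1, c j • μ j = ∑ j ∈ J1, c j • μ1 j := fun c =>
    Finset.sum_congr rfl (fun j hj => by rw [e1 j (h1.JC hj)])
  refine ⟨Y1 ∪ Y2, J1, μ, ?_⟩
  refine ⟨Finset.union_subset_union h1.YC h2.YC, h1.JC.trans Finset.subset_union_left, ?_, ?_, ?_, ?_, ?_, ?_, ?_, ?_, ?_⟩
  · rw [Finset.disjoint_union_right]
    exact ⟨h1.disj, hd.mono h1.JC h2.YC⟩
  · exact h1.ne.mono Finset.subset_union_left
  · intro y hy z hz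
    simp only [Finset.mem_union, not_or] at hz
    rcases Finset.mem_union.1 hy with hy | hy
    · rw [e1 y (h1.YC hy)]; exact h1.suppY y hy z hz.1
    · rw [e2 y (h2.YC hy)]; exact h2.suppY y hy z hz.2
  · intro y hy z hz
    simp only [Finset.mem_union, not_or] at hz
    rw [e1 y (h1.JC hy)]; exact h1.suppJ y hy z hz.1
  · intro y hy y' hy'
    rcases Finset.mem_union.1 hy with hy | hy <;> rcases Finset.mem_union.1 hy' with hy' | hy'
    · rw [e1 y (h1.YC hy)]; exact h1.kron y hy y' hy'
    · rw [e1 y (h1.YC hy), if_neg, h1.suppY y hy y' (hn1 _ (h2.YC hy'))]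
      rintro rfl; exact hn1 _ (h2.YC hy') (h1.YC hy)
    · rw [e2 y (h2.YC hy), if_neg, h2.suppY y hy y' (hn2 _ (h1.YC hy'))]
      rintro rfl; exact hn2 _ (h1.YC hy') (h2.YC hy)
    · rw [e2 y (h2.YC hy)]; exact h2.kron y hy y' hy'
  · intro j hj y hy
    rw [e1 j (h1.JC hj)]
    rcases Finset.mem_union.1 hy with hy | hy
    · exact h1.kz j hj y hy
    · exact h1.suppJ j hj y (hn1 _ (h2.YC hy))
  · intro y hy
    rcases Finset.mem_union.1 hy with hy | hy
    · rw [e1 y (h1.YC hy)]; exact h1.a1 y hy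
    · rw [e2 y (h2.YC hy)]; exact h2.a1 y hy
  · intro c
    rw [es]; exact h1.a2 c
  · rw [Finset.card_union_of_disjoint hd, Finset.card_union_of_disjoint (hd.mono h1.YC h2.YC), add_mul]
    refine add_le_add h1.card (h2.card.trans ?_)
    gcongr
    norm_num

lemma Good.merge (h1 : Good m S f C1 x δ L Y1 J1 μ1) (h2 : Good m S f C2 x δ L Y2 J2 μ2) (hd : Disjoint C1 C2) :
    ∃ Y J μ, Good m S f (C1 ∪ C2) x δ L Y J μ := by
  rcases le_total J2.card J1.card with h | h
  · exact h1.merge_aux h2 hd h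
  · rw [Finset.union_comm]; exact h2.merge_aux h1 hd.symm h

end

lemma nat_aux1 {s r : ℕ} (h : r < s) : s ≤ (s - r) * 2 ^ r := by
  obtain ⟨t, rfl⟩ := Nat.exists_eq_add_of_lt h
  have h1 : r + 1 ≤ 2 ^ r := Nat.lt_two_pow_self
  have : r + t + 1 - r = t + 1 := by omega
  rw [this]
  nlinarith
lemma nat_aux2 {s : ℕ} (h : 1 ≤ s) : s ≤ 2 ^ (s - 1) := by
  have : s - 1 < 2 ^ (s - 1) := Nat.lt_two_pow_self
  omega

set_option maxHeartbeats 1000000 in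
lemma Good.rescale (m n D : ℕ) (s : ℕ) (L : ℝ) (hL : 1 ≤ L) : ∃ L' : ℝ, 1 ≤ L' ∧
    ∀ (S C : Finset (En n)) (f : En n → (Fin D → ℝ) →ₗ[ℝ] ℝ) (x : En n) (δ1 δ : ℝ), 0 < δ1 → δ1 ≤ δ → C.card ≤ s →
      (∃ Y J μ, Good m S f C x δ1 L Y J μ) →
      Adm (Tst m S f x) L (fun z => if z ∈ C then 1 else 0) ∧ qn m S f x δ (fun z => if z ∈ C then 1 else 0) ≤ L →
      ∃ Y J μ, Good m S f C x δ L' Y J μ := by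
  have hCM := CM_ge m n
  set Q := L + Fintype.card (Ix m n D) * (CM m n * 1 ^ m) with hQ
  have hQ0 : 0 ≤ (Fintype.card (Ix m n D) : ℝ) * (CM m n * 1 ^ m) := by positivity
  obtain ⟨L1, hL1, H⟩ := CmSel.rescale' (En n) (En n → ℝ) s Q (by linarith)
  refine ⟨L1 + L, by linarith, ?_⟩
  intro S C f x δ1 δ hδ1 hδ hCs ⟨Y, J, μ, h0⟩ hind
  have h := h0.mono (show L ≤ Q by linarith)
  obtain ⟨R, hR, g1, g2⟩ := H (qn m S f x δ1) (qn m S f x δ) (Tst m S f x) μ J Y h.disj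
    ((Finset.card_le_card h.YC).trans hCs) (fun v => by
      have hq : 0 ≤ qn m S f x δ v := apply_nonneg _ _
      refine (qn_compare (x' := x) (K := 1) S f hδ1 hδ le_rfl (by simpa using hδ1.le) v).trans ?_
      gcongr; linarith) h.a1 h.a2
  have hJR : Disjoint J R := h.disj.mono_right hR
  have hJRC : J ∪ R ⊆ C := Finset.union_subset h.JC (hR.trans h.YC)
  have suppJR : ∀ j ∈ J ∪ R, ∀ z, z ∉ C → μ j z = 0 := by
    intro j hj z hz
    rcases Finset.mem_union.1 hj with hj | hj
    · exact h.suppJ j hj z hz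
    · exact h.suppY j (hR hj) z hz
  have kzJR : ∀ j ∈ J ∪ R, ∀ y ∈ Y, y ∉ R → μ j y = 0 := by
    intro j hj y hy hyR
    rcases Finset.mem_union.1 hj with hj | hj
    · exact h.kz j hj y hy
    · rw [h.kron j (hR hj) y hy, if_neg]
      rintro rfl; exact hyR hj
  by_cases hne : (Y \ R).Nonempty
  · choose! c hc1 hc2 using g1
    set μ' : En n → En n → ℝ := fun y => if y ∈ Y \ R then μ y + ∑ j ∈ J ∪ R, c y j • μ j else μ y with hμ'
    have e1 : ∀ y ∈ Y \ R, μ' y = μ y + ∑ j ∈ J ∪ R, c y j • μ j := fun y hy => if_pos hy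
    have e2 : ∀ j ∈ J ∪ R, μ' j = μ j := by
      intro j hj
      refine if_neg ?_
      intro hj'
      rw [Finset.mem_sdiff] at hj'
      rcases Finset.mem_union.1 hj with hj | hj
      · exact Finset.disjoint_left.1 h.disj hj hj'.1
      · exact hj'.2 hj
    have es : ∀ c : En n → ℝ, ∑ j ∈ J ∪ R, c j • μ' j = ∑ j ∈ J ∪ R, c j • μ j := fun c =>
      Finset.sum_congr rfl (fun j hj => by rw [e2 j hj])
    have ez : ∀ y, ∀ z, (∀ j ∈ J ∪ R, μ j z = 0) → (∑ j ∈ J ∪ R, c y j • μ j) z = 0 := by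
      intro y z hz
      rw [Finset.sum_apply]
      exact Finset.sum_eq_zero (fun j hj => by rw [Pi.smul_apply, hz j hj, smul_zero])
    refine ⟨Y \ R, J ∪ R, μ', Good.mono (L := L1) ?_ (by linarith)⟩
    refine ⟨Finset.sdiff_subset.trans h.YC, hJRC, ?_, hne, ?_, ?_, ?_, ?_, ?_, ?_, ?_⟩
    · rw [Finset.disjoint_union_left]
      exact ⟨h.disj.mono_right Finset.sdiff_subset, Finset.disjoint_sdiff⟩
    · intro y hy z hz
      rw [e1 y hy, Pi.add_apply, ez y z (fun j hj => suppJR j hj z hz), add_zero]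
      exact h.suppY y (Finset.mem_sdiff.1 hy).1 z hz
    · intro y hy z hz
      rw [e2 y hy]; exact suppJR y hy z hz
    · intro y hy y' hy'
      have hy'' := Finset.mem_sdiff.1 hy'
      rw [e1 y hy, Pi.add_apply, ez y y' (fun j hj => kzJR j hj y' hy''.1 hy''.2), add_zero]
      exact h.kron y (Finset.mem_sdiff.1 hy).1 y' hy''.1
    · intro j hj y hy
      have hy'' := Finset.mem_sdiff.1 hy
      rw [e2 j hj]; exact kzJR j hj y hy''.1 hy''.2
    · intro y hy
      rw [e1 y hy]; exact ⟨hc1 y hy, hc2 y hy⟩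
    · intro c
      rw [es]; exact g2 c
    · rw [Finset.card_sdiff_of_subset hR, Finset.card_union_of_disjoint hJR, pow_add]
      have hlt : R.card < Y.card := by
        have := Finset.card_pos.2 hne
        rw [Finset.card_sdiff_of_subset hR] at this; omega
      calc C.card ≤ Y.card * 2 ^ J.card := h.card
        _ ≤ (Y.card - R.card) * 2 ^ R.card * 2 ^ J.card := Nat.mul_le_mul_right _ (nat_aux1 hlt)
        _ = _ := by ring
  · have hYR : Y = R := by
      rw [Finset.not_nonempty_iff_eq_empty, Finset.sdiff_eq_empty_iff_subset] at hne
      exact hne.antisymm hR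
    subst hYR
    obtain ⟨y, hy⟩ := h.ne
    have hyJ : y ∉ J := fun h' => Finset.disjoint_left.1 h.disj h' hy
    set J' := J ∪ Y.erase y with hJ'
    have hJ'JR : J' ⊆ J ∪ Y := Finset.union_subset_union le_rfl (Finset.erase_subset _ _)
    have hyJ' : y ∉ J' := by simp [hJ', hyJ]
    have hins : J ∪ Y = insert y J' := by
      rw [hJ']
      ext z; simp only [Finset.mem_union, Finset.mem_insert, Finset.mem_erase]
      by_cases hz : z = y
      · subst hz; simp [hy]
      · simp [hz]
    set ind : En n → ℝ := fun z => if z ∈ C then 1 else 0 with hind'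
    set μ' : En n → En n → ℝ := fun w => if w = y then ind else μ w with hμ'
    have e1 : μ' y = ind := if_pos rfl
    have e2 : ∀ j ∈ J', μ' j = μ j := by
      intro j hj
      refine if_neg ?_
      rintro rfl; exact hyJ' hj
    have es : ∀ c : En n → ℝ, ∑ j ∈ J', c j • μ' j = ∑ j ∈ J ∪ Y, (if j = y then 0 else c j) • μ j := by
      intro c
      rw [hins, Finset.sum_insert hyJ', if_pos rfl, zero_smul, zero_add]
      refine Finset.sum_congr rfl (fun j hj => ?_)
      rw [e2 j hj, if_neg]
      rintro rfl; exact hyJ' hj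
    refine ⟨{y}, J', μ', ?_⟩
    refine ⟨by simpa using h.YC hy, hJ'JR.trans hJRC, by simpa using hyJ', by simp, ?_, ?_, ?_, ?_, ?_, ?_, ?_⟩
    · intro w hw z hz
      rw [Finset.mem_singleton] at hw
      subst hw
      rw [e1, hind']; exact if_neg hz
    · intro j hj z hz
      rw [e2 j hj]; exact suppJR j (hJ'JR hj) z hz
    · intro w hw z hz
      rw [Finset.mem_singleton] at hw hz
      subst hw hz
      rw [e1, if_pos rfl, hind']; exact if_pos (h.YC hy)
    · intro j hj z hz
      rw [Finset.mem_singleton] at hz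
      subst hz
      rw [e2 j hj]
      rcases Finset.mem_union.1 hj with hj | hj
      · exact h.kz j hj z hy
      · rw [h.kron j (Finset.mem_of_mem_erase hj) z hy, if_neg]
        exact (Finset.ne_of_mem_erase hj).symm
    · intro w hw
      rw [Finset.mem_singleton] at hw
      subst hw
      rw [e1]; exact ⟨hind.1.mono (by linarith), hind.2.trans (by linarith)⟩
    · intro c
      rw [es]
      have := g2 (fun j => if j = y then 0 else c j)
      beta_reduce at this
      set v := ∑ j ∈ J ∪ Y, (if j = y then 0 else c j) • μ j with hv
      have hq : 0 ≤ qn m S f x δ v := apply_nonneg _ _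
      have hle : L1 * qn m S f x δ v ≤ (L1 + L) * qn m S f x δ v := by gcongr; linarith
      refine ⟨this.1.mono hle, fun j hj => ?_⟩
      have h3 := this.2 j (hJ'JR hj)
      rw [if_neg (by rintro rfl; exact hyJ' hj)] at h3
      exact h3.trans hle
    · rw [Finset.card_singleton, one_mul, hJ', Finset.card_union_of_disjoint
        (h.disj.mono_right (Finset.erase_subset _ _)), Finset.card_erase_of_mem hy, pow_add]
      calc C.card ≤ Y.card * 2 ^ J.card := h.card
        _ ≤ 2 ^ (Y.card - 1) * 2 ^ J.card := Nat.mul_le_mul_right _ (nat_aux2 (Finset.card_pos.2 ⟨y, hy⟩))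
        _ = _ := by ring

end CmSel

namespace CmSel

lemma split_gap {n : ℕ} (C : Finset (En n)) (h : 2 ≤ C.card) : ∃ (C1 C2 : Finset (En n)) (δ : ℝ), 0 < δ ∧
    Disjoint C1 C2 ∧ C1 ∪ C2 = C ∧ C1.Nonempty ∧ C2.Nonempty ∧ (∀ z ∈ C1, ∀ w ∈ C2, δ ≤ ‖w - z‖) ∧
    ∀ z ∈ C, ∀ w ∈ C, ‖w - z‖ ≤ C.card * δ := by
  obtain ⟨u, hu, v, hv, huv⟩ := Finset.one_lt_card.1 (show 1 < C.card by omega)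
  have hne : (C ×ˢ C).Nonempty := ⟨(u, v), Finset.mk_mem_product hu hv⟩
  obtain ⟨⟨a, b⟩, hab, hmax⟩ := Finset.exists_max_image (C ×ˢ C) (fun p : En n × En n => ‖p.2 - p.1‖) hne
  obtain ⟨ha, hb⟩ := Finset.mem_product.1 hab
  simp only at ha hb hmax
  set d := ‖b - a‖ with hd
  have hd0 : 0 < d := by
    refine lt_of_lt_of_le (norm_pos_iff.2 (sub_ne_zero.2 huv.symm)) (hmax (u, v) (Finset.mk_mem_product hu hv))
  have hk : (0 : ℝ) < C.card := by exact_mod_cast (by omega : 0 < C.card)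
  set e := d / C.card with he
  have he0 : 0 < e := by positivity
  have hde : C.card * e = d := by rw [he]; field_simp
  have key : ∃ i < C.card, ∀ z ∈ C, ¬ ((i : ℝ) * e < ‖z - a‖ ∧ ‖z - a‖ ≤ ((i : ℝ) + 1) * e) := by
    by_contra hcon
    push Not at hcon
    choose! g hg using hcon
    have hinj : Set.InjOn g (Finset.range C.card : Set ℕ) := by
      have aux : ∀ i < C.card, ∀ j < C.card, i < j → g i ≠ g j := by
        intro i hi j hj hij heq
        have h1 := (hg i hi).2.2
        have h2 := (hg j hj).2.1
        rw [heq] at h1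
        have h3 : (i : ℝ) + 1 ≤ j := by exact_mod_cast hij
        have h4 : ((i : ℝ) + 1) * e ≤ j * e := by gcongr
        linarith
      intro i hi j hj heq
      have hi' : i < C.card := by simpa using hi
      have hj' : j < C.card := by simpa using hj
      rcases lt_trichotomy i j with hl | hl | hl
      · exact absurd heq (aux i hi' j hj' hl)
      · exact hl
      · exact absurd heq.symm (aux j hj' i hi' hl)
    have hmaps : ∀ i ∈ Finset.range C.card, g i ∈ C.erase a := by
      intro i hi
      have hi' : i < C.card := by simpa using hi
      refine Finset.mem_erase.2 ⟨?_, (hg i hi').1⟩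
      intro heq
      have h2 := (hg i hi').2.1
      rw [heq, sub_self, norm_zero] at h2
      have : 0 ≤ (i : ℝ) * e := by positivity
      linarith
    have := Finset.card_le_card_of_injOn g hmaps hinj
    rw [Finset.card_range, Finset.card_erase_of_mem ha] at this
    omega
  obtain ⟨i, hi, hz⟩ := key
  have hgap : ∀ z ∈ C, ¬ ‖z - a‖ ≤ (i : ℝ) * e → ((i : ℝ) + 1) * e < ‖z - a‖ := by
    intro z hzC hz1
    by_contra hcon
    exact hz z hzC ⟨not_le.1 hz1, not_lt.1 hcon⟩
  refine ⟨C.filter (fun z => ‖z - a‖ ≤ (i : ℝ) * e), C.filter (fun z => ¬ ‖z - a‖ ≤ (i : ℝ) * e), e, he0,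
    Finset.disjoint_filter_filter_not _ _ _, Finset.filter_union_filter_not_eq _ _, ⟨a, ?_⟩, ⟨b, ?_⟩, ?_, ?_⟩
  · refine Finset.mem_filter.2 ⟨ha, ?_⟩
    rw [sub_self, norm_zero]; positivity
  · refine Finset.mem_filter.2 ⟨hb, ?_⟩
    rw [not_le, ← hd, ← hde]
    have : (i : ℝ) < C.card := by exact_mod_cast hi
    gcongr
  · intro z hz1 w hw1
    obtain ⟨hz1, hz2⟩ := Finset.mem_filter.1 hz1
    obtain ⟨hw1, hw2⟩ := Finset.mem_filter.1 hw1
    have h1 := hgap w hw1 hw2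
    have h2 : ‖w - a‖ ≤ ‖w - z‖ + ‖z - a‖ := norm_sub_le_norm_sub_add_norm_sub _ _ _
    linarith
  · intro z hz1 w hw1
    rw [hde]
    exact hmax (z, w) (Finset.mk_mem_product hz1 hw1)

set_option maxHeartbeats 1000000 in
lemma cluster (m n D k : ℕ) (j : ℕ) : ∃ L : ℝ, 1 ≤ L ∧ ∀ (S C : Finset (En n)) (f : En n → (Fin D → ℝ) →ₗ[ℝ] ℝ)
    (δ : ℝ) (x : En n), Dual m S f → C ⊆ S → S.card ≤ k → C.card ≤ j → 0 < δ → δ ≤ 1 →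
    (∀ z ∈ C, ∀ w ∈ S, w ∉ C → δ ≤ ‖w - z‖) → (∀ z ∈ C, ∀ w ∈ C, ‖w - z‖ ≤ ((k : ℝ) + 1) * δ) → x ∈ C →
    ∃ Y J μ, Good m S f C x δ L Y J μ := by
  have hK : (1 : ℝ) ≤ (k : ℝ) + 1 := by
    have : (0 : ℝ) ≤ k := Nat.cast_nonneg _
    linarith
  induction j with
  | zero =>
    refine ⟨1, le_rfl, ?_⟩
    intro S C f δ x _ _ _ hC _ _ _ _ hx
    have : C = ∅ := by simpa using hC
    subst this; simp at hx
  | succ j ih =>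
    obtain ⟨L, hL, IH⟩ := ih
    obtain ⟨B, hB, HB⟩ := ind_adm m n D k ((k : ℝ) + 1) hK
    set L2 := (L + ((k : ℝ) + 1) ^ m * L) * (((Fintype.card (Ix m n D) : ℝ) + 1) * (CM m n * ((k : ℝ) + 1) ^ m)) with hL2
    have hCM := CM_ge m n
    have hL2p : 0 ≤ L2 := by positivity
    obtain ⟨L', hL', HR⟩ := Good.rescale m n D k (L2 + B) (by linarith)
    refine ⟨L' + B, by linarith, ?_⟩
    intro S C f δ x hf hCS hSk hCj hδ hδ1 hsep hdiam hx
    have hCk : C.card ≤ k := (Finset.card_le_card hCS).trans hSk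
    have hind := HB S C f δ x hf hCS hCk hδ hδ1 hsep (fun z hz => hdiam x hx z hz)
    by_cases hc : C.card ≤ 1
    · have hCx : C = {x} := by
        apply Finset.eq_singleton_iff_unique_mem.2
        exact ⟨hx, fun y hy => Finset.card_le_one.1 hc y hy x hx⟩
      refine ⟨{x}, ∅, fun _ z => if z ∈ C then 1 else 0, Good.mono (L := B) ?_ (by linarith)⟩
      refine ⟨by simpa using hx, by simp, by simp, by simp, ?_, by simp, ?_, by simp, fun _ _ => hind, ?_, by simpa using hc⟩
      · intro y _ z hz; exact if_neg hz
      · intro y hy y' hy'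
        rw [Finset.mem_singleton] at hy hy'
        subst hy hy'
        simp [hx]
      · intro c
        rw [Finset.sum_empty, map_zero, mul_zero]
        refine ⟨?_, by simp⟩
        intro φ _
        simp
    · obtain ⟨C1, C2, δ1, hδonep, hdis, hun, ⟨x1, hx1⟩, ⟨x2, hx2⟩, hgap, hdi⟩ := split_gap C (by omega)
      set η := min δ1 δ with hη
      have hηp : 0 < η := lt_min hδonep hδ
      have hη1 : η ≤ δ1 := min_le_left _ _
      have hηδ : η ≤ δ := min_le_right _ _
      have hC1 : C1 ⊆ C := hun ▸ Finset.subset_union_left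
      have hC2 : C2 ⊆ C := hun ▸ Finset.subset_union_right
      have hcard : C1.card + C2.card = C.card := by rw [← hun, Finset.card_union_of_disjoint hdis]
      have hp1 : 0 < C1.card := Finset.card_pos.2 ⟨x1, hx1⟩
      have hp2 : 0 < C2.card := Finset.card_pos.2 ⟨x2, hx2⟩
      have hdiamη : ∀ z ∈ C, ∀ w ∈ C, ‖w - z‖ ≤ ((k : ℝ) + 1) * η := by
        intro z hz w hw
        rcases min_choice δ1 δ with h | h
        · rw [hη, h]
          refine (hdi z hz w hw).trans ?_
          have : (C.card : ℝ) ≤ k := by exact_mod_cast hCk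
          gcongr; linarith
        · rw [hη, h]; exact hdiam z hz w hw
      have hmem : ∀ w ∈ C, w ∈ C1 ∨ w ∈ C2 := fun w hw => by rw [← hun] at hw; exact Finset.mem_union.1 hw
      obtain ⟨Y1, J1, μ1, g1⟩ := IH S C1 f η x1 hf (hC1.trans hCS) hSk (by omega) hηp (hηδ.trans hδ1)
        (fun z hz w hw hwC => by
          by_cases hwC' : w ∈ C
          · exact hη1.trans (hgap z hz w ((hmem w hwC').resolve_left hwC))
          · exact hηδ.trans (hsep z (hC1 hz) w hw hwC'))
        (fun z hz w hw => hdiamη z (hC1 hz) w (hC1 hw)) hx1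
      obtain ⟨Y2, J2, μ2, g2⟩ := IH S C2 f η x2 hf (hC2.trans hCS) hSk (by omega) hηp (hηδ.trans hδ1)
        (fun z hz w hw hwC => by
          by_cases hwC' : w ∈ C
          · rw [norm_sub_rev]; exact hη1.trans (hgap w ((hmem w hwC').resolve_right hwC) z hz)
          · exact hηδ.trans (hsep z (hC2 hz) w hw hwC'))
        (fun z hz w hw => hdiamη z (hC2 hz) w (hC2 hw)) hx2
      have g1' := g1.move hL hηp hK (hdiamη x1 (hC1 hx1) x hx)
      have g2' := g2.move hL hηp hK (hdiamη x2 (hC2 hx2) x hx)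
      obtain ⟨Y, J, μ, g⟩ := g1'.merge g2' hdis
      rw [hun] at g
      obtain ⟨Y', J', μ', g'⟩ := HR S C f x η δ hηp hηδ hCk ⟨Y, J, μ, g.mono (by linarith)⟩
        ⟨hind.1.mono (by linarith), hind.2.trans (by linarith)⟩
      exact ⟨Y', J', μ', g'.mono (by linarith)⟩

lemma Good.card_J {m n D : ℕ} {S C : Finset (En n)} {f : En n → (Fin D → ℝ) →ₗ[ℝ] ℝ} {x : En n} {δ L : ℝ}
    {Y J : Finset (En n)} {μ : En n → En n → ℝ} (h : Good m S f C x δ L Y J μ) : J.card ≤ Fintype.card (Ix m n D) := by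
  have hli : LinearIndependent ℝ (fun j : J => (fun b : Ix m n D => Gn m S f (μ j) (eb x δ b))) := by
    rw [Fintype.linearIndependent_iff]
    intro g hg j
    set c : En n → ℝ := fun z => if hz : z ∈ J then g ⟨z, hz⟩ else 0 with hc
    have hcg : ∀ j : J, c j = g j := fun j => by rw [hc]; simp
    have hq : qn m S f x δ (∑ j ∈ J, c j • μ j) = 0 := by
      rw [qn_def]
      refine Finset.sum_eq_zero (fun b _ => ?_)
      rw [abs_eq_zero]
      have h1 := congrFun hg b
      rw [Finset.sum_apply] at h1
      rw [← Finset.sum_coe_sort J (fun j => c j • μ j)]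
      have h2 : ∀ T : Finset J, Gn m S f (∑ j ∈ T, c j • μ j) (eb x δ b) = ∑ j ∈ T, c j * Gn m S f (μ j) (eb x δ b) := by
        intro T
        induction T using Finset.induction_on with
        | empty => simp [Gn]
        | insert a T ha ih => rw [Finset.sum_insert ha, Finset.sum_insert ha, Gn_add_left, Gn_smul_left, ih]
      rw [h2]
      rw [← h1.trans (Pi.zero_apply b)]
      refine Finset.sum_congr rfl (fun j _ => ?_)
      rw [hcg]; rfl
    have := (h.a2 c).2 j j.2
    rw [hq, mul_zero, hcg] at this
    exact abs_eq_zero.1 (le_antisymm this (abs_nonneg _))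
  have := hli.fintype_card_le_finrank
  simpa using this

lemma Jet.bd_one {m n D : ℕ} {F : En n → Fin D → ℝ} {x : En n} {p : Jt m n D} (hp : Jet F x p) (hF : NB m F 1) :
    Bd x 1 1 p := by
  intro b
  refine (co_le_iter p x b).trans ?_
  have hb := od_lt b
  have hks : ((od b : ℕ) : WithTop ℕ∞) ≤ m := by exact_mod_cast hb.le
  have h1 := hp (od b) hb
  rw [iteratedFDeriv_sub_apply (hF.1.of_le hks).contDiffAt (contDiff_pl p _).contDiffAt, sub_eq_zero] at h1
  rw [← h1, one_pow, mul_one]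
  exact hF.2 _ hb.le x

set_option maxHeartbeats 1000000 in
lemma sparsify (m n D k : ℕ) : ∃ B : ℝ, 1 ≤ B ∧ ∀ (S : Finset (En n)) (f : En n → (Fin D → ℝ) →ₗ[ℝ] ℝ),
    S.card ≤ k → 2 ^ Fintype.card (Ix m n D) < S.card → Dual m S f →
    ∃ μ : En n → ℝ, (∀ x ∈ S, 0 ≤ μ x ∧ μ x ≤ 1) ∧ (∃ x ∈ S, μ x = 0) ∧ (∃ x ∈ S, μ x = 1) ∧
      ∀ F : En n → Fin D → ℝ, NB m F 1 → |∑ x ∈ S, μ x * f x (F x)| ≤ B := by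
  obtain ⟨B, hB, HB⟩ := dual_cut m n D k
  obtain ⟨L, hL, HL⟩ := cluster m n D k k
  refine ⟨B + 3 * L, by linarith, ?_⟩
  intro S f hSk hS hf
  have h1p : 1 ≤ 2 ^ Fintype.card (Ix m n D) := Nat.one_le_two_pow
  obtain ⟨C1, C2, δ, hδ, hdis, hun, ⟨x1, hx1⟩, ⟨x2, hx2⟩, hgap, hdi⟩ := split_gap S (by omega)
  have hC1 : C1 ⊆ S := hun ▸ Finset.subset_union_left
  have hC2 : C2 ⊆ S := hun ▸ Finset.subset_union_right
  have hmem : ∀ w ∈ S, w ∈ C1 ∨ w ∈ C2 := fun w hw => by rw [← hun] at hw; exact Finset.mem_union.1 hw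
  by_cases hδ1 : 1 ≤ δ
  · refine ⟨fun z => if z ∈ C1 then 1 else 0, ?_, ⟨x2, hC2 hx2, if_neg (fun h => Finset.disjoint_left.1 hdis h hx2)⟩,
      ⟨x1, hC1 hx1, if_pos hx1⟩, ?_⟩
    · intro x _
      beta_reduce
      split_ifs <;> norm_num
    · intro F hF
      have h2 := HB S C1 f 1 1 F hf hC1 ((Finset.card_le_card hC1).trans hSk) one_pos le_rfl
        (fun z hz w hw hwC => hδ1.trans (hgap z hz w ((hmem w hw).resolve_left hwC))) hF.1 one_pos
        (fun y _ i hi => by simpa using hF.2 i hi y)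
      have e : ∑ x ∈ S, (if x ∈ C1 then (1 : ℝ) else 0) * f x (F x) = ∑ z ∈ C1, f z (F z) := by
        simp only [ite_mul, one_mul, zero_mul]
        rw [← Finset.sum_filter, Finset.filter_mem_eq_inter, Finset.inter_eq_right.2 hC1]
      rw [e]
      linarith
  · have hx1S := hC1 hx1
    obtain ⟨Y, J, μ, g⟩ := HL S S f 1 x1 hf le_rfl hSk hSk one_pos le_rfl (fun z _ w hw hw' => absurd hw hw')
      (fun z hz w hw => by
        refine (hdi z hz w hw).trans ?_
        have : (S.card : ℝ) ≤ k := by exact_mod_cast hSk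
        have h0 : (0 : ℝ) ≤ S.card := Nat.cast_nonneg _
        nlinarith) hx1S
    have hY : 1 < Y.card := by
      by_contra hcon
      have h1 : Y.card * 2 ^ J.card ≤ 1 * 2 ^ Fintype.card (Ix m n D) :=
        Nat.mul_le_mul (by omega) (Nat.pow_le_pow_right (by norm_num) g.card_J)
      have := g.card
      omega
    obtain ⟨y, hy, y', hy', hyy⟩ := Finset.one_lt_card.1 hY
    have v1 : μ y y = 1 := by rw [g.kron y hy y hy, if_pos rfl]
    have v0 : μ y y' = 0 := by rw [g.kron y hy y' hy', if_neg hyy.symm]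
    obtain ⟨a1, a2⟩ := g.a1 y hy
    rw [adm_iff] at a1
    set ν := μ y with hν
    obtain ⟨z0, hz0, hmin⟩ := Finset.exists_min_image S ν ⟨x1, hx1S⟩
    obtain ⟨z1, hz1, hmax⟩ := Finset.exists_max_image S ν ⟨x1, hx1S⟩
    have hosc : 1 ≤ ν z1 - ν z0 := by
      have h1 := hmin y' (g.YC hy')
      have h2 := hmax y (g.YC hy)
      linarith
    set t := ν z1 - ν z0 with ht
    have ht0 : 0 < t := by linarith
    refine ⟨fun z => (ν z - ν z0) / t, ?_, ⟨z0, hz0, by simp⟩, ⟨z1, hz1, div_self ht0.ne'⟩, ?_⟩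
    · intro x hx
      refine ⟨div_nonneg (sub_nonneg.2 (hmin x hx)) ht0.le, ?_⟩
      rw [div_le_one ht0]
      have := hmax x hx
      linarith
    · intro F hF
      obtain ⟨p, hp⟩ := Jet.exists hF.1 x1
      have b1 := a1.2 F p hF hp
      have b2 := Gn_le_qn S f one_pos ν (hp.bd_one hF)
      have b3 := hf F hF
      have b4 := a1.1 z0
      have e : ∑ x ∈ S, (ν x - ν z0) / t * f x (F x) =
          (∑ z ∈ S, ν z * f z (F z - pl p z) + Gn m S f ν p - ν z0 * ∑ x ∈ S, f x (F x)) / t := by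
        rw [Gn, ← Finset.sum_add_distrib, Finset.mul_sum, ← Finset.sum_sub_distrib, Finset.sum_div]
        refine Finset.sum_congr rfl (fun z _ => ?_)
        rw [map_sub]; ring
      rw [e, abs_div, abs_of_pos ht0]
      have b5 : |ν z0 * ∑ x ∈ S, f x (F x)| ≤ L := by
        rw [abs_mul]
        have := mul_le_mul b4 b3 (abs_nonneg _) (by linarith)
        linarith
      have b6 := abs_sub (∑ z ∈ S, ν z * f z (F z - pl p z) + Gn m S f ν p) (ν z0 * ∑ x ∈ S, f x (F x))
      have b7 := abs_add_le (∑ z ∈ S, ν z * f z (F z - pl p z)) (Gn m S f ν p)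
      exact (div_le_self (abs_nonneg _) hosc).trans (by linarith)

end CmSel

namespace CmSel

lemma NB_sum {m n D : ℕ} {ι : Type*} (T : Finset ι) (G : ι → En n → Fin D → ℝ) (M : ℝ) (h : ∀ i ∈ T, NB m (G i) M) :
    NB m (∑ i ∈ T, G i) (T.card * M) := by
  induction T using Finset.induction_on with
  | empty => simpa using NB.zero (m := m) (n := n) (D := D) le_rfl
  | insert a T ha ih =>
    rw [Finset.sum_insert ha, Finset.card_insert_of_notMem ha]
    have := (h a (Finset.mem_insert_self _ _)).add (ih (fun i hi => h i (Finset.mem_insert_of_mem hi)))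
    refine this.mono (le_of_eq ?_)
    push_cast; ring

lemma interp {n : ℕ} (m D : ℕ) (S : Finset (En n)) : ∃ N : ℝ, 0 < N ∧ ∀ (g : S → Fin D → ℝ) (ε : ℝ), 0 ≤ ε → (∀ x, ‖g x‖ ≤ ε) →
    ∃ G : En n → Fin D → ℝ, NB m G (N * ε) ∧ ∀ x : S, G x = g x := by
  obtain ⟨r0, hr0, hsep⟩ := exists_sep S
  set r := min r0 1 with hr
  have hrp : 0 < r := lt_min hr0 one_pos
  have hr1 : r ≤ 1 := min_le_right _ _
  have hrr : r ≤ r0 := min_le_left _ _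
  have hBB := BB_ge m n
  have hBr : 0 ≤ BB m n / r ^ m := by positivity
  refine ⟨((Finset.univ : Finset S).card + 1) * (BB m n / r ^ m), by positivity, ?_⟩
  intro g ε hε hg
  refine ⟨∑ x : S, fun y => bump (x : En n) r y • g x, ?_, ?_⟩
  · have h1 : ∀ x ∈ (Finset.univ : Finset S), NB m (fun y => bump (x : En n) r y • g x) (BB m n / r ^ m * ε) := by
      intro x _
      refine ⟨(bump_contDiff _ r m).smul contDiff_const, fun k hk y => ?_⟩
      have e : (fun y => bump (x : En n) r y • g x) = ((ContinuousLinearMap.id ℝ ℝ).smulRight (g x)) ∘ bump (x : En n) r := by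
        funext y; simp
      rw [e]
      refine (ContinuousLinearMap.norm_iteratedFDeriv_comp_left _ (bump_contDiff _ r k).contDiffAt le_rfl).trans ?_
      rw [ContinuousLinearMap.norm_smulRight_apply, mul_comm]
      refine mul_le_mul ?_ ?_ (by positivity) hBr
      · refine (bump_bound (m := m) _ hrp hk y).trans ?_
        refine div_le_div_of_nonneg_left (by linarith) (by positivity) (pow_le_pow_of_le_one hrp.le hr1 hk)
      · have : ‖ContinuousLinearMap.id ℝ ℝ‖ = 1 := ContinuousLinearMap.norm_id
        rw [this, one_mul]; exact hg x
    refine (NB_sum _ _ _ h1).mono ?_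
    have : 0 ≤ BB m n / r ^ m * ε := by positivity
    linarith
  · intro x
    rw [Finset.sum_apply, Finset.sum_eq_single x]
    · rw [bump_one hrp (by simpa using hrp.le), one_smul]
    · intro b _ hb
      rw [bump_zero hrp, zero_smul]
      by_contra hcon
      push Not at hcon
      exact hb (Subtype.ext (hsep x x.2 b b.2 (by linarith)).symm)
    · simp

set_option maxHeartbeats 1000000 in
lemma step_one (m n D k : ℕ) (hk : 2 ^ Fintype.card (Ix m n D) ≤ k) : ∃ C : ℝ, 1 ≤ C ∧ ∀ (S : Finset (En n))
    (K : En n → Set (Fin D → ℝ)), S.card ≤ k + 1 → (∀ x ∈ S, Convex ℝ (K x)) →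
    (∀ S' ⊆ S, S'.card ≤ k → ∃ F, NB m F 1 ∧ ∀ x ∈ S', F x ∈ K x) → ∃ F, NB m F C ∧ ∀ x ∈ S, F x ∈ K x := by
  obtain ⟨B, hB, HB⟩ := sparsify m n D (k + 1)
  set C := 2 * B + 2 with hC
  have hC0 : 0 < C := by linarith
  refine ⟨C, by linarith, ?_⟩
  intro S K hSk hconv hsub
  by_cases hS : S.card ≤ k
  · obtain ⟨F, hF, hFK⟩ := hsub S le_rfl hS
    exact ⟨F, hF.mono (by linarith), hFK⟩
  by_contra hno
  set A : Set (S → Fin D → ℝ) := {h | ∃ (F : En n → Fin D → ℝ) (M : ℝ), M < C ∧ NB m F M ∧ ∀ x : S, F x = h x} with hA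
  set Bs : Set (S → Fin D → ℝ) := Set.pi Set.univ (fun x : S => K x) with hBs
  have cA : Convex ℝ A := by
    rintro h ⟨F, M, hM, hF, hFh⟩ h' ⟨F', M', hM', hF', hFh'⟩ a b ha hb hab
    refine ⟨a • F + b • F', max M M', max_lt hM hM',
      (hF.mono (le_max_left _ _)).convex (hF'.mono (le_max_right _ _)) ha hb hab, fun x => ?_⟩
    simp [hFh, hFh']
  have oA : IsOpen A := by
    rw [Metric.isOpen_iff]
    rintro h ⟨F, M, hM, hF, hFh⟩
    obtain ⟨N, hN, HN⟩ := interp m D S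
    refine ⟨(C - M) / (2 * N), div_pos (by linarith) (by linarith), ?_⟩
    intro h' hh'
    rw [mem_ball_iff_norm] at hh'
    obtain ⟨G, hG, hGx⟩ := HN (h' - h) ((C - M) / (2 * N)) (div_nonneg (by linarith) (by linarith))
      (fun x => (norm_le_pi_norm _ x).trans hh'.le)
    refine ⟨F + G, _, ?_, hF.add hG, fun x => ?_⟩
    · have : N * ((C - M) / (2 * N)) = (C - M) / 2 := by field_simp
      rw [this]; linarith
    · rw [Pi.add_apply, hFh, hGx, Pi.sub_apply]; abel
  have cB : Convex ℝ Bs := convex_pi (fun x _ => hconv x x.2)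
  have dAB : Disjoint A Bs := by
    rw [Set.disjoint_left]
    rintro h ⟨F, M, hM, hF, hFh⟩ hb
    refine hno ⟨F, hF.mono hM.le, fun x hx => ?_⟩
    have := hb ⟨x, hx⟩ trivial
    rw [← hFh] at this
    exact this
  obtain ⟨φ, u, hu1, hu2⟩ := geometric_hahn_banach_open cA oA cB dAB
  have hu : 0 < u := by
    have := hu1 0 ⟨0, 0, hC0, NB.zero le_rfl, fun x => rfl⟩
    simpa using this
  have hle : ∀ F : En n → Fin D → ℝ, NB m F 1 → C * φ (fun x : S => F x) ≤ u := by
    intro F hF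
    by_contra hcon
    push Not at hcon
    set t := φ (fun x : S => F x) with ht
    have ht0 : 0 < t := by
      by_contra h0
      nlinarith
    have h1 : u / t < C := by rwa [div_lt_iff₀ ht0]
    have h2 := hu1 ((u / t) • (fun x : S => F x)) ⟨(u / t) • F, |u / t| * 1, by
      rw [abs_of_pos (by positivity), mul_one]; exact h1, hF.smul _, fun x => rfl⟩
    rw [map_smul, smul_eq_mul, ← ht, div_mul_cancel₀ _ ht0.ne'] at h2
    exact lt_irrefl _ h2
  set f : En n → (Fin D → ℝ) →ₗ[ℝ] ℝ := fun x => if hx : x ∈ S then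
    (C / u) • (φ.toLinearMap ∘ₗ LinearMap.single ℝ (fun _ : S => Fin D → ℝ) ⟨x, hx⟩) else 0 with hf
  have fsum : ∀ F : En n → Fin D → ℝ, ∑ x ∈ S, f x (F x) = C / u * φ (fun x : S => F x) := by
    intro F
    have e : (fun x : S => F x) = ∑ x : S, Pi.single x (F x) := (Finset.univ_sum_single _).symm
    rw [e, map_sum, Finset.mul_sum, ← Finset.sum_coe_sort S]
    refine Finset.sum_congr rfl (fun x _ => ?_)
    rw [hf]
    simp
  have hdual : Dual m S f := by
    intro F hF
    rw [fsum, abs_le]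
    have h1 := hle F hF
    have h2 := hle (-F) (by have := hF.smul (-1); simpa using this)
    have e : (fun x : S => (-F) x) = -(fun x : S => F x) := rfl
    rw [e, map_neg] at h2
    constructor
    · rw [div_mul_eq_mul_div, le_div_iff₀ hu]; linarith
    · rw [div_mul_eq_mul_div, div_le_iff₀ hu]; linarith
  obtain ⟨μ, hμ, ⟨x0, hx0, hμ0⟩, ⟨x1, hx1, hμ1⟩, hμB⟩ := HB S f hSk (by omega) hdual
  have h01 : x0 ≠ x1 := by
    rintro rfl
    rw [hμ0] at hμ1; norm_num at hμ1
  obtain ⟨F, hF, hFK⟩ := hsub (S.erase x0) (Finset.erase_subset _ _) (by rw [Finset.card_erase_of_mem hx0]; omega)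
  obtain ⟨F', hF', hFK'⟩ := hsub (S.erase x1) (Finset.erase_subset _ _) (by rw [Finset.card_erase_of_mem hx1]; omega)
  set g : En n → Fin D → ℝ := fun x => μ x • F x + (1 - μ x) • F' x with hg
  have hgK : (fun x : S => g x) ∈ Bs := by
    rintro ⟨x, hx⟩ -
    change μ x • F x + (1 - μ x) • F' x ∈ K x
    by_cases e0 : x = x0
    · subst e0
      rw [hμ0, zero_smul, zero_add, sub_zero, one_smul]
      exact hFK' x (Finset.mem_erase.2 ⟨h01, hx⟩)
    by_cases e1 : x = x1
    · subst e1
      rw [hμ1, one_smul, sub_self, zero_smul, add_zero]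
      exact hFK x (Finset.mem_erase.2 ⟨e0, hx⟩)
    exact hconv x hx (hFK x (Finset.mem_erase.2 ⟨e0, hx⟩)) (hFK' x (Finset.mem_erase.2 ⟨e1, hx⟩))
      (hμ x hx).1 (by linarith [(hμ x hx).2]) (by ring)
  have h1 := hu2 _ hgK
  have h2 : C ≤ ∑ x ∈ S, f x (g x) := by
    rw [fsum, div_mul_eq_mul_div, le_div_iff₀ hu]
    gcongr
  have h3 : ∑ x ∈ S, f x (g x) = ∑ x ∈ S, μ x * f x (F x) + ∑ x ∈ S, f x (F' x) - ∑ x ∈ S, μ x * f x (F' x) := by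
    rw [← Finset.sum_add_distrib, ← Finset.sum_sub_distrib]
    refine Finset.sum_congr rfl (fun x _ => ?_)
    rw [hg, map_add, map_smul, map_smul, smul_eq_mul, smul_eq_mul]; ring
  have b1 := (abs_le.1 (hμB F hF)).2
  have b2 := (abs_le.1 (hμB F' hF')).1
  have b3 := (abs_le.1 (hdual F' hF')).2
  linarith

/-- rescaling of the target sets -/
lemma nb_unscale {m n D : ℕ} {F : En n → Fin D → ℝ} {M c : ℝ} (hc : 0 < c) (h : NB m F M) : NB m (c • F) (c * M) := by
  have := h.smul c
  rwa [abs_of_pos hc] at this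

lemma iter_step (m n D : ℕ) (j : ℕ) : ∃ C : ℝ, 1 ≤ C ∧ ∀ (S : Finset (En n)) (K : En n → Set (Fin D → ℝ)),
    S.card ≤ 2 ^ Fintype.card (Ix m n D) + j → (∀ x ∈ S, Convex ℝ (K x)) →
    (∀ S' ⊆ S, S'.card ≤ 2 ^ Fintype.card (Ix m n D) → ∃ F, NB m F 1 ∧ ∀ x ∈ S', F x ∈ K x) →
    ∃ F, NB m F C ∧ ∀ x ∈ S, F x ∈ K x := by
  induction j with
  | zero => exact ⟨1, le_rfl, fun S K hS _ h => h S le_rfl hS⟩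
  | succ j ih =>
    obtain ⟨C, hC, H⟩ := ih
    obtain ⟨C', hC', H'⟩ := step_one m n D (2 ^ Fintype.card (Ix m n D) + j) (by omega)
    have hC0 : 0 < C := by linarith
    refine ⟨C * C', by nlinarith, ?_⟩
    intro S K hS hconv hsub
    obtain ⟨F, hF, hFK⟩ := H' S (fun x => (fun z => C • z) ⁻¹' K x) hS (fun x hx => (hconv x hx).smul_preimage C) (by
      intro S' hS' hc
      obtain ⟨F, hF, hFK⟩ := H S' K hc (fun x hx => hconv x (hS' hx)) (fun S'' h1 h2 => hsub S'' (h1.trans hS') h2)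
      refine ⟨C⁻¹ • F, ?_, fun x hx => ?_⟩
      · have := nb_unscale (inv_pos.2 hC0) hF
        rwa [inv_mul_cancel₀ hC0.ne'] at this
      · change C • (C⁻¹ • F x) ∈ K x
        rw [smul_inv_smul₀ hC0.ne']; exact hFK x hx)
    exact ⟨C • F, nb_unscale hC0 hF, hFK⟩

theorem fp_final (m n D : ℕ) (hm : 1 ≤ m) (hn : 1 ≤ n) : ∃ Csharp : ℝ, 0 < Csharp ∧
      ∀ E : Finset (En n), ∀ K : En n → Set (Fin D → ℝ),
        (∀ x ∈ E, Convex ℝ (K x)) →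
        (∀ S : Finset (En n), S ⊆ E → S.card ≤ 2 ^ (D * Nat.choose (n + m - 1) n) →
          ∃ F : En n → Fin D → ℝ, ContDiff ℝ m F ∧ CmLE m F 1 ∧ ∀ x ∈ S, F x ∈ K x) →
        ∃ F : En n → Fin D → ℝ, ContDiff ℝ m F ∧ CmLE m F Csharp ∧ ∀ x ∈ E, F x ∈ K x := by
  obtain ⟨k0, C, hC, H⟩ := fp_big (m := m) (n := n) D hm hn
  obtain ⟨C', hC', H'⟩ := iter_step m n D k0
  have hnR : (0 : ℝ) < n := by exact_mod_cast hn
  set c : ℝ := (n : ℝ) ^ m with hc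
  have hc0 : 0 < c := by positivity
  set t := c * C' with ht
  have ht0 : 0 < t := by positivity
  refine ⟨t * C, by positivity, ?_⟩
  intro E K hconv hsub
  obtain ⟨F, hF, hFK⟩ := H E (fun x => (fun z => t • z) ⁻¹' K x) (fun x hx => (hconv x hx).smul_preimage t) (by
    intro S hS hSk
    obtain ⟨F, hF, hFK⟩ := H' S (fun x => (fun z => c • z) ⁻¹' K x) (hSk.trans (Nat.le_add_left _ _))
      (fun x hx => (hconv x (hS hx)).smul_preimage c) (by
        intro S' hS' hc'
        obtain ⟨F, hF1, hF2, hFK⟩ := hsub S' (hS'.trans hS)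
          (hc'.trans (Nat.pow_le_pow_right (by norm_num) (card_Ix_le m n D hm)))
        have hF := NB_of_cmLE hn zero_le_one hF1 hF2
        refine ⟨c⁻¹ • F, ?_, fun x hx => ?_⟩
        · have := nb_unscale (inv_pos.2 hc0) hF
          rwa [← hc, mul_one, inv_mul_cancel₀ hc0.ne'] at this
        · change c • (c⁻¹ • F x) ∈ K x
          rw [smul_inv_smul₀ hc0.ne']; exact hFK x hx)
    have hC0 : 0 < C' := by linarith
    refine ⟨C'⁻¹ • F, ?_, fun x hx => ?_⟩
    · have := nb_unscale (inv_pos.2 hC0) hF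
      rwa [inv_mul_cancel₀ hC0.ne'] at this
    · change t • (C'⁻¹ • F x) ∈ K x
      rw [ht, mul_smul, smul_inv_smul₀ hC0.ne']; exact hFK x hx)
  have hN := nb_unscale ht0 hF
  exact ⟨t • F, hN.1, hN.cmLE, hFK⟩

end CmSel

/-- **Finiteness principle for `C^m` selection** with finiteness number
`k♯ = 2^(D·binom(n+m-1,n))`. -/
theorem cm_selection_finiteness_principle
    (m n D : ℕ) (hm : 1 ≤ m) (hn : 1 ≤ n) (hD : 1 ≤ D) :
    ∃ Csharp : ℝ, 0 < Csharp ∧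
      ∀ E : Finset (En n), ∀ K : En n → Set (Fin D → ℝ),
        (∀ x ∈ E, Convex ℝ (K x)) →
        (∀ S : Finset (En n), S ⊆ E → S.card ≤ 2 ^ (D * Nat.choose (n + m - 1) n) →
          ∃ F : En n → Fin D → ℝ, ContDiff ℝ m F ∧ CmLE m F 1 ∧ ∀ x ∈ S, F x ∈ K x) →
        ∃ F : En n → Fin D → ℝ, ContDiff ℝ m F ∧ CmLE m F Csharp ∧ ∀ x ∈ E, F x ∈ K x := by
  exact CmSel.fp_final m n D hm hn
end
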